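/- Suppose condition (B_p) holds for some p > 4, and conditions (Q_∞) and (M_L) hold, with the limit matrix q in (Q_∞) aperiodic. Suppose also Σ_{i∈S} (2c_i + s_i²)π(i) > 0. Then for every x ≥ 0, lim_{n→∞} P[n^{−1/2} Y_n ≤ x] = F_{α,θ}(x √π(0)), where α = 1/2 + (Σ_{i∈S} c_i π(i))/(Σ_{i∈S} s_i² π(i)) and θ = 2 Σ_{i∈S} s_i² π(i). -/

import Mathlib

open MeasureTheory Filter Topology Asymptotics
open scoped ENNReal NNReal

/-- A time-homogeneous Markov chain on a measurable state space `E`, encoded via the family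
`P z` of laws (on trajectory space) of the chain started at `z`.  The field `markov` is the
time-homogeneous Markov property: conditionally on the event `{ω n = w}` intersected with any
event `B` depending only on the first `n+1` coordinates, the shifted trajectory has law `P w`. -/
structure MChain (E : Type*) [MeasurableSpace E] where
  P : E → MeasureTheory.Measure (ℕ → E)
  isProb : ∀ z, MeasureTheory.IsProbabilityMeasure (P z)
  init : ∀ z, P z {ω | ω 0 = z} = 1
  markov : ∀ (z : E) (n : ℕ) (w : E) (A B : Set (ℕ → E)), MeasurableSet A →
    (∀ ω ω' : ℕ → E, (∀ k, k ≤ n → ω k = ω' k) → ω ∈ B → ω' ∈ B) →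
    P z (B ∩ {ω | ω n = w} ∩ {ω | (fun k => ω (n + k)) ∈ A})
      = P z (B ∩ {ω | ω n = w}) * P w A

namespace MChain

variable {E : Type*} [MeasurableSpace E]

/-- Irreducibility: every state can be reached from every state with positive probability. -/
def Irreducible (X : MChain E) : Prop := ∀ z w : E, ∃ n : ℕ, X.P z {ω | ω n = w} ≠ 0

/-- Recurrence: from every state, the chain returns to it almost surely. -/
def Recurrent (X : MChain E) : Prop := ∀ z : E, X.P z {ω | ∃ n, 1 ≤ n ∧ ω n = z} = 1

def Transient (X : MChain E) : Prop := ¬ X.Recurrent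

/-- The first return time to `z` (with junk value `0`, via `sInf ∅ = 0`, if there is no return). -/
noncomputable def returnTime (z : E) (ω : ℕ → E) : ℕ := sInf {n | 1 ≤ n ∧ ω n = z}

/-- Positive recurrence: recurrent, with finite mean return times. -/
def PositiveRecurrent (X : MChain E) : Prop :=
  X.Recurrent ∧ ∀ z : E, (∫⁻ ω, (returnTime z ω : ℝ≥0∞) ∂(X.P z)) ≠ ⊤

def NullRecurrent (X : MChain E) : Prop := X.Recurrent ∧ ¬ X.PositiveRecurrent

end MChain

section HalfStrip

variable {S : Type*} [Fintype S] [DecidableEq S] [Nonempty S]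
  [MeasurableSpace S] [MeasurableSingletonClass S]

/-- `qhat X x i j` is the probability that the `S`-coordinate moves from `i` to `j` when the
`ℕ`-coordinate is at `x`; this is `q_x(i,j) = Σ_y p(x,i,y,j)` of the paper. -/
noncomputable def qhat (X : MChain (ℕ × S)) (x : ℕ) (i j : S) : ℝ :=
  (X.P (x, i) {ω | (ω 1).2 = j}).toReal

/-- `stepMoment X k x i = μ_k(x,i) = E[(X_{n+1}-X_n)^k | X_n = x, η_n = i]`. -/
noncomputable def stepMoment (X : MChain (ℕ × S)) (k : ℕ) (x : ℕ) (i : S) : ℝ :=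
  ∫ ω, (((ω 1).1 : ℝ) - (x : ℝ)) ^ k ∂(X.P (x, i))

/-- Condition (B_p): uniformly bounded conditional `p`-th moments of the jumps of the
`ℕ`-coordinate (by the Markov property, the conditional moment given `F_n` is a function of
the current state only). -/
def CondB (X : MChain (ℕ × S)) (p : ℝ) : Prop :=
  ∃ C : ℝ≥0∞, C ≠ ⊤ ∧ ∀ (x : ℕ) (i : S),
    (∫⁻ ω, ENNReal.ofReal (|((ω 1).1 : ℝ) - (x : ℝ)| ^ p) ∂(X.P (x, i))) ≤ C

def IsStochasticMatrix (Q : S → S → ℝ) : Prop :=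
  (∀ i j, 0 ≤ Q i j) ∧ ∀ i, (∑ j, Q i j) = 1

def IsIrreducibleMatrix (Q : S → S → ℝ) : Prop :=
  ∀ i j, ∃ n : ℕ, 0 < ((Matrix.of Q) ^ n) i j

/-- Aperiodicity (for a finite irreducible stochastic matrix, eventual positivity of the
diagonal entries of the powers is equivalent to aperiodicity). -/
def IsAperiodicMatrix (Q : S → S → ℝ) : Prop :=
  ∀ i, ∃ N : ℕ, ∀ n, N ≤ n → 0 < ((Matrix.of Q) ^ n) i i

/-- `pst` is a (strictly positive) stationary distribution for `Q`. -/
def IsStationaryDist (Q : S → S → ℝ) (pst : S → ℝ) : Prop :=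
  (∀ i, 0 < pst i) ∧ (∑ i, pst i) = 1 ∧ ∀ j, (∑ i, pst i * Q i j) = pst j

/-- Condition (Q_∞): the transition matrix of the `S`-coordinate converges as `x → ∞` to an
irreducible stochastic matrix `Q`. -/
def CondQ (X : MChain (ℕ × S)) (Q : S → S → ℝ) : Prop :=
  (∀ i j, Tendsto (fun x : ℕ => qhat X x i j) atTop (nhds (Q i j))) ∧
    IsStochasticMatrix Q ∧ IsIrreducibleMatrix Q

/-- Condition (Q_∞^+): as (Q_∞), with a power-law rate of convergence. -/
def CondQplus (X : MChain (ℕ × S)) (Q : S → S → ℝ) : Prop :=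
  (∃ δ₀ : ℝ, 0 < δ₀ ∧ ∀ i j,
      (fun x : ℕ => qhat X x i j - Q i j) =O[atTop] fun x : ℕ => (x : ℝ) ^ (-δ₀)) ∧
    IsStochasticMatrix Q ∧ IsIrreducibleMatrix Q

/-- Condition (M_C): asymptotically constant drifts, `μ₁(x,i) = d_i + o(1)`. -/
def CondMC (X : MChain (ℕ × S)) (d : S → ℝ) : Prop :=
  ∀ i, Tendsto (fun x : ℕ => stepMoment X 1 x i) atTop (nhds (d i))

/-- Condition (M_L): Lamperti-type drifts, `μ₁(x,i) = c_i/x + o(1/x)`, `μ₂(x,i) = s_i² + o(1)`,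
with at least one `s_i²` nonzero. -/
def CondML (X : MChain (ℕ × S)) (c s2 : S → ℝ) : Prop :=
  (∀ i, 0 ≤ s2 i) ∧ (∃ i, s2 i ≠ 0) ∧
    (∀ i, Tendsto (fun x : ℕ => (x : ℝ) * stepMoment X 1 x i) atTop (nhds (c i))) ∧
    (∀ i, Tendsto (fun x : ℕ => stepMoment X 2 x i) atTop (nhds (s2 i)))

/-- Condition (M_L^+): Lamperti-type drifts with power-law error bounds. -/
def CondMLplus (X : MChain (ℕ × S)) (c s2 : S → ℝ) : Prop :=
  (∀ i, 0 ≤ s2 i) ∧ (∃ i, s2 i ≠ 0) ∧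
    ∃ δ₁ : ℝ, 0 < δ₁ ∧ ∀ i,
      ((fun x : ℕ => stepMoment X 1 x i - c i / (x : ℝ)) =O[atTop]
        fun x : ℕ => (x : ℝ) ^ (-1 - δ₁)) ∧
      ((fun x : ℕ => stepMoment X 2 x i - s2 i) =O[atTop] fun x : ℕ => (x : ℝ) ^ (-δ₁))

/-- Successive visit times `τ_0 < τ_1 < ⋯` of the `S`-coordinate to the distinguished state
`s0` (junk value, via `sInf ∅ = 0`, if there is no such visit). -/
noncomputable def tauSeq (s0 : S) (ω : ℕ → ℕ × S) : ℕ → ℕ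
  | 0 => sInf {n | (ω n).2 = s0}
  | m + 1 => sInf {n | tauSeq s0 ω m < n ∧ (ω n).2 = s0}

/-- `τ`, the first positive time at which the `S`-coordinate visits `s0`. -/
noncomputable def tauRet (s0 : S) (ω : ℕ → ℕ × S) : ℕ :=
  sInf {n | 1 ≤ n ∧ (ω n).2 = s0}

/-- `D_n`, the maximal displacement of the `ℕ`-coordinate during the `n`-th excursion. -/
noncomputable def Dexc (s0 : S) (n : ℕ) (ω : ℕ → ℕ × S) : ℕ :=
  Finset.sup (Finset.Icc (tauSeq s0 ω n) (tauSeq s0 ω (n + 1)))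
    fun m => Nat.dist (ω m).1 (ω (tauSeq s0 ω n)).1

/-- `N(n) = max {k : τ_k ≤ n}`. -/
noncomputable def Ncount (s0 : S) (n : ℕ) (ω : ℕ → ℕ × S) : ℕ :=
  sSup {k | tauSeq s0 ω k ≤ n}

end HalfStrip

/-- `Fdist a t` is the distribution function of the square root of a `Gamma(a,t)` random
variable: `F_{a,t}(x) = ∫_0^x 2 u^{2a-1} e^{-u²/t} / (t^a Γ(a)) du`. -/
noncomputable def Fdist (a t x : ℝ) : ℝ :=
  ∫ u in (0:ℝ)..x, 2 * u ^ (2 * a - 1) * Real.exp (-(u ^ 2) / t) / (t ^ a * Real.Gamma a)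

variable {S : Type*} [Fintype S] [DecidableEq S] [Nonempty S]
  [MeasurableSpace S] [MeasurableSingletonClass S]

section

open ProbabilityTheory

namespace MChain

variable {E : Type*} [MeasurableSpace E] [Countable E] [MeasurableSingletonClass E]

instance (X : MChain E) (z : E) : IsProbabilityMeasure (X.P z) := X.isProb z

/-- The one-step transition kernel of a chain. -/
noncomputable def stepKernel (X : MChain E) : Kernel E E where
  toFun z := (X.P z).map (fun ω => ω 1)
  measurable' := Measurable.of_discrete

lemma stepKernel_apply (X : MChain E) (z : E) :
    X.stepKernel z = (X.P z).map (fun ω => ω 1) := rfl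

instance (X : MChain E) : IsMarkovKernel X.stepKernel :=
  ⟨fun _ => Measure.isProbabilityMeasure_map (measurable_pi_apply 1).aemeasurable⟩

/-- The kernel sending a state to the law of the trajectory started there. -/
noncomputable def pathKernel (X : MChain E) : Kernel E (ℕ → E) where
  toFun := X.P
  measurable' := Measurable.of_discrete

instance (X : MChain E) : IsMarkovKernel X.pathKernel := ⟨fun z => X.isProb z⟩

lemma measurable_shift : Measurable (fun (ω : ℕ → E) k => ω (1 + k)) :=
  measurable_pi_lambda _ fun _ => measurable_pi_apply _

lemma map_shift (X : MChain E) (z : E) :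
    (X.P z).map (fun ω k => ω (1 + k)) = (X.pathKernel ∘ₖ X.stepKernel) z := by
  ext A hA
  rw [Measure.map_apply measurable_shift hA, Kernel.comp_apply' _ _ _ hA, stepKernel_apply,
    lintegral_map (Kernel.measurable_coe _ hA) (measurable_pi_apply 1)]
  have hU : (fun (ω : ℕ → E) k => ω (1 + k)) ⁻¹' A
      = ⋃ w : E, (Set.univ ∩ {ω | ω 1 = w} ∩ {ω | (fun k => ω (1 + k)) ∈ A}) := by
    ext ω; simp
  rw [hU, measure_iUnion]
  · simp_rw [fun w => X.markov z 1 w A Set.univ hA (fun _ _ _ h => h)]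
    rw [← lintegral_map (f := fun w => X.pathKernel w A) (g := fun ω : ℕ → E => ω 1)
      (Kernel.measurable_coe _ hA) (measurable_pi_apply 1), lintegral_countable']
    refine tsum_congr fun w => ?_
    rw [Measure.map_apply (measurable_pi_apply 1) (measurableSet_singleton w), mul_comm]
    simp [pathKernel, Set.preimage]
  · intro a b hab
    refine Set.disjoint_left.2 fun ω h1 h2 => hab ?_
    exact h1.1.2.symm.trans h2.1.2
  · intro w
    refine ((MeasurableSet.univ.inter ?_)).inter (measurable_shift hA)
    exact measurableSet_eq_fun (measurable_pi_apply 1) measurable_const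

lemma integral_shift (X : MChain E) (z : E) (Φ : (ℕ → E) → ℝ) (hΦ : Measurable Φ) (C : ℝ)
    (hC : ∀ ω, |Φ ω| ≤ C) :
    ∫ ω, Φ (fun k => ω (1 + k)) ∂(X.P z) = ∫ w, (∫ ω, Φ ω ∂(X.P w)) ∂(X.stepKernel z) := by
  rw [← integral_map (f := Φ) measurable_shift.aemeasurable hΦ.aestronglyMeasurable, map_shift,
    Kernel.integral_comp]
  · rfl
  · exact Integrable.of_bound hΦ.aestronglyMeasurable C (ae_of_all _ hC)

lemma ae_init (X : MChain E) (z : E) : ∀ᵐ ω ∂(X.P z), ω 0 = z := by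
  have := X.init z
  rwa [← mem_ae_iff_prob_eq_one] at this
  exact measurableSet_eq_fun (measurable_pi_apply 0) measurable_const

lemma isMarkovKernel_pow (κ : Kernel E E) [IsMarkovKernel κ] (n : ℕ) : IsMarkovKernel (κ ^ n) := by
  induction n with
  | zero => rw [pow_zero]; exact inferInstanceAs (IsMarkovKernel Kernel.id)
  | succ n ih => rw [pow_succ]; exact inferInstanceAs (IsMarkovKernel ((κ ^ n) ∘ₖ κ))

lemma map_eval (X : MChain E) (n : ℕ) (z : E) :
    (X.P z).map (fun ω => ω n) = (X.stepKernel ^ n) z := by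
  induction n generalizing z with
  | zero =>
    rw [pow_zero]
    change _ = Kernel.id z
    rw [Kernel.id_apply, Measure.map_congr (g := fun _ => z) (X.ae_init z), Measure.map_const]
    simp
  | succ n ih =>
    have h1 : (fun ω : ℕ → E => ω (n + 1)) = (fun ω => ω n) ∘ (fun ω k => ω (1 + k)) := by
      ext ω; simp [add_comm]
    rw [h1, ← Measure.map_map (measurable_pi_apply n) measurable_shift, map_shift]
    rw [← Kernel.map_apply _ (measurable_pi_apply n), Kernel.map_comp, pow_succ]
    congr 2
    ext w : 1
    rw [Kernel.map_apply _ (measurable_pi_apply n), ← ih]; rfl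

lemma pow_ne_zero_of_irreducible (X : MChain E) (h : X.Irreducible) (z w : E) :
    ∃ n : ℕ, (X.stepKernel ^ n) z {w} ≠ 0 := by
  obtain ⟨n, hn⟩ := h z w
  refine ⟨n, ?_⟩
  rw [← map_eval, Measure.map_apply (measurable_pi_apply n) (measurableSet_singleton w)]
  exact hn

end MChain

end

section

open ProbabilityTheory

/-- The number of visits to `s0` still to come after a step from `z`, when `k` are due at `z`. -/
def nextCount (s0 : S) (k : ℕ) (z : ℕ × S) : ℕ := if z.2 = s0 then k - 1 else k

/-- Indicator that the counted chain has not yet made its last due visit. -/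
noncomputable def aliveInd (s0 : S) (k : ℕ) (z : ℕ × S) : ℝ := if k = 0 ∧ z.2 = s0 then 0 else 1

/-- The expectation of `g` after `m` steps of the chain, stopped at the visit number `k` to `s0`. -/
noncomputable def stopVal (κ : Kernel (ℕ × S) (ℕ × S)) (s0 : S) (g : ℕ → ℕ × S → ℝ) :
    ℕ → ℕ → ℕ × S → ℝ
  | 0, k, z => g k z
  | m + 1, k, z => if k = 0 ∧ z.2 = s0 then g k z else
      ∫ w, stopVal κ s0 g m (nextCount s0 k z) w ∂(κ z)

/-- The value of `g` after `m` steps along a path stopped at the visit number `k` to `s0`. -/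
noncomputable def pathVal (s0 : S) (g : ℕ → ℕ × S → ℝ) : ℕ → ℕ → (ℕ → ℕ × S) → ℝ
  | 0, k, ω => g k (ω 0)
  | m + 1, k, ω => if k = 0 ∧ (ω 0).2 = s0 then g k (ω 0) else
      pathVal s0 g m (nextCount s0 k (ω 0)) (fun l => ω (1 + l))

lemma abs_pathVal_le (s0 : S) (g : ℕ → ℕ × S → ℝ) (C : ℝ) (hC : ∀ k z, |g k z| ≤ C) (m k : ℕ)
    (ω : ℕ → ℕ × S) : |pathVal s0 g m k ω| ≤ C := by
  induction m generalizing k ω with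
  | zero => exact hC _ _
  | succ m ih =>
    rw [pathVal]
    split_ifs
    · exact hC _ _
    · exact ih _ _

lemma measurable_pathVal (s0 : S) (g : ℕ → ℕ × S → ℝ) (m k : ℕ) :
    Measurable (pathVal s0 g m k) := by
  induction m generalizing k with
  | zero =>
    exact (Measurable.of_discrete (f := g k)).comp (measurable_pi_apply 0)
  | succ m ih =>
    have h0 : Measurable (fun ω : ℕ → ℕ × S => ω 0) := measurable_pi_apply 0
    have h1 : Measurable (fun p : (ℕ × S) × (ℕ → ℕ × S) =>
        if k = 0 ∧ p.1.2 = s0 then g k p.1 else pathVal s0 g m (nextCount s0 k p.1) p.2) := by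
      refine measurable_from_prod_countable_right fun z => ?_
      dsimp only
      split_ifs
      · exact measurable_const
      · exact ih _
    exact h1.comp (h0.prodMk MChain.measurable_shift)

lemma integral_pathVal (X : MChain (ℕ × S)) (s0 : S) (g : ℕ → ℕ × S → ℝ) (C : ℝ)
    (hC : ∀ k z, |g k z| ≤ C) (m k : ℕ) (z : ℕ × S) :
    ∫ ω, pathVal s0 g m k ω ∂(X.P z) = stopVal X.stepKernel s0 g m k z := by
  induction m generalizing k z with
  | zero =>
    rw [integral_congr_ae (g := fun _ => g k z)]
    · simp [stopVal]
    · filter_upwards [X.ae_init z] with ω hω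
      simp [pathVal, hω]
  | succ m ih =>
    rw [stopVal]
    split_ifs with h
    · rw [integral_congr_ae (g := fun _ => g k z)]
      · simp
      · filter_upwards [X.ae_init z] with ω hω
        simp [pathVal, hω, h.1, h.2]
    · simp_rw [← ih]
      rw [← X.integral_shift z _ (measurable_pathVal s0 g m _) C (abs_pathVal_le s0 g C hC m _)]
      refine integral_congr_ae ?_
      filter_upwards [X.ae_init z] with ω hω
      rw [pathVal, hω, if_neg h]

/-- The path makes its visit number `k` (counted from `0`) to `s0` at time `j`. -/
def IsVisit (s0 : S) (k : ℕ) (ω : ℕ → ℕ × S) (j : ℕ) : Prop :=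
  (ω j).2 = s0 ∧ ∑ l ∈ Finset.range j, (if (ω l).2 = s0 then 1 else 0) = k

lemma exists_last_visit (s0 : S) (k : ℕ) (ω : ℕ → ℕ × S) (j : ℕ)
    (h : ∑ l ∈ Finset.range j, (if (ω l).2 = s0 then 1 else 0) = k + 1) :
    ∃ i < j, IsVisit s0 k ω i ∧ ∀ l, i < l → l < j → (ω l).2 ≠ s0 := by
  induction j with
  | zero => simp at h
  | succ j ih =>
    rw [Finset.sum_range_succ] at h
    by_cases hj : (ω j).2 = s0
    · refine ⟨j, Nat.lt_succ_self j, ⟨hj, ?_⟩, fun l h1 h2 => by omega⟩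
      rw [if_pos hj] at h
      omega
    · rw [if_neg hj, add_zero] at h
      obtain ⟨i, hi, hv, hl⟩ := ih h
      refine ⟨i, by omega, hv, fun l h1 h2 => ?_⟩
      rcases Nat.lt_succ_iff_lt_or_eq.1 h2 with h3 | h3
      · exact hl l h1 h3
      · rw [h3]; exact hj

lemma tauSeq_eq_of_isVisit (s0 : S) (k : ℕ) (ω : ℕ → ℕ × S) (j : ℕ) (h : IsVisit s0 k ω j) :
    tauSeq s0 ω k = j := by
  induction k generalizing j with
  | zero =>
    rw [tauSeq]
    refine le_antisymm (Nat.sInf_le h.1) (le_csInf ⟨j, h.1⟩ fun l hl => ?_)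
    by_contra hlj
    have := Finset.sum_eq_zero_iff.1 h.2 l (Finset.mem_range.2 (not_le.1 hlj))
    simp only [Set.mem_ofPred_eq] at hl
    simp [hl] at this
  | succ k ih =>
    obtain ⟨i, hij, hi, hl⟩ := exists_last_visit s0 k ω j h.2
    rw [tauSeq, ih i hi]
    refine le_antisymm (Nat.sInf_le ⟨hij, h.1⟩) (le_csInf ⟨j, hij, h.1⟩ fun l hlm => ?_)
    by_contra hlj
    exact hl l hlm.1 (not_le.1 hlj) hlm.2

lemma pathVal_dichotomy (s0 : S) (f : ℕ → ℝ) (m k : ℕ) (ω : ℕ → ℕ × S) :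
    (pathVal s0 (aliveInd s0) m k ω = 1 ∧
      pathVal s0 (fun k z => (1 - aliveInd s0 k z) * f z.1) m k ω = 0) ∨
    ∃ j, IsVisit s0 k ω j ∧ pathVal s0 (aliveInd s0) m k ω = 0 ∧
      pathVal s0 (fun k z => (1 - aliveInd s0 k z) * f z.1) m k ω = f (ω j).1 := by
  induction m generalizing k ω with
  | zero =>
    by_cases h : k = 0 ∧ (ω 0).2 = s0
    · exact Or.inr ⟨0, ⟨h.2, by simp [h.1]⟩, by simp [pathVal, aliveInd, h], by
        simp [pathVal, aliveInd, h]⟩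
    · exact Or.inl ⟨by simp only [pathVal, aliveInd, if_neg h], by
        simp only [pathVal, aliveInd, if_neg h]; ring⟩
  | succ m ih =>
    by_cases h : k = 0 ∧ (ω 0).2 = s0
    · exact Or.inr ⟨0, ⟨h.2, by simp [h.1]⟩, by simp [pathVal, aliveInd, h], by
        simp [pathVal, aliveInd, h]⟩
    · simp only [pathVal, if_neg h]
      rcases ih (nextCount s0 k (ω 0)) (fun l => ω (1 + l)) with h1 | ⟨j, hj, h1⟩
      · exact Or.inl h1
      · refine Or.inr ⟨1 + j, ⟨hj.1, ?_⟩, h1⟩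
        rw [add_comm, Finset.sum_range_succ']
        have := hj.2
        simp only [nextCount, add_comm 1] at this
        rw [this]
        split_ifs with h2
        · have : k ≠ 0 := fun hk => h ⟨hk, h2⟩
          omega
        · rfl

lemma abs_integral_tauSeq_sub_le (X : MChain (ℕ × S)) (s0 : S) (f : ℕ → ℝ) (hf : ∀ x, |f x| ≤ 1)
    (hm : ∀ n, Measurable fun ω : ℕ → ℕ × S => f (ω (tauSeq s0 ω n)).1)
    (m k : ℕ) (z : ℕ × S) :
    |∫ ω, f (ω (tauSeq s0 ω k)).1 ∂(X.P z) -
      stopVal X.stepKernel s0 (fun k z => (1 - aliveInd s0 k z) * f z.1) m k z|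
      ≤ stopVal X.stepKernel s0 (aliveInd s0) m k z := by
  have ha : ∀ k z, |aliveInd s0 k z| ≤ 1 := fun k z => by
    unfold aliveInd; split_ifs <;> simp
  have hb : ∀ k (z : ℕ × S), |(1 - aliveInd s0 k z) * f z.1| ≤ 1 := fun k z => by
    unfold aliveInd; split_ifs <;> simp [hf]
  rw [← integral_pathVal X s0 _ 1 ha, ← integral_pathVal X s0 _ 1 hb, ← integral_sub]
  · refine (abs_integral_le_integral_abs).trans (integral_mono ?_ ?_ fun ω => ?_)
    · refine Integrable.abs (Integrable.sub ?_ ?_)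
      · exact Integrable.of_bound (hm k).aestronglyMeasurable 1 (ae_of_all _ fun ω => hf _)
      · exact Integrable.of_bound (measurable_pathVal _ _ _ _).aestronglyMeasurable 1
          (ae_of_all _ fun ω => abs_pathVal_le s0 _ 1 hb m k ω)
    · exact Integrable.of_bound (measurable_pathVal _ _ _ _).aestronglyMeasurable 1
          (ae_of_all _ fun ω => abs_pathVal_le s0 _ 1 ha m k ω)
    · dsimp only
      rcases pathVal_dichotomy s0 f m k ω with ⟨h1, h2⟩ | ⟨j, hj, h1, h2⟩
      · rw [h1, h2, sub_zero]; exact hf _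
      · rw [h1, h2, tauSeq_eq_of_isVisit s0 k ω j hj, sub_self, abs_zero]
  · exact Integrable.of_bound (hm k).aestronglyMeasurable 1 (ae_of_all _ fun ω => hf _)
  · exact Integrable.of_bound (measurable_pathVal _ _ _ _).aestronglyMeasurable 1
      (ae_of_all _ fun ω => abs_pathVal_le s0 _ 1 hb m k ω)

lemma measurable_sInf_nat {Ω : Type*} [MeasurableSpace Ω] (A : Ω → Set ℕ)
    (hA : ∀ n, MeasurableSet {ω | n ∈ A ω}) : Measurable fun ω => sInf (A ω) := by
  refine measurable_to_countable' fun n => ?_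
  rcases Nat.eq_zero_or_pos n with rfl | hn
  · have : (fun ω => sInf (A ω)) ⁻¹' {0} = {ω | 0 ∈ A ω} ∪ ⋂ m, {ω | m ∈ A ω}ᶜ := by
      ext ω
      simp [Nat.sInf_eq_zero, Set.eq_empty_iff_forall_notMem]
    rw [this]
    exact (hA 0).union (MeasurableSet.iInter fun m => (hA m).compl)
  · have : (fun ω => sInf (A ω)) ⁻¹' {n} = {ω | n ∈ A ω} ∩ ⋂ m : Fin n, {ω | (m : ℕ) ∈ A ω}ᶜ := by
      ext ω
      simp only [Set.mem_preimage, Set.mem_singleton_iff, Set.mem_inter_iff, Set.mem_ofPred_eq,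
        Set.mem_iInter, Set.mem_compl_iff]
      constructor
      · intro h
        have hne : (A ω).Nonempty := Nat.nonempty_of_pos_sInf (h ▸ hn)
        exact ⟨h ▸ Nat.sInf_mem hne, fun m hm => Nat.notMem_of_lt_sInf (h ▸ m.2) hm⟩
      · rintro ⟨h1, h2⟩
        refine le_antisymm (Nat.sInf_le h1) (le_csInf ⟨n, h1⟩ fun l hl => ?_)
        by_contra hln
        exact h2 ⟨l, not_le.1 hln⟩ hl
    rw [this]
    exact (hA n).inter (MeasurableSet.iInter fun m => (hA m).compl)

lemma measurable_tauSeq (s0 : S) (n : ℕ) :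
    Measurable fun ω : ℕ → ℕ × S => tauSeq s0 ω n := by
  have hs : ∀ l, MeasurableSet {ω : ℕ → ℕ × S | (ω l).2 = s0} := fun l =>
    measurableSet_eq_fun (measurable_snd.comp (measurable_pi_apply l)) measurable_const
  induction n with
  | zero => exact measurable_sInf_nat _ hs
  | succ n ih =>
    refine measurable_sInf_nat (fun ω => {l | tauSeq s0 ω n < l ∧ (ω l).2 = s0}) fun l => ?_
    exact (measurableSet_lt ih measurable_const).inter (hs l)

lemma measurable_fst_tauSeq (s0 : S) (n : ℕ) :
    Measurable fun ω : ℕ → ℕ × S => (ω (tauSeq s0 ω n)).1 := by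
  have h1 : Measurable fun p : ℕ × (ℕ → ℕ × S) => (p.2 p.1).1 :=
    measurable_from_prod_countable_right fun l => measurable_fst.comp (measurable_pi_apply l)
  exact h1.comp ((measurable_tauSeq s0 n).prodMk measurable_id)

end

section

open ProbabilityTheory

instance {E : Type*} [MeasurableSpace E] [Countable E] [MeasurableSingletonClass E]
    (κ : Kernel E E) [IsMarkovKernel κ] (n : ℕ) :
    IsMarkovKernel (κ ^ n) := MChain.isMarkovKernel_pow κ n

lemma integrable_of_abs_le {E : Type*} [MeasurableSpace E] [Countable E]
    [DiscreteMeasurableSpace E]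
    (μ : Measure E) [IsFiniteMeasure μ] {f : E → ℝ} {C : ℝ}
    (hC : ∀ z, |f z| ≤ C) : Integrable f μ :=
  Integrable.of_bound Measurable.of_discrete.aestronglyMeasurable C (ae_of_all _ hC)

lemma abs_integral_le_of_abs_le {E : Type*} [MeasurableSpace E] (μ : Measure E)
    [IsProbabilityMeasure μ] {f : E → ℝ} {C : ℝ} (hC : ∀ z, |f z| ≤ C) : |∫ w, f w ∂μ| ≤ C := by
  simpa using norm_integral_le_of_norm_le_const (μ := μ) (f := f) (C := C) (ae_of_all _ hC)

lemma integral_pow_succ {E : Type*} [MeasurableSpace E] [Countable E]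
    [DiscreteMeasurableSpace E]
    (κ : Kernel E E) [IsMarkovKernel κ] {e : E → ℝ} {C : ℝ} (he : ∀ z, |e z| ≤ C) (j : ℕ) (z : E) :
    ∫ w, e w ∂((κ ^ (j + 1)) z) = ∫ w, (∫ v, e v ∂((κ ^ j) w)) ∂(κ z) := by
  have h : κ ^ (j + 1) = (κ ^ j) ∘ₖ κ := pow_succ κ j
  have h2 : Integrable e (((κ ^ j) ∘ₖ κ) z) := integrable_of_abs_le _ he
  rw [h, Kernel.integral_comp h2]

section StopVal

variable (κ : Kernel (ℕ × S) (ℕ × S)) [IsMarkovKernel κ] (s0 : S)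

lemma nextCount_le (k : ℕ) (z : ℕ × S) : nextCount s0 k z ≤ k := by
  unfold nextCount; split_ifs <;> omega

lemma stopVal_bdd {g : ℕ → ℕ × S → ℝ} (hg : ∀ k, ∃ C, ∀ z, |g k z| ≤ C) (m k : ℕ) :
    ∃ C, ∀ z, |stopVal κ s0 g m k z| ≤ C := by
  induction m generalizing k with
  | zero => exact hg k
  | succ m ih =>
    obtain ⟨C0, h0⟩ := hg k
    obtain ⟨C1, h1⟩ := ih k
    obtain ⟨C2, h2⟩ := ih (k - 1)
    refine ⟨max C0 (max C1 C2), fun z => ?_⟩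
    rw [stopVal]
    split_ifs with h
    · exact (h0 z).trans (le_max_left _ _)
    · unfold nextCount
      split_ifs
      · exact (abs_integral_le_of_abs_le _ h2).trans
          ((le_max_right _ _).trans (le_max_right _ _))
      · exact (abs_integral_le_of_abs_le _ h1).trans ((le_max_left _ _).trans (le_max_right _ _))

lemma stopVal_integrable {g : ℕ → ℕ × S → ℝ} (hg : ∀ k, ∃ C, ∀ z, |g k z| ≤ C) (m k : ℕ)
    (μ : Measure (ℕ × S)) [IsFiniteMeasure μ] : Integrable (stopVal κ s0 g m k) μ := by
  obtain ⟨C, hC⟩ := stopVal_bdd κ s0 hg m k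
  exact integrable_of_abs_le _ hC

lemma aliveInd_bdd (k : ℕ) : ∃ C, ∀ z, |aliveInd s0 k z| ≤ C :=
  ⟨1, fun z => by unfold aliveInd; split_ifs <;> simp⟩

lemma stopVal_nonneg {g : ℕ → ℕ × S → ℝ} (hg : ∀ k z, 0 ≤ g k z) (m k : ℕ) (z : ℕ × S) :
    0 ≤ stopVal κ s0 g m k z := by
  induction m generalizing k z with
  | zero => exact hg k z
  | succ m ih =>
    rw [stopVal]
    split_ifs
    · exact hg _ _
    · exact integral_nonneg fun w => ih _ _

lemma abs_stopVal_sub_stopVal_le {g g' : ℕ → ℕ × S → ℝ} (hg : ∀ k, ∃ C, ∀ z, |g k z| ≤ C)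
    (hg' : ∀ k, ∃ C, ∀ z, |g' k z| ≤ C) (n : ℕ) (c c' : ℝ)
    (h : ∀ k ≤ n, ∀ z, |g k z - g' k z| ≤ c * aliveInd s0 k z + c') (m k : ℕ) (hk : k ≤ n)
    (z : ℕ × S) :
    |stopVal κ s0 g m k z - stopVal κ s0 g' m k z|
      ≤ c * stopVal κ s0 (aliveInd s0) m k z + c' := by
  induction m generalizing k z with
  | zero => exact h k hk z
  | succ m ih =>
    rw [stopVal, stopVal, stopVal]
    split_ifs with h0
    · exact h k hk z
    · have hk' := (nextCount_le s0 k z).trans hk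
      have i1 := stopVal_integrable κ s0 hg m (nextCount s0 k z) (κ z)
      have i2 := stopVal_integrable κ s0 hg' m (nextCount s0 k z) (κ z)
      have i3 := stopVal_integrable κ s0 (aliveInd_bdd s0) m (nextCount s0 k z) (κ z)
      rw [← integral_sub i1 i2]
      calc _ ≤ ∫ w, |stopVal κ s0 g m (nextCount s0 k z) w
              - stopVal κ s0 g' m (nextCount s0 k z) w| ∂(κ z) := abs_integral_le_integral_abs
        _ ≤ ∫ w, (c * stopVal κ s0 (aliveInd s0) m (nextCount s0 k z) w + c') ∂(κ z) :=
            integral_mono (i1.sub i2).abs ((i3.const_mul c).add (integrable_const _))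
              fun w => ih _ hk' w
        _ = _ := by
            rw [integral_add (i3.const_mul c) (integrable_const _), integral_const_mul]; simp

lemma sum_integral_pow_succ {e : ℕ × S → ℝ} {Ce : ℝ} (he : ∀ z, |e z| ≤ Ce) (m : ℕ)
    (z : ℕ × S) :
    ∑ j ∈ Finset.range (m + 1), ∫ w, e w ∂((κ ^ j) z)
      = ∫ v, (∑ j ∈ Finset.range m, ∫ w, e w ∂((κ ^ j) v)) ∂(κ z) + e z := by
  rw [Finset.sum_range_succ', integral_finsetSum]
  · congr 1
    · exact Finset.sum_congr rfl fun j _ => integral_pow_succ κ he j z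
    · rw [pow_zero]
      change ∫ w, e w ∂(Kernel.id z) = _
      rw [Kernel.id_apply, integral_dirac]
  · intro j _
    exact integrable_of_abs_le _ fun v => abs_integral_le_of_abs_le _ he

lemma integrable_sum_integral_pow {e : ℕ × S → ℝ} {Ce : ℝ} (he : ∀ z, |e z| ≤ Ce) (m : ℕ)
    (μ : Measure (ℕ × S)) [IsFiniteMeasure μ] :
    Integrable (fun v => ∑ j ∈ Finset.range m, ∫ w, e w ∂((κ ^ j) v)) μ :=
  integrable_finsetSum _ fun _ _ =>
    integrable_of_abs_le _ fun _ => abs_integral_le_of_abs_le _ he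

/-- If `g` changes by at most `e` in mean in each step, it changes by at most the accumulated `e`
up to the stopping time. -/
lemma abs_stopVal_sub_le {g : ℕ → ℕ × S → ℝ} (hg : ∀ k, ∃ C, ∀ z, |g k z| ≤ C)
    {e : ℕ × S → ℝ} (he0 : ∀ z, 0 ≤ e z) {Ce : ℝ} (he : ∀ z, |e z| ≤ Ce) (n : ℕ)
    (h : ∀ k ≤ n, ∀ z : ℕ × S, ¬ (k = 0 ∧ z.2 = s0) →
      |∫ w, g (nextCount s0 k z) w ∂(κ z) - g k z| ≤ e z) (m k : ℕ) (hk : k ≤ n) (z : ℕ × S) :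
    |stopVal κ s0 g m k z - g k z| ≤ ∑ j ∈ Finset.range m, ∫ w, e w ∂((κ ^ j) z) := by
  induction m generalizing k z with
  | zero => simp [stopVal]
  | succ m ih =>
    rw [stopVal]
    split_ifs with h0
    · rw [sub_self, abs_zero]
      exact Finset.sum_nonneg fun j _ => integral_nonneg he0
    · have hk' := (nextCount_le s0 k z).trans hk
      have i1 := stopVal_integrable κ s0 hg m (nextCount s0 k z) (κ z)
      have i2 : Integrable (g (nextCount s0 k z)) (κ z) :=
        stopVal_integrable κ s0 hg 0 (nextCount s0 k z) (κ z)
      have i3 := integrable_sum_integral_pow κ he m (κ z)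
      rw [sum_integral_pow_succ κ he]
      have h2 : |∫ w, stopVal κ s0 g m (nextCount s0 k z) w ∂(κ z)
          - ∫ w, g (nextCount s0 k z) w ∂(κ z)|
          ≤ ∫ v, (∑ j ∈ Finset.range m, ∫ w, e w ∂((κ ^ j) v)) ∂(κ z) := by
        rw [← integral_sub i1 i2]
        exact abs_integral_le_integral_abs.trans
          (integral_mono (i1.sub i2).abs i3 fun w => ih _ hk' w)
      exact (abs_sub_le _ _ _).trans (add_le_add h2 (h k hk z h0))

/-- If `g ≥ 0` decreases by at least `b` in mean in each step, up to errors `e`, the probability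
of being still alive after `m` steps is at most `(g + accumulated errors) / (b m)`. -/
lemma mul_stopVal_aliveInd_le {g : ℕ → ℕ × S → ℝ} (hg : ∀ k, ∃ C, ∀ z, |g k z| ≤ C)
    (hg0 : ∀ k z, 0 ≤ g k z) {b : ℝ} (hb : 0 ≤ b)
    {e : ℕ × S → ℝ} (he0 : ∀ z, 0 ≤ e z) {Ce : ℝ} (he : ∀ z, |e z| ≤ Ce) (n : ℕ)
    (h : ∀ k ≤ n, ∀ z : ℕ × S, ¬ (k = 0 ∧ z.2 = s0) →
      ∫ w, g (nextCount s0 k z) w ∂(κ z) ≤ g k z - b + e z) (m k : ℕ) (hk : k ≤ n) (z : ℕ × S) :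
    b * m * stopVal κ s0 (aliveInd s0) m k z
      ≤ g k z + ∑ j ∈ Finset.range m, ∫ w, e w ∂((κ ^ j) z) := by
  have ha1 : ∀ m k z, stopVal κ s0 (aliveInd s0) m k z ≤ 1 := by
    intro m k z
    have := abs_stopVal_sub_stopVal_le κ s0 (g := aliveInd s0) (g' := fun _ _ => 0)
      (aliveInd_bdd s0) (fun _ => ⟨0, by simp⟩) k 0 1 (fun k _ z => by
        unfold aliveInd; split_ifs <;> simp) m k le_rfl z
    have h0 : ∀ m k z, stopVal κ s0 (fun _ _ => 0) m k z = 0 := by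
      intro m
      induction m with
      | zero => intros; rfl
      | succ m ih => intro k z; simp [stopVal, ih]
    rw [h0, sub_zero, zero_mul, zero_add] at this
    exact (le_abs_self _).trans this
  suffices H : stopVal κ s0 g m k z + b * m * stopVal κ s0 (aliveInd s0) m k z
      ≤ g k z + ∑ j ∈ Finset.range m, ∫ w, e w ∂((κ ^ j) z) by
    have := stopVal_nonneg κ s0 hg0 m k z
    linarith
  induction m generalizing k z with
  | zero => simp [stopVal]
  | succ m ih =>
    rw [stopVal, stopVal]
    split_ifs with h0
    · rw [aliveInd, if_pos h0, mul_zero, add_zero]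
      exact le_add_of_nonneg_right (Finset.sum_nonneg fun j _ => integral_nonneg he0)
    · have hk' := (nextCount_le s0 k z).trans hk
      have i1 := stopVal_integrable κ s0 hg m (nextCount s0 k z) (κ z)
      have i2 := stopVal_integrable κ s0 hg 0 (nextCount s0 k z) (κ z)
      have i3 := integrable_sum_integral_pow κ he m (κ z)
      have i4 := stopVal_integrable κ s0 (aliveInd_bdd s0) m (nextCount s0 k z) (κ z)
      rw [sum_integral_pow_succ κ he]
      have h2 := integral_mono (i1.add (i4.const_mul (b * m))) (i2.add i3)
        fun w => ih _ hk' w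
      rw [integral_add' i1 (i4.const_mul _), integral_add' i2 i3, integral_const_mul] at h2
      have h3 : ∫ w, stopVal κ s0 (aliveInd s0) m (nextCount s0 k z) w ∂(κ z) ≤ 1 := by
        have := integral_mono i4 (integrable_const (1 : ℝ)) fun w => ha1 m (nextCount s0 k z) w
        simpa using this
      have h4 := h k hk z h0
      have h5 : ∫ w, stopVal κ s0 g 0 (nextCount s0 k z) w ∂(κ z)
          = ∫ w, g (nextCount s0 k z) w ∂(κ z) := rfl
      push_cast
      nlinarith

end StopVal

end

section

open ProbabilityTheory

section Poisson

variable {Q : S → S → ℝ} {pst : S → ℝ}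

lemma eq_of_harmonic (hQ : IsStochasticMatrix Q) (hirr : IsIrreducibleMatrix Q) {h : S → ℝ}
    (hh : ∀ i, ∑ j, Q i j * h j = h i) (i j : S) : h i = h j := by
  have key : ∀ n : ℕ, (∀ i j, 0 ≤ ((Matrix.of Q) ^ n) i j) ∧
      (∀ i, ∑ j, ((Matrix.of Q) ^ n) i j = 1) ∧
      (∀ i, ∑ j, ((Matrix.of Q) ^ n) i j * h j = h i) := by
    intro n
    induction n with
    | zero => simp [Matrix.one_apply, apply_ite]
    | succ n ih =>
      obtain ⟨h0, h1, h2⟩ := ih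
      refine ⟨fun i j => ?_, fun i => ?_, fun i => ?_⟩
      · rw [pow_succ, Matrix.mul_apply]
        exact Finset.sum_nonneg fun k _ => mul_nonneg (h0 _ _) (hQ.1 _ _)
      · simp_rw [pow_succ, Matrix.mul_apply]
        rw [Finset.sum_comm]
        simp_rw [← Finset.mul_sum, Matrix.of_apply, hQ.2, mul_one, h1]
      · simp_rw [pow_succ, Matrix.mul_apply, Finset.sum_mul]
        rw [Finset.sum_comm]
        simp_rw [mul_assoc, ← Finset.mul_sum, Matrix.of_apply, hh, h2]
  obtain ⟨i0, hi0⟩ := Finite.exists_max h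
  suffices H : ∀ j, h j = h i0 by rw [H i, H j]
  intro j
  obtain ⟨n, hn⟩ := hirr i0 j
  obtain ⟨h0, h1, h2⟩ := key n
  have h3 : ∑ j, ((Matrix.of Q) ^ n) i0 j * (h i0 - h j) = 0 := by
    simp_rw [mul_sub, Finset.sum_sub_distrib, ← Finset.sum_mul, h1, h2]; ring
  have h4 := (Finset.sum_eq_zero_iff_of_nonneg
    (fun j _ => mul_nonneg (h0 i0 j) (sub_nonneg.2 (hi0 j)))).1 h3 j (Finset.mem_univ j)
  rcases mul_eq_zero.1 h4 with h5 | h5 <;> linarith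

/-- Solvability of the Poisson equation for an irreducible stochastic matrix. -/
lemma exists_poisson (hQ : IsStochasticMatrix Q) (hirr : IsIrreducibleMatrix Q)
    (hp : IsStationaryDist Q pst) {f : S → ℝ} (hf : ∑ i, pst i * f i = 0) :
    ∃ h : S → ℝ, ∀ i, h i - ∑ j, Q i j * h j = f i := by
  let T : (S → ℝ) →ₗ[ℝ] (S → ℝ) := LinearMap.id - (Matrix.of Q).mulVecLin
  have hT : ∀ h i, T h i = h i - ∑ j, Q i j * h j := fun h i => by
    simp [T, Matrix.mulVec, dotProduct]
  let φ : (S → ℝ) →ₗ[ℝ] ℝ := ∑ i, pst i • LinearMap.proj i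
  have hφ : ∀ h, φ h = ∑ i, pst i * h i := fun h => by simp [φ]
  have hle : LinearMap.range T ≤ LinearMap.ker φ := by
    rintro _ ⟨h, rfl⟩
    rw [LinearMap.mem_ker, hφ]
    simp_rw [hT, mul_sub, Finset.sum_sub_distrib, Finset.mul_sum]
    rw [Finset.sum_comm (s := Finset.univ)]
    simp_rw [← mul_assoc, ← Finset.sum_mul, hp.2.2, sub_self]
  have hker : LinearMap.ker T ≤ Submodule.span ℝ {fun _ => (1 : ℝ)} := by
    intro h hh
    rw [LinearMap.mem_ker] at hh
    have h1 : ∀ i, ∑ j, Q i j * h j = h i := fun i => by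
      have := congrFun hh i
      rw [hT] at this
      simp only [Pi.zero_apply] at this
      linarith
    rw [Submodule.mem_span_singleton]
    obtain ⟨i0⟩ := ‹Nonempty S›
    exact ⟨h i0, funext fun j => by simp [eq_of_harmonic hQ hirr h1 j i0]⟩
  have hdim : Module.finrank ℝ (LinearMap.ker T) ≤ 1 :=
    (Submodule.finrank_mono hker).trans (finrank_span_singleton (K := ℝ)
      (Function.ne_iff.2 ⟨Classical.arbitrary S, one_ne_zero⟩)).le
  have hφs : LinearMap.range φ = ⊤ := by
    rw [LinearMap.range_eq_top]
    intro y
    refine ⟨fun _ => y, ?_⟩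
    rw [hφ, ← Finset.sum_mul, hp.2.1, one_mul]
  have e1 := LinearMap.finrank_range_add_finrank_ker T
  have e2 := LinearMap.finrank_range_add_finrank_ker φ
  rw [hφs, finrank_top, Module.finrank_self] at e2
  have heq : LinearMap.range T = LinearMap.ker φ :=
    Submodule.eq_of_le_of_finrank_le hle (by omega)
  have hfm : f ∈ LinearMap.range T := by rw [heq, LinearMap.mem_ker, hφ, hf]
  obtain ⟨h, hh⟩ := hfm
  exact ⟨h, fun i => by rw [← hT, hh]⟩

lemma exists_poisson_center (hQ : IsStochasticMatrix Q) (hirr : IsIrreducibleMatrix Q)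
    (hp : IsStationaryDist Q pst) (f : S → ℝ) :
    ∃ h : S → ℝ, ∀ i, h i - ∑ j, Q i j * h j = f i - ∑ i, f i * pst i := by
  refine exists_poisson hQ hirr hp ?_
  simp_rw [mul_sub, Finset.sum_sub_distrib, ← Finset.sum_mul, hp.2.1, one_mul, mul_comm, sub_self]

/-- The sums `f + Q f + ⋯ + Q^{L-1} f`. -/
def iterSum (Q : S → S → ℝ) (f : S → ℝ) : ℕ → S → ℝ
  | 0 => fun _ => 0
  | L + 1 => fun i => f i + ∑ j, Q i j * iterSum Q f L j

lemma abs_sum_mul_le (hQ : IsStochasticMatrix Q) {g : S → ℝ} {H : ℝ} (hg : ∀ i, |g i| ≤ H)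
    (i : S) : |∑ j, Q i j * g j| ≤ H := by
  calc _ ≤ ∑ j, |Q i j * g j| := Finset.abs_sum_le_sum_abs _ _
    _ ≤ ∑ j, Q i j * H := Finset.sum_le_sum fun j _ => by
        rw [abs_mul, abs_of_nonneg (hQ.1 i j)]
        exact mul_le_mul_of_nonneg_left (hg j) (hQ.1 i j)
    _ = H := by rw [← Finset.sum_mul, hQ.2, one_mul]

lemma exists_abs_iterSum_sub_le (hQ : IsStochasticMatrix Q) (hirr : IsIrreducibleMatrix Q)
    (hp : IsStationaryDist Q pst) (f : S → ℝ) :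
    ∃ C, ∀ (L : ℕ) i, |iterSum Q f L i - L * ∑ i, f i * pst i| ≤ C := by
  obtain ⟨h, hh⟩ := exists_poisson_center hQ hirr hp f
  obtain ⟨H, hH⟩ : ∃ H, ∀ i, |h i| ≤ H := (Set.finite_range fun i => |h i|).bddAbove.imp
    fun H hH i => hH ⟨i, rfl⟩
  have key : ∀ L : ℕ, ∀ i, |iterSum Q f L i - L * ∑ i, f i * pst i - h i| ≤ H := by
    intro L
    induction L with
    | zero => intro i; simpa [iterSum] using hH i
    | succ L ih =>
      intro i
      have e : iterSum Q f (L + 1) i - ((L + 1 : ℕ) : ℝ) * ∑ i, f i * pst i - h i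
          = ∑ j, Q i j * (iterSum Q f L j - L * ∑ i, f i * pst i - h j) := by
        simp_rw [mul_sub, Finset.sum_sub_distrib, ← Finset.sum_mul, hQ.2]
        have := hh i
        rw [iterSum]
        push_cast
        linarith
      rw [e]
      exact abs_sum_mul_le hQ ih i
  refine ⟨H + H, fun L i => ?_⟩
  have := abs_add_le (iterSum Q f L i - L * ∑ i, f i * pst i - h i) (h i)
  rw [sub_add_cancel] at this
  exact this.trans (add_le_add (key L i) (hH i))

/-- A positive stationary mean makes the iterated sums eventually positive. -/
lemma eventually_iterSum_pos (hQ : IsStochasticMatrix Q) (hirr : IsIrreducibleMatrix Q)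
    (hp : IsStationaryDist Q pst) {f : S → ℝ} (hf : 0 < ∑ i, f i * pst i) :
    ∀ᶠ L : ℕ in atTop, ∀ i, 0 < iterSum Q f L i := by
  obtain ⟨C, hC⟩ := exists_abs_iterSum_sub_le hQ hirr hp f
  have h1 : Tendsto (fun L : ℕ => (L : ℝ) * ∑ i, f i * pst i) atTop atTop :=
    tendsto_natCast_atTop_atTop.atTop_mul_const hf
  filter_upwards [h1.eventually_gt_atTop C] with L hL i
  have := (abs_le.1 (hC L i)).1
  linarith

end Poisson

end

section

open ProbabilityTheory

/-- The increment of the first coordinate. -/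
def jump (z w : ℕ × S) : ℝ := (w.1 : ℝ) - z.1

/-- Uniformly bounded fourth moments of the increments of the first coordinate. -/
def BddMoment (κ : Kernel (ℕ × S) (ℕ × S)) (C : ℝ≥0) : Prop :=
  ∀ z, ∫⁻ w, ENNReal.ofReal (jump z w ^ 4) ∂(κ z) ≤ C

namespace BddMoment

variable {κ κ' : Kernel (ℕ × S) (ℕ × S)} {C C' : ℝ≥0}

lemma integrable_pow_four (h : BddMoment κ C) (z : ℕ × S) :
    Integrable (fun w => jump z w ^ 4) (κ z) := by
  refine ⟨Measurable.of_discrete.aestronglyMeasurable, ?_⟩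
  rw [hasFiniteIntegral_iff_ofReal (ae_of_all _ fun w => by positivity)]
  exact (h z).trans_lt ENNReal.coe_lt_top

lemma integral_pow_four_le (h : BddMoment κ C) (z : ℕ × S) :
    ∫ w, jump z w ^ 4 ∂(κ z) ≤ C := by
  rw [integral_eq_lintegral_of_nonneg_ae (ae_of_all _ fun w => by positivity)
    Measurable.of_discrete.aestronglyMeasurable]
  exact ENNReal.toReal_le_coe_of_le_coe (h z)

lemma integrable [IsMarkovKernel κ] (h : BddMoment κ C) (z : ℕ × S) {f : ℕ × S → ℝ} {A : ℝ}
    (hf : ∀ w, |f w| ≤ A * (1 + jump z w ^ 4)) : Integrable f (κ z) :=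
  Integrable.mono' (((integrable_const 1).add (h.integrable_pow_four z)).const_mul A)
    Measurable.of_discrete.aestronglyMeasurable (ae_of_all _ hf)

lemma integral_abs_le [IsMarkovKernel κ] (h : BddMoment κ C) (z : ℕ × S) {f : ℕ × S → ℝ} {A : ℝ}
    (hA : 0 ≤ A) (hf : ∀ w, |f w| ≤ A * (1 + jump z w ^ 4)) :
    ∫ w, |f w| ∂(κ z) ≤ A * (1 + C) := by
  have i0 := (integrable_const (1 : ℝ)).add (h.integrable_pow_four z)
  calc _ ≤ ∫ w, A * (1 + jump z w ^ 4) ∂(κ z) :=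
        integral_mono (h.integrable z hf).abs (i0.const_mul A) hf
    _ = A * (1 + ∫ w, jump z w ^ 4 ∂(κ z)) := by
        rw [integral_const_mul, integral_add (integrable_const _) (h.integrable_pow_four z)]; simp
    _ ≤ _ := by gcongr; exact h.integral_pow_four_le z

lemma abs_integral_le [IsMarkovKernel κ] (h : BddMoment κ C) (z : ℕ × S) {f : ℕ × S → ℝ} {A : ℝ}
    (hA : 0 ≤ A) (hf : ∀ w, |f w| ≤ A * (1 + jump z w ^ 4)) :
    |∫ w, f w ∂(κ z)| ≤ A * (1 + C) :=
  abs_integral_le_integral_abs.trans (h.integral_abs_le z hA hf)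

end BddMoment

lemma abs_le_one_add_pow_four (d : ℝ) : |d| ≤ 1 + d ^ 4 := by
  rcases abs_cases d with ⟨h, _⟩ | ⟨h, _⟩ <;> rw [h] <;>
    nlinarith [sq_nonneg (d ^ 2 - 1 / 2), sq_nonneg (d - 1 / 2), sq_nonneg (d + 1 / 2)]

lemma sq_le_one_add_pow_four (d : ℝ) : d ^ 2 ≤ 1 + d ^ 4 := by
  nlinarith [sq_nonneg (d ^ 2 - 1 / 2)]

lemma abs_pow_three_le (d : ℝ) : |d| ^ 3 ≤ 1 + d ^ 4 := by
  have h4 : d ^ 4 = |d| ^ 4 := by rw [show (4 : ℕ) = 2 * 2 from rfl, pow_mul, pow_mul, sq_abs]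
  rw [h4]
  nlinarith [sq_nonneg (|d| ^ 2 - |d| / 2), sq_nonneg (|d| - 1), abs_nonneg d,
    sq_nonneg (|d| ^ 2 - 1), sq_nonneg (|d| + 1)]

lemma one_add_le_mul (z w : ℕ × S) : 1 + (z.1 : ℝ) ≤ (1 + w.1) * (1 + |jump z w|) := by
  have h1 : (0 : ℝ) ≤ w.1 := Nat.cast_nonneg _
  have h2 := neg_abs_le (jump z w)
  have h3 := abs_nonneg (jump z w)
  unfold jump at *
  nlinarith

/-- A function on the half strip which is bounded and vanishes at infinity. -/
lemma exists_abs_le_of_tendsto {g : ℕ × S → ℝ} {l : S → ℝ}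
    (h : ∀ i, Tendsto (fun x : ℕ => g (x, i)) atTop (𝓝 (l i))) : ∃ C, 0 ≤ C ∧ ∀ z, |g z| ≤ C := by
  have h1 : ∀ i, ∃ C, ∀ x, |g (x, i)| ≤ C := fun i => by
    obtain ⟨C, hC⟩ := (h i).abs.bddAbove_range
    exact ⟨C, fun x => hC ⟨x, rfl⟩⟩
  choose C hC using h1
  refine ⟨∑ i, |C i|, Finset.sum_nonneg fun i _ => abs_nonneg _, fun z => ?_⟩
  exact ((hC z.2 z.1).trans (le_abs_self _)).trans
    (Finset.single_le_sum (f := fun i => |C i|) (fun i _ => abs_nonneg _) (Finset.mem_univ z.2))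

lemma exists_le_add_div {g : ℕ × S → ℝ}
    (h : ∀ i, Tendsto (fun x : ℕ => g (x, i)) atTop (𝓝 0)) {ε : ℝ} (hε : 0 < ε) :
    ∃ B, 0 ≤ B ∧ ∀ z, |g z| ≤ ε + B / (1 + z.1) := by
  obtain ⟨C, hC0, hC⟩ := exists_abs_le_of_tendsto h
  have h1 : ∀ᶠ x : ℕ in atTop, ∀ i, |g (x, i)| < ε := by
    rw [eventually_all]
    intro i
    have := (h i).abs
    rw [abs_zero] at this
    exact this.eventually_lt_const hε
  obtain ⟨N, hN⟩ := eventually_atTop.1 h1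
  refine ⟨C * (1 + N), by positivity, fun z => ?_⟩
  rcases le_total N z.1 with h2 | h2
  · have := hN z.1 h2 z.2
    have h3 : 0 ≤ C * (1 + N) / (1 + (z.1 : ℝ)) := by positivity
    linarith
  · have h3 : C ≤ C * (1 + N) / (1 + (z.1 : ℝ)) := by
      rw [le_div_iff₀ (by positivity)]
      have : (z.1 : ℝ) ≤ N := by exact_mod_cast h2
      gcongr
    linarith [hC z]

lemma tendsto_const_div_one_add (B : ℝ) :
    Tendsto (fun x : ℕ => B / (1 + (x : ℝ))) atTop (𝓝 0) :=
  Tendsto.div_atTop tendsto_const_nhds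
    (tendsto_atTop_add_const_left _ _ tendsto_natCast_atTop_atTop)

lemma tendsto_zero_of_le_add_div {g : ℕ → ℝ}
    (h : ∀ ε > 0, ∃ B, ∀ x : ℕ, |g x| ≤ ε + B / (1 + x)) : Tendsto g atTop (𝓝 0) := by
  rw [Metric.tendsto_atTop']
  intro ε hε
  obtain ⟨B, hB⟩ := h (ε / 2) (half_pos hε)
  obtain ⟨N, hN⟩ := eventually_atTop.1
    ((tendsto_const_div_one_add B).eventually_lt_const (half_pos hε))
  refine ⟨N, fun n hn => ?_⟩
  rw [Real.dist_eq, sub_zero]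
  linarith [hB n, hN n hn.le]

section

variable {κ κ' : Kernel (ℕ × S) (ℕ × S)} [IsMarkovKernel κ] [IsMarkovKernel κ'] {C C' : ℝ≥0}

lemma BddMoment.integral_jump_div_le (hκ : BddMoment κ C) (z : ℕ × S) :
    ∫ w, (1 + |jump z w|) / (1 + (w.1 : ℝ)) ∂(κ z) ≤ 5 * (1 + C) / (1 + z.1) := by
  have h1 : ∀ w : ℕ × S, |(1 + |jump z w|) / (1 + (w.1 : ℝ))|
      ≤ 5 / (1 + z.1) * (1 + jump z w ^ 4) := by
    intro w
    rw [abs_of_nonneg (by positivity), div_mul_eq_mul_div,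
      div_le_div_iff₀ (by positivity) (by positivity)]
    have h2 := one_add_le_mul z w
    have h3 := abs_le_one_add_pow_four (jump z w)
    have h4 := sq_le_one_add_pow_four (jump z w)
    have h5 := abs_nonneg (jump z w)
    rw [← sq_abs] at h4
    calc (1 + |jump z w|) * (1 + (z.1 : ℝ))
        ≤ (1 + |jump z w|) * ((1 + w.1) * (1 + |jump z w|)) := by gcongr
      _ = (1 + 2 * |jump z w| + |jump z w| ^ 2) * (1 + w.1) := by ring
      _ ≤ 5 * (1 + jump z w ^ 4) * (1 + w.1) := by
        gcongr
        nlinarith [show 0 ≤ jump z w ^ 4 by positivity]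
  have := hκ.integral_abs_le z (by positivity) h1
  calc _ ≤ ∫ w, |(1 + |jump z w|) / (1 + (w.1 : ℝ))| ∂(κ z) :=
        (le_abs_self _).trans abs_integral_le_integral_abs
    _ ≤ _ := this.trans (by rw [div_mul_eq_mul_div])

lemma BddMoment.integrable_jump_div (hκ : BddMoment κ C) (z : ℕ × S) :
    Integrable (fun w : ℕ × S => (1 + |jump z w|) / (1 + (w.1 : ℝ))) (κ z) := by
  refine hκ.integrable z (A := 2) fun w => ?_
  rw [abs_of_nonneg (by positivity)]
  have h3 := abs_le_one_add_pow_four (jump z w)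
  have : (1 + |jump z w|) / (1 + (w.1 : ℝ)) ≤ 1 + |jump z w| :=
    div_le_self (by positivity) (by linarith [Nat.cast_nonneg (α := ℝ) w.1])
  nlinarith [show 0 ≤ jump z w ^ 4 by positivity]

lemma BddMoment.integral_inv_le (hκ : BddMoment κ C) (z : ℕ × S) :
    ∫ w : ℕ × S, 1 / (1 + (w.1 : ℝ)) ∂(κ z) ≤ 5 * (1 + C) / (1 + z.1) := by
  refine le_trans (integral_mono_of_nonneg (ae_of_all _ fun w => by positivity)
    (hκ.integrable_jump_div z) (ae_of_all _ fun w => ?_)) (hκ.integral_jump_div_le z)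
  simp only
  gcongr
  linarith [abs_nonneg (jump z w)]

lemma BddMoment.tendsto_integral_zero (hκ : BddMoment κ C) {g : ℕ × S → ℝ}
    (h : ∀ i, Tendsto (fun x : ℕ => g (x, i)) atTop (𝓝 0)) (i : S) :
    Tendsto (fun x : ℕ => ∫ w, g w ∂(κ (x, i))) atTop (𝓝 0) := by
  refine tendsto_zero_of_le_add_div fun ε hε => ?_
  obtain ⟨B, hB0, hB⟩ := exists_le_add_div h hε
  obtain ⟨C0, hC0, hC⟩ := exists_abs_le_of_tendsto h
  refine ⟨B * (5 * (1 + C)), fun x => ?_⟩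
  have i1 : Integrable (fun w : ℕ × S => 1 / (1 + (w.1 : ℝ))) (κ (x, i)) :=
    integrable_of_abs_le _ (C := 1) fun w => by
      rw [abs_of_nonneg (by positivity)]
      exact div_le_one_of_le₀ (by linarith [Nat.cast_nonneg (α := ℝ) w.1]) (by positivity)
  calc _ ≤ ∫ w, |g w| ∂(κ (x, i)) := abs_integral_le_integral_abs
    _ ≤ ∫ w : ℕ × S, (ε + B * (1 / (1 + (w.1 : ℝ)))) ∂(κ (x, i)) :=
        integral_mono (integrable_of_abs_le _ hC).abs
          ((integrable_const ε).add (i1.const_mul B)) fun w => by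
            simp only [mul_one_div]; exact hB w
    _ = ε + B * ∫ w : ℕ × S, 1 / (1 + (w.1 : ℝ)) ∂(κ (x, i)) := by
        rw [integral_add (integrable_const _) (i1.const_mul B), integral_const_mul]; simp
    _ ≤ _ := by
        have := hκ.integral_inv_le (x, i)
        rw [mul_div_assoc]
        gcongr

/-- Convergence of the transition probabilities of the second coordinate. -/
def QLim (κ : Kernel (ℕ × S) (ℕ × S)) (Q : S → S → ℝ) : Prop :=
  ∀ i j, Tendsto (fun x : ℕ => (κ (x, i)).real {w | w.2 = j}) atTop (𝓝 (Q i j))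

lemma integral_snd (z : ℕ × S) (f : S → ℝ) :
    ∫ w, f w.2 ∂(κ z) = ∑ j, (κ z).real {w | w.2 = j} * f j := by
  have h1 : (fun w : ℕ × S => f w.2)
      = fun w => ∑ j, Set.indicator {w : ℕ × S | w.2 = j} (fun _ => f j) w := by
    ext w
    simp [Set.indicator_apply]
  rw [h1, integral_finsetSum]
  · refine Finset.sum_congr rfl fun j _ => ?_
    rw [integral_indicator_const _ (MeasurableSet.of_discrete), smul_eq_mul]
  · intro j _
    exact (integrable_const _).indicator MeasurableSet.of_discrete

lemma QLim.tendsto_integral_snd {Q : S → S → ℝ} (hQ : QLim κ Q) (f : S → ℝ) (i : S) :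
    Tendsto (fun x : ℕ => ∫ w, f w.2 ∂(κ (x, i))) atTop (𝓝 (∑ j, Q i j * f j)) := by
  simp_rw [integral_snd]
  exact tendsto_finsetSum _ fun j _ => (hQ i j).mul_const _

lemma BddMoment.tendsto_integral (hκ : BddMoment κ C) {Q : S → S → ℝ} (hQ : QLim κ Q)
    {f : ℕ × S → ℝ} {l : S → ℝ}
    (h : ∀ i, Tendsto (fun x : ℕ => f (x, i)) atTop (𝓝 (l i))) (i : S) :
    Tendsto (fun x : ℕ => ∫ w, f w ∂(κ (x, i))) atTop (𝓝 (∑ j, Q i j * l j)) := by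
  have h0 : ∀ i, Tendsto (fun x : ℕ => f (x, i) - l i) atTop (𝓝 0) := fun i => by
    simpa using (h i).sub_const (l i)
  have h1 := hκ.tendsto_integral_zero (g := fun w => f w - l w.2) h0 i
  obtain ⟨C0, _, hC⟩ := exists_abs_le_of_tendsto h
  obtain ⟨C1, _, hC1⟩ := exists_abs_le_of_tendsto (g := fun w : ℕ × S => l w.2) (l := l)
    fun i => tendsto_const_nhds
  have h2 : ∀ x : ℕ, ∫ w, f w ∂(κ (x, i))
      = ∫ w, (f w - l w.2) ∂(κ (x, i)) + ∫ w, l w.2 ∂(κ (x, i)) := fun x => by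
    rw [integral_sub (integrable_of_abs_le _ hC) (integrable_of_abs_le _ hC1)]
    ring
  simp_rw [h2]
  simpa using h1.add (hQ.tendsto_integral_snd l i)

end

end

section

open ProbabilityTheory

/-- A kernel with bounded fourth moments and Lamperti type drift and second moments. -/
structure HasLam (κ : Kernel (ℕ × S) (ℕ × S)) (c s : S → ℝ) : Prop where
  moment : ∃ C, BddMoment κ C
  drift : ∀ i, Tendsto (fun x : ℕ => (1 + (x : ℝ)) * ∫ w, jump (x, i) w ∂(κ (x, i))) atTop (𝓝 (c i))
  second : ∀ i, Tendsto (fun x : ℕ => ∫ w, jump (x, i) w ^ 2 ∂(κ (x, i))) atTop (𝓝 (s i))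

lemma hasLam_stepKernel (X : MChain (ℕ × S)) {p : ℝ} (hp : 4 < p) (hB : CondB X p)
    {c s2 : S → ℝ} (hML : CondML X c s2) : HasLam X.stepKernel c s2 := by
  have e1 : ∀ (k x : ℕ) (i : S),
      ∫ w, jump (x, i) w ^ k ∂(X.stepKernel (x, i)) = stepMoment X k x i := by
    intro k x i
    rw [MChain.stepKernel_apply, integral_map (measurable_pi_apply 1).aemeasurable
      Measurable.of_discrete.aestronglyMeasurable]
    rfl
  refine ⟨?_, fun i => ?_, fun i => ?_⟩
  · obtain ⟨C, hC, h⟩ := hB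
    lift C to ℝ≥0 using hC
    refine ⟨1 + C, fun z => ?_⟩
    rw [MChain.stepKernel_apply, lintegral_map Measurable.of_discrete (measurable_pi_apply 1)]
    have h1 : ∀ d : ℝ, ENNReal.ofReal (d ^ 4) ≤ 1 + ENNReal.ofReal (|d| ^ p) := by
      intro d
      rw [← ENNReal.ofReal_one, ← ENNReal.ofReal_add zero_le_one (by positivity)]
      apply ENNReal.ofReal_le_ofReal
      have h4 : d ^ 4 = |d| ^ (4 : ℝ) := by
        rw [show (4 : ℝ) = ((4 : ℕ) : ℝ) by norm_num, Real.rpow_natCast]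
        rw [show (4 : ℕ) = 2 * 2 from rfl, pow_mul, pow_mul, sq_abs]
      rw [h4]
      rcases le_total |d| 1 with h5 | h5
      · have := Real.rpow_le_one (abs_nonneg d) h5 (show (0 : ℝ) ≤ 4 by norm_num)
        have := Real.rpow_nonneg (abs_nonneg d) p
        linarith
      · have := Real.rpow_le_rpow_of_exponent_le h5 hp.le
        linarith
    calc _ ≤ ∫⁻ ω, (1 + ENNReal.ofReal (|((ω 1).1 : ℝ) - (z.1 : ℝ)| ^ p)) ∂(X.P z) :=
          lintegral_mono fun ω => h1 _
      _ = 1 + ∫⁻ ω, ENNReal.ofReal (|((ω 1).1 : ℝ) - (z.1 : ℝ)| ^ p) ∂(X.P z) := by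
          rw [lintegral_add_left measurable_const]; simp
      _ ≤ _ := by
          rw [ENNReal.coe_add, ENNReal.coe_one]
          gcongr
          exact h z.1 z.2
  · have h1 := hML.2.2.1 i
    have h2 : ∀ x : ℕ, ∫ w, jump (x, i) w ∂(X.stepKernel (x, i)) = stepMoment X 1 x i :=
      fun x => by simpa using e1 1 x i
    simp_rw [h2]
    have h3 : Tendsto (fun x : ℕ => stepMoment X 1 x i) atTop (𝓝 0) := by
      have := (tendsto_inv_atTop_zero.comp (tendsto_natCast_atTop_atTop (R := ℝ))).mul h1
      rw [zero_mul] at this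
      refine this.congr' ?_
      filter_upwards [eventually_gt_atTop 0] with x hx
      have : (x : ℝ) ≠ 0 := by exact_mod_cast hx.ne'
      simp only [Function.comp]
      field_simp
    have := h3.add h1
    rw [zero_add] at this
    exact this.congr fun x => by ring
  · simp_rw [e1]
    exact hML.2.2.2 i

lemma qLim_stepKernel (X : MChain (ℕ × S)) {Q : S → S → ℝ} (hQ : CondQ X Q) :
    QLim X.stepKernel Q := by
  intro i j
  refine (hQ.1 i j).congr fun x => ?_
  rw [MChain.stepKernel_apply, measureReal_def, Measure.map_apply (measurable_pi_apply 1)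
    MeasurableSet.of_discrete]
  rfl

section

variable {κ κ' : Kernel (ℕ × S) (ℕ × S)} [IsMarkovKernel κ] [IsMarkovKernel κ']

lemma jump_eq_add (z w v : ℕ × S) : jump z v = jump z w + jump w v := by unfold jump; ring

lemma BddMoment.comp {C C' : ℝ≥0} (h : BddMoment κ C) (h' : BddMoment κ' C') :
    BddMoment (κ' ∘ₖ κ) (8 * C + 8 * C') := by
  intro z
  rw [Kernel.lintegral_comp _ _ _ Measurable.of_discrete]
  have h1 : ∀ w v : ℕ × S, ENNReal.ofReal (jump z v ^ 4)
      ≤ 8 * ENNReal.ofReal (jump z w ^ 4) + 8 * ENNReal.ofReal (jump w v ^ 4) := by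
    intro w v
    rw [show (8 : ℝ≥0∞) = ENNReal.ofReal 8 by simp, ← ENNReal.ofReal_mul (by norm_num),
      ← ENNReal.ofReal_mul (by norm_num), ← ENNReal.ofReal_add (by positivity) (by positivity),
      jump_eq_add z w v]
    apply ENNReal.ofReal_le_ofReal
    nlinarith [sq_nonneg (jump z w - jump w v), sq_nonneg (jump z w ^ 2 - jump w v ^ 2),
      sq_nonneg (jump z w + jump w v), sq_nonneg (jump z w * (jump z w - jump w v)),
      sq_nonneg (jump w v * (jump z w - jump w v))]
  calc _ ≤ ∫⁻ w, (8 * ENNReal.ofReal (jump z w ^ 4) + 8 * C') ∂(κ z) := by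
        refine lintegral_mono fun w => (lintegral_mono (h1 w)).trans ?_
        rw [lintegral_add_left measurable_const,
          lintegral_const_mul (f := fun v => ENNReal.ofReal (jump w v ^ 4)) _
            Measurable.of_discrete]
        simp only [lintegral_const, measure_univ, mul_one]
        exact add_le_add le_rfl (mul_le_mul' le_rfl (h' w))
    _ ≤ _ := by
        rw [lintegral_add_left Measurable.of_discrete,
          lintegral_const_mul _ Measurable.of_discrete]
        simp only [lintegral_const, measure_univ, mul_one, ENNReal.coe_add, ENNReal.coe_mul]
        gcongr
        · norm_num
        · exact h z
        · norm_num

/-- The drift of a Lamperti kernel times the (shifted) position is bounded. -/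
lemma HasLam.abs_drift_le {c s : S → ℝ} (h : HasLam κ c s) :
    ∃ D, 0 ≤ D ∧ ∀ w, |∫ v, jump w v ∂(κ w)| ≤ D / (1 + w.1) := by
  obtain ⟨D, hD0, hD⟩ := exists_abs_le_of_tendsto
    (g := fun w : ℕ × S => (1 + (w.1 : ℝ)) * ∫ v, jump w v ∂(κ w)) h.drift
  refine ⟨D, hD0, fun w => ?_⟩
  have := hD w
  rw [abs_mul, abs_of_nonneg (by positivity)] at this
  rw [le_div_iff₀ (by positivity)]
  linarith

lemma HasLam.comp {Q : S → S → ℝ} {c s c' s' : S → ℝ} (hQ : QLim κ Q) (h : HasLam κ c s)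
    (h' : HasLam κ' c' s') :
    HasLam (κ' ∘ₖ κ) (fun i => c i + ∑ j, Q i j * c' j) (fun i => s i + ∑ j, Q i j * s' j) := by
  obtain ⟨C, hC⟩ := h.moment
  obtain ⟨C', hC'⟩ := h'.moment
  obtain ⟨D, hD0, hD⟩ := h'.abs_drift_le
  have hCC := hC.comp hC'
  have i1 : ∀ z, Integrable (fun w => jump z w) (κ z) := fun z =>
    hC.integrable z (A := 1) fun w => by rw [one_mul]; exact abs_le_one_add_pow_four _
  have i2 : ∀ z, Integrable (fun w => jump z w ^ 2) (κ z) := fun z =>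
    hC.integrable z (A := 1) fun w => by
      rw [one_mul, abs_of_nonneg (sq_nonneg _)]; exact sq_le_one_add_pow_four _
  have i1' : ∀ z, Integrable (fun w => jump z w) (κ' z) := fun z =>
    hC'.integrable z (A := 1) fun w => by rw [one_mul]; exact abs_le_one_add_pow_four _
  have i2' : ∀ z, Integrable (fun w => jump z w ^ 2) (κ' z) := fun z =>
    hC'.integrable z (A := 1) fun w => by
      rw [one_mul, abs_of_nonneg (sq_nonneg _)]; exact sq_le_one_add_pow_four _
  have i1c : ∀ z, Integrable (fun w => jump z w) ((κ' ∘ₖ κ) z) := fun z =>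
    hCC.integrable z (A := 1) fun w => by rw [one_mul]; exact abs_le_one_add_pow_four _
  have i2c : ∀ z, Integrable (fun w => jump z w ^ 2) ((κ' ∘ₖ κ) z) := fun z =>
    hCC.integrable z (A := 1) fun w => by
      rw [one_mul, abs_of_nonneg (sq_nonneg _)]; exact sq_le_one_add_pow_four _
  have hbd : ∀ w : ℕ × S, |∫ v, jump w v ∂(κ' w)| ≤ D := fun w =>
    (hD w).trans (div_le_self hD0 (by linarith [Nat.cast_nonneg (α := ℝ) w.1]))
  have im : ∀ z, Integrable (fun w => ∫ v, jump w v ∂(κ' w)) (κ z) := fun z =>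
    integrable_of_abs_le _ hbd
  have is : ∀ z, Integrable (fun w => ∫ v, jump w v ^ 2 ∂(κ' w)) (κ z) := by
    intro z
    obtain ⟨B, _, hB⟩ := exists_abs_le_of_tendsto
      (g := fun w : ℕ × S => ∫ v, jump w v ^ 2 ∂(κ' w)) h'.second
    exact integrable_of_abs_le _ hB
  have ix : ∀ z, Integrable (fun w => jump z w * ∫ v, jump w v ∂(κ' w)) (κ z) := fun z =>
    (i1 z).mul_bdd (c := D) Measurable.of_discrete.aestronglyMeasurable (ae_of_all _ hbd)
  have hx : ∀ z, |∫ w, jump z w * ∫ v, jump w v ∂(κ' w) ∂(κ z)|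
      ≤ D * (5 * (1 + C) / (1 + z.1)) := by
    intro z
    calc _ ≤ ∫ w, |jump z w * ∫ v, jump w v ∂(κ' w)| ∂(κ z) := abs_integral_le_integral_abs
      _ ≤ ∫ w, D * ((1 + |jump z w|) / (1 + (w.1 : ℝ))) ∂(κ z) := by
          refine integral_mono (ix z).abs ((hC.integrable_jump_div z).const_mul D) fun w => ?_
          simp only
          rw [abs_mul]
          calc _ ≤ (1 + |jump z w|) * (D / (1 + w.1)) := by
                gcongr
                · linarith
                · exact hD w
            _ = _ := by ring
      _ ≤ _ := by
          rw [integral_const_mul]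
          exact mul_le_mul_of_nonneg_left (hC.integral_jump_div_le z) hD0
  refine ⟨⟨_, hCC⟩, fun i => ?_, fun i => ?_⟩
  · have e : ∀ z, ∫ v, jump z v ∂((κ' ∘ₖ κ) z)
        = ∫ w, jump z w ∂(κ z) + ∫ w, (∫ v, jump w v ∂(κ' w)) ∂(κ z) := by
      intro z
      rw [Kernel.integral_comp (i1c z), ← integral_add (i1 z) (im z)]
      refine integral_congr_ae (ae_of_all _ fun w => ?_)
      have e3 : (fun v => jump z v) = fun v => jump z w + jump w v :=
        funext fun v => jump_eq_add z w v
      simp only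
      rw [e3, integral_add (integrable_const _) (i1' w)]
      simp
    have e2 : ∀ x : ℕ, (1 + (x : ℝ)) * ∫ v, jump (x, i) v ∂((κ' ∘ₖ κ) (x, i))
        = (1 + (x : ℝ)) * ∫ w, jump (x, i) w ∂(κ (x, i))
          + (∫ w : ℕ × S, ((1 + (w.1 : ℝ)) * ∫ v, jump w v ∂(κ' w)) ∂(κ (x, i))
          - ∫ w, jump (x, i) w * ∫ v, jump w v ∂(κ' w) ∂(κ (x, i))) := by
      intro x
      have ib : Integrable (fun w : ℕ × S => (1 + (w.1 : ℝ)) * ∫ v, jump w v ∂(κ' w))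
          (κ (x, i)) := by
        obtain ⟨B, _, hB⟩ := exists_abs_le_of_tendsto
          (g := fun w : ℕ × S => (1 + (w.1 : ℝ)) * ∫ v, jump w v ∂(κ' w)) h'.drift
        exact integrable_of_abs_le _ hB
      rw [e, mul_add, ← integral_sub ib (ix _), ← integral_const_mul (1 + (x : ℝ))
        (fun w => ∫ v, jump w v ∂(κ' w))]
      congr 1
      refine integral_congr_ae (ae_of_all _ fun w => ?_)
      simp only [jump]
      ring
    have t1 := hC.tendsto_integral hQ
      (f := fun w : ℕ × S => (1 + (w.1 : ℝ)) * ∫ v, jump w v ∂(κ' w)) h'.drift i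
    have t2 : Tendsto (fun x : ℕ => ∫ w, jump (x, i) w * ∫ v, jump w v ∂(κ' w) ∂(κ (x, i)))
        atTop (𝓝 0) := squeeze_zero_norm (fun x => hx (x, i)) (by
          simp_rw [← mul_div_assoc]
          exact tendsto_const_div_one_add _)
    simp_rw [e2]
    simpa using (h.drift i).add (t1.sub t2)
  · have e : ∀ z, ∫ v, jump z v ^ 2 ∂((κ' ∘ₖ κ) z)
        = ∫ w, jump z w ^ 2 ∂(κ z) + (2 * ∫ w, jump z w * ∫ v, jump w v ∂(κ' w) ∂(κ z)
          + ∫ w, (∫ v, jump w v ^ 2 ∂(κ' w)) ∂(κ z)) := by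
      intro z
      have i3 : Integrable (fun w => 2 * (jump z w * ∫ v, jump w v ∂(κ' w))
          + ∫ v, jump w v ^ 2 ∂(κ' w)) (κ z) := ((ix z).const_mul 2).add (is z)
      rw [Kernel.integral_comp (i2c z), ← integral_const_mul,
        ← integral_add ((ix z).const_mul 2) (is z), ← integral_add (i2 z) i3]
      refine integral_congr_ae (ae_of_all _ fun w => ?_)
      simp only
      have e3 : (fun v => jump z v ^ 2)
          = fun v => jump z w ^ 2 + (2 * jump z w * jump w v + jump w v ^ 2) :=
        funext fun v => by rw [jump_eq_add z w]; ring
      have i4 : Integrable (fun v => 2 * jump z w * jump w v + jump w v ^ 2) (κ' w) :=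
        ((i1' w).const_mul _).add (i2' w)
      rw [e3, integral_add (integrable_const _) i4, integral_add ((i1' w).const_mul _) (i2' w),
        integral_const_mul]
      simp [mul_assoc]
    have t1 := hC.tendsto_integral hQ
      (f := fun w : ℕ × S => ∫ v, jump w v ^ 2 ∂(κ' w)) h'.second i
    have t2 : Tendsto (fun x : ℕ => ∫ w, jump (x, i) w * ∫ v, jump w v ∂(κ' w) ∂(κ (x, i)))
        atTop (𝓝 0) := squeeze_zero_norm (fun x => hx (x, i)) (by
          simp_rw [← mul_div_assoc]
          exact tendsto_const_div_one_add _)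
    simp_rw [e]
    simpa using (h.second i).add ((t2.const_mul 2).add t1)

/-- Powers of a Lamperti kernel are Lamperti kernels. -/
lemma HasLam.pow {Q : S → S → ℝ} {c s : S → ℝ} (hQ : QLim κ Q) (h : HasLam κ c s) (L : ℕ) :
    HasLam (κ ^ L) (iterSum Q c L) (iterSum Q s L) := by
  induction L with
  | zero =>
    have e : κ ^ 0 = Kernel.id := pow_zero κ
    rw [e]
    refine ⟨⟨0, fun z => ?_⟩, fun i => ?_, fun i => ?_⟩
    · simp [Kernel.id_apply, jump]
    · simp [Kernel.id_apply, jump, iterSum]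
    · simp [Kernel.id_apply, jump, iterSum]
  | succ L ih =>
    have e : κ ^ (L + 1) = (κ ^ L) ∘ₖ κ := pow_succ κ L
    rw [e]
    exact h.comp hQ ih

end

end

section

open ProbabilityTheory

/-- The squared excess of the first coordinate over the level `K`. -/
def sqExcess (K : ℕ) (w : ℕ × S) : ℝ := (max ((w.1 : ℝ) - K) 0) ^ 2

lemma min_le_sq_max_sub {r : ℝ} (hr : 0 ≤ r) (d : ℝ) :
    2 * r * d + min (d ^ 2) (r * |d|) ≤ (max (r + d) 0) ^ 2 - r ^ 2 := by
  rcases le_total 0 (r + d) with h | h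
  · rw [max_eq_left h]
    have := min_le_left (d ^ 2) (r * |d|)
    nlinarith
  · rw [max_eq_right h]
    have := min_le_right (d ^ 2) (r * |d|)
    rw [abs_of_nonpos (by linarith)] at this ⊢
    nlinarith

lemma sub_le_min_of_le {r R : ℝ} (hR : 1 ≤ R) (hr : R ≤ r) (d : ℝ) :
    d ^ 2 - |d| ^ 3 / R ≤ min (d ^ 2) (r * |d|) := by
  have hd := abs_nonneg d
  have h3 : 0 ≤ |d| ^ 3 / R := by positivity
  refine le_min (by linarith) ?_
  rw [← sq_abs]
  rcases le_total |d| R with h | h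
  · nlinarith
  · have : |d| ^ 2 ≤ |d| ^ 3 / R := by
      rw [le_div_iff₀ (by linarith), pow_succ |d| 2]
      gcongr
    have h5 : 0 ≤ r * |d| := mul_nonneg (by linarith) hd
    linarith

lemma sub_div_le_min {r R : ℝ} (hr : 1 ≤ r) (hR : 1 ≤ R) (d : ℝ) :
    (d ^ 2 - |d| ^ 3 / R) / R ≤ min (d ^ 2) (r * |d|) := by
  have hd := abs_nonneg d
  have h3 : 0 ≤ |d| ^ 3 / R := by positivity
  refine le_min ?_ ?_
  · rw [div_le_iff₀ (by linarith)]
    nlinarith [sq_nonneg d]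
  · rw [div_le_iff₀ (by linarith), ← sq_abs]
    have h6 : |d| * R ≤ r * |d| * R := by
      have : 0 ≤ |d| * R := by positivity
      nlinarith
    rcases le_total |d| R with h | h
    · nlinarith
    · have : |d| ^ 2 ≤ |d| ^ 3 / R := by
        rw [le_div_iff₀ (by linarith), pow_succ |d| 2]
        gcongr
      have h5 : 0 ≤ |d| * R := by positivity
      linarith

lemma exists_pos_le (f : S → ℝ) (hf : ∀ i, 0 < f i) : ∃ δ, 0 < δ ∧ ∀ i, δ ≤ f i := by
  obtain ⟨i, hi⟩ := Finite.exists_min f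
  exact ⟨f i, hf i, hi⟩

section

variable {κ : Kernel (ℕ × S) (ℕ × S)} [IsMarkovKernel κ] {C : ℝ≥0}

lemma BddMoment.integrable_jump (h : BddMoment κ C) (z : ℕ × S) :
    Integrable (fun w => jump z w) (κ z) :=
  h.integrable z (A := 1) fun w => by rw [one_mul]; exact abs_le_one_add_pow_four _

lemma BddMoment.integrable_sq (h : BddMoment κ C) (z : ℕ × S) :
    Integrable (fun w => jump z w ^ 2) (κ z) :=
  h.integrable z (A := 1) fun w => by
    rw [one_mul, abs_of_nonneg (sq_nonneg _)]; exact sq_le_one_add_pow_four _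

lemma BddMoment.integrable_cube (h : BddMoment κ C) (z : ℕ × S) :
    Integrable (fun w => |jump z w| ^ 3) (κ z) :=
  h.integrable z (A := 1) fun w => by
    rw [one_mul, abs_of_nonneg (by positivity)]; exact abs_pow_three_le _

lemma BddMoment.integral_cube_le (h : BddMoment κ C) (z : ℕ × S) :
    ∫ w, |jump z w| ^ 3 ∂(κ z) ≤ 1 + C := by
  have := h.abs_integral_le z (f := fun w => |jump z w| ^ 3) zero_le_one fun w => by
    rw [one_mul, abs_of_nonneg (by positivity)]; exact abs_pow_three_le _
  rw [one_mul] at this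
  exact (le_abs_self _).trans this

lemma abs_sqExcess_sub_le (K : ℕ) (z w : ℕ × S) :
    |sqExcess K w - sqExcess K z|
      ≤ |jump z w| * (2 * max ((z.1 : ℝ) - K) 0 + |jump z w|) := by
  unfold sqExcess
  set a := max ((z.1 : ℝ) - K) 0
  set b := max ((w.1 : ℝ) - K) 0
  have ha : 0 ≤ a := le_max_right _ _
  have hb : 0 ≤ b := le_max_right _ _
  have h1 : |b - a| ≤ |jump z w| := by
    have := abs_max_sub_max_le_abs ((w.1 : ℝ) - K) (z.1 - K) 0
    unfold jump
    rwa [sub_sub_sub_cancel_right] at this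
  have h2 : b ≤ a + |jump z w| := by linarith [le_abs_self (b - a)]
  rw [show b ^ 2 - a ^ 2 = (b - a) * (b + a) by ring, abs_mul, abs_of_nonneg (add_nonneg hb ha)]
  exact mul_le_mul h1 (by linarith) (add_nonneg hb ha) (abs_nonneg _)

lemma BddMoment.integrable_sqExcess_sub (h : BddMoment κ C) (K : ℕ) (z : ℕ × S) :
    Integrable (fun w => sqExcess K w - sqExcess K z) (κ z) := by
  have ha : (0 : ℝ) ≤ max ((z.1 : ℝ) - K) 0 := le_max_right _ _
  refine h.integrable z (A := 2 * max ((z.1 : ℝ) - K) 0 + 1) fun w => ?_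
  refine (abs_sqExcess_sub_le K z w).trans ?_
  have h1 := abs_le_one_add_pow_four (jump z w)
  have h2 := sq_le_one_add_pow_four (jump z w)
  rw [← sq_abs] at h2
  nlinarith

/-- A convex Lyapunov function for a Lamperti kernel with uniformly positive parameters. -/
lemma HasLam.exists_lyapunov {c s : S → ℝ} (h : HasLam κ c s) (hs : ∀ i, 0 < s i)
    (hcs : ∀ i, 0 < 2 * c i + s i) :
    ∃ K : ℕ, ∀ z : ℕ × S, 0 ≤ ∫ w, (sqExcess K w - sqExcess K z) ∂(κ z) ∧
      (K < z.1 → 0 < ∫ w, (sqExcess K w - sqExcess K z) ∂(κ z)) := by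
  obtain ⟨C, hC⟩ := h.moment
  obtain ⟨D0, hD0, hD⟩ := h.abs_drift_le
  obtain ⟨δ, hδ, hδ'⟩ := exists_pos_le (fun i => min (s i) (2 * c i + s i))
    fun i => lt_min (hs i) (hcs i)
  have hδ1 : ∀ i, δ ≤ s i := fun i => (hδ' i).trans (min_le_left _ _)
  have hδ2 : ∀ i, δ ≤ 2 * c i + s i := fun i => (hδ' i).trans (min_le_right _ _)
  set R : ℝ := 1 + 8 * (1 + C) / δ with hRdef
  have hR1 : 1 ≤ R := by rw [hRdef]; have : 0 ≤ 8 * (1 + (C : ℝ)) / δ := by positivity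
                         linarith
  have hR0 : 0 < R := by linarith
  have hRC : (1 + (C : ℝ)) / R ≤ δ / 8 := by
    rw [div_le_iff₀ hR0, hRdef]
    have : δ / 8 * (8 * (1 + (C : ℝ)) / δ) = 1 + C := by field_simp
    nlinarith
  have ev : ∀ᶠ x : ℕ in atTop, (∀ i, |(1 + (x : ℝ)) * ∫ w, jump (x, i) w ∂(κ (x, i)) - c i| < δ / 8)
      ∧ (∀ i, |∫ w, jump (x, i) w ^ 2 ∂(κ (x, i)) - s i| < δ / 8)
      ∧ 2 * R * D0 / (1 + (x : ℝ)) < δ / (2 * R) := by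
    refine (eventually_all.2 fun i => ?_).and ((eventually_all.2 fun i => ?_).and ?_)
    · exact Metric.tendsto_nhds.1 (h.drift i) _ (by positivity)
    · exact Metric.tendsto_nhds.1 (h.second i) _ (by positivity)
    · exact (tendsto_const_div_one_add _).eventually_lt_const (by positivity)
  obtain ⟨K, hK⟩ := eventually_atTop.1 ev
  refine ⟨K, fun z => ?_⟩
  have key : K < z.1 → 0 < ∫ w, (sqExcess K w - sqExcess K z) ∂(κ z) := by
    intro hz
    obtain ⟨x, i⟩ := z
    simp only at hz
    obtain ⟨h1, h2, h3⟩ := hK x hz.le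
    replace h1 := (abs_lt.1 (h1 i)).1
    replace h2 := (abs_lt.1 (h2 i)).1
    have hDx := (abs_le.1 (hD (x, i))).1
    set m1 := ∫ w, jump (x, i) w ∂(κ (x, i)) with hm1
    set m2 := ∫ w, jump (x, i) w ^ 2 ∂(κ (x, i)) with hm2
    set r : ℝ := (x : ℝ) - K with hr
    have hr1 : 1 ≤ r := by
      have : ((K + 1 : ℕ) : ℝ) ≤ x := by exact_mod_cast hz
      push_cast at this
      linarith
    have hpt : ∀ w : ℕ × S, 2 * r * jump (x, i) w + min (jump (x, i) w ^ 2) (r * |jump (x, i) w|)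
        ≤ sqExcess K w - sqExcess K (x, i) := by
      intro w
      have := min_le_sq_max_sub (r := r) (by linarith) (jump (x, i) w)
      unfold sqExcess
      simp only
      rw [← hr, max_eq_left (show 0 ≤ r by linarith)]
      rwa [show r + jump (x, i) w = (w.1 : ℝ) - K by rw [hr, jump]; ring] at this
    have i1 := (hC.integrable_jump (x, i)).const_mul (2 * r)
    have i2 := hC.integrable_sq (x, i)
    have i3 := (hC.integrable_cube (x, i)).div_const R
    have i23 := i2.sub i3
    have iD := hC.integrable_sqExcess_sub K (x, i)
    have e23 : δ - δ / 4 ≤ ∫ w, ((fun w => jump (x, i) w ^ 2) - fun w => |jump (x, i) w| ^ 3 / R) w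
        ∂(κ (x, i)) - (s i - δ) := by
      rw [integral_sub' i2 i3, integral_div, ← hm2]
      have := div_le_div_of_nonneg_right (hC.integral_cube_le (x, i)) hR0.le
      linarith
    rcases le_total r R with hrR | hrR
    · have hI := integral_mono (i1.add (i23.div_const R)) iD fun w =>
        (add_le_add le_rfl (sub_div_le_min hr1 hR1 (jump (x, i) w))).trans (hpt w)
      rw [integral_add' i1 (i23.div_const R), integral_const_mul, ← hm1, integral_div] at hI
      refine lt_of_lt_of_le ?_ hI
      have h5 : δ / (2 * R) ≤ (∫ w, ((fun w => jump (x, i) w ^ 2)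
          - fun w => |jump (x, i) w| ^ 3 / R) w ∂(κ (x, i))) / R := by
        rw [div_le_div_iff₀ (by positivity) hR0]
        have := hδ1 i
        nlinarith
      have h6 : -(2 * R * D0 / (1 + (x : ℝ))) ≤ 2 * r * m1 := by
        have h7 : 0 ≤ D0 / (1 + (x : ℝ)) := by positivity
        have h8 : 2 * R * D0 / (1 + (x : ℝ)) = 2 * R * (D0 / (1 + (x : ℝ))) := by ring
        rw [h8]
        simp only at hDx
        nlinarith
      linarith
    · have hI := integral_mono (i1.add i23) iD fun w =>
        (add_le_add le_rfl (sub_le_min_of_le hR1 hrR (jump (x, i) w))).trans (hpt w)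
      rw [integral_add' i1 i23, integral_const_mul, ← hm1] at hI
      refine lt_of_lt_of_le ?_ hI
      set u : ℝ := r / (1 + x) with hu
      have hx0 : (0 : ℝ) < 1 + x := by positivity
      have hu0 : 0 ≤ u := by rw [hu]; exact div_nonneg (by linarith) hx0.le
      have hu1 : u ≤ 1 := by
        rw [hu, div_le_one hx0]
        have : (0 : ℝ) ≤ K := Nat.cast_nonneg _
        linarith
      have h6 : 2 * r * m1 = 2 * u * ((1 + x) * m1) := by
        rw [hu]; field_simp
      have h7 : 2 * u * (c i - δ / 8) ≤ 2 * r * m1 := by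
        rw [h6]
        exact mul_le_mul_of_nonneg_left (by linarith) (by linarith)
      have := hδ1 i
      have := hδ2 i
      nlinarith
  refine ⟨?_, key⟩
  rcases lt_or_ge K z.1 with hz | hz
  · exact (key hz).le
  · refine integral_nonneg fun w => ?_
    have : sqExcess K z = 0 := by
      unfold sqExcess
      have : (z.1 : ℝ) ≤ K := by exact_mod_cast hz
      rw [max_eq_right (by linarith)]; norm_num
    rw [this, sub_zero]
    exact sq_nonneg _

end

end

section

open ProbabilityTheory

lemma integral_integral_of_invariant {E : Type*} [MeasurableSpace E] [Countable E]
    [DiscreteMeasurableSpace E] {κ : Kernel E E} [IsMarkovKernel κ] {μ : Measure E}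
    [IsFiniteMeasure μ] (hμ : Kernel.Invariant κ μ) {f : E → ℝ} {C : ℝ} (hf : ∀ z, |f z| ≤ C) :
    ∫ z, (∫ w, f w ∂(κ z)) ∂μ = ∫ z, f z ∂μ := by
  have h1 : Integrable f ((κ ∘ₖ Kernel.const Unit μ) ()) := by
    rw [Kernel.comp_const, hμ.def, Kernel.const_apply]
    exact integrable_of_abs_le _ hf
  have h2 := Kernel.integral_comp h1
  rw [Kernel.comp_const, hμ.def, Kernel.const_apply] at h2
  exact h2.symm

section

variable {κ : Kernel (ℕ × S) (ℕ × S)} [IsMarkovKernel κ] {C : ℝ≥0}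

/-- The truncated function `M F / (M + F)` satisfies a one-step comparison with `F`. -/
lemma truncation_sub {M a b : ℝ} (hM : 0 < M) (ha : 0 ≤ a) (hb : 0 ≤ b) :
    (M / (M + a)) ^ 2 * (b - a) ≤
      M * b / (M + b) - M * a / (M + a) + (b - a) ^ 2 / (M + b) := by
  have h1 : 0 < M + a := by linarith
  have h2 : 0 < M + b := by linarith
  have e : M * b / (M + b) - M * a / (M + a)
      = (M / (M + a)) ^ 2 * (b - a) - (M / (M + a)) ^ 2 * ((b - a) ^ 2 / (M + b)) := by
    field_simp
    ring
  rw [e]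
  have h3 : (M / (M + a)) ^ 2 ≤ 1 :=
    pow_le_one₀ (by positivity) ((div_le_one h1).2 (by linarith))
  have h4 : 0 ≤ (b - a) ^ 2 / (M + b) := by positivity
  nlinarith

lemma sqExcess_nonneg (K : ℕ) (w : ℕ × S) : 0 ≤ sqExcess K w := sq_nonneg _

lemma sqExcess_sub_sq_le (K : ℕ) (z w : ℕ × S) :
    (sqExcess K w - sqExcess K z) ^ 2 ≤
      (8 * sqExcess K z + 2) * (1 + jump z w ^ 4) := by
  have h := abs_sqExcess_sub_le K z w
  rw [← sq_abs (sqExcess K w - sqExcess K z)]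
  have ha : (0 : ℝ) ≤ max ((z.1 : ℝ) - K) 0 := le_max_right _ _
  have h1 : |sqExcess K w - sqExcess K z| ^ 2
      ≤ (|jump z w| * (2 * max ((z.1 : ℝ) - K) 0 + |jump z w|)) ^ 2 := by gcongr
  refine h1.trans ?_
  have h2 := sq_le_one_add_pow_four (jump z w)
  have h4 : jump z w ^ 4 = |jump z w| ^ 4 := by
    rw [show (4 : ℕ) = 2 * 2 from rfl, pow_mul, pow_mul, sq_abs]
  rw [← sq_abs] at h2
  rw [h4] at h2 ⊢
  unfold sqExcess
  set a := max ((z.1 : ℝ) - K) 0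
  set d := |jump z w|
  have h5 : (d * (2 * a + d)) ^ 2 ≤ 8 * a ^ 2 * d ^ 2 + 2 * d ^ 4 := by
    nlinarith [sq_nonneg (d * (2 * a - d))]
  nlinarith [sq_nonneg a]

lemma sqExcess_sub_sq_div_le (K : ℕ) (z w : ℕ × S) {M : ℝ} (hM : 1 ≤ M) :
    (sqExcess K w - sqExcess K z) ^ 2 / (M + sqExcess K w) ≤ 10 * (1 + jump z w ^ 4) := by
  have hw := sqExcess_nonneg K w
  rw [div_le_iff₀ (by linarith)]
  have h := abs_sqExcess_sub_le K w z
  have ej : |jump w z| = |jump z w| := by unfold jump; exact abs_sub_comm _ _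
  rw [abs_sub_comm, ej] at h
  rw [← sq_abs (sqExcess K w - sqExcess K z)]
  have ha : (0 : ℝ) ≤ max ((w.1 : ℝ) - K) 0 := le_max_right _ _
  have h1 : |sqExcess K w - sqExcess K z| ^ 2
      ≤ (|jump z w| * (2 * max ((w.1 : ℝ) - K) 0 + |jump z w|)) ^ 2 := by gcongr
  refine h1.trans ?_
  have h2 := sq_le_one_add_pow_four (jump z w)
  have h4 : jump z w ^ 4 = |jump z w| ^ 4 := by
    rw [show (4 : ℕ) = 2 * 2 from rfl, pow_mul, pow_mul, sq_abs]
  rw [← sq_abs] at h2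
  rw [h4] at h2 ⊢
  unfold sqExcess
  set a := max ((w.1 : ℝ) - K) 0
  set d := |jump z w|
  have h5 : (d * (2 * a + d)) ^ 2 ≤ 8 * a ^ 2 * d ^ 2 + 2 * d ^ 4 := by
    nlinarith [sq_nonneg (d * (2 * a - d))]
  have h6 : 0 ≤ d ^ 4 := by positivity
  nlinarith [sq_nonneg a, mul_nonneg h6 (sq_nonneg a), mul_nonneg h6 (sub_nonneg.2 hM),
    mul_le_mul_of_nonneg_left h2 (sq_nonneg a)]

lemma measure_singleton_eq_zero_of_invariant (hC : BddMoment κ C) {μ : Measure (ℕ × S)}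
    [IsFiniteMeasure μ] (hμ : Kernel.Invariant κ μ) {K : ℕ}
    (hK : ∀ z, 0 ≤ ∫ w, (sqExcess K w - sqExcess K z) ∂(κ z)) {z : ℕ × S}
    (hz : 0 < ∫ w, (sqExcess K w - sqExcess K z) ∂(κ z)) : μ {z} = 0 := by
  set D : ℕ × S → ℝ := fun z => ∫ w, (sqExcess K w - sqExcess K z) ∂(κ z) with hD
  set T : ℕ → ℕ × S → ℝ := fun n w => n * sqExcess K w / (n + sqExcess K w) with hT
  set ρ : ℕ → ℕ × S → ℝ := fun n z =>
    ∫ w, (sqExcess K w - sqExcess K z) ^ 2 / (n + sqExcess K w) ∂(κ z) with hρ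
  have hF := sqExcess_nonneg (S := S) K
  have hTb : ∀ n w, |T n w| ≤ n := by
    intro n w
    have := hF w
    rw [hT, abs_of_nonneg (by positivity)]
    rcases Nat.eq_zero_or_pos n with rfl | hn
    · simp
    · have : (0 : ℝ) < n := by exact_mod_cast hn
      rw [div_le_iff₀ (by positivity)]
      nlinarith
  have hρi : ∀ n : ℕ, 1 ≤ n → ∀ z, Integrable (fun w =>
      (sqExcess K w - sqExcess K z) ^ 2 / (n + sqExcess K w)) (κ z) := fun n hn z =>
    hC.integrable z (A := 10) fun w => by
      have := hF w
      rw [abs_of_nonneg (by positivity)]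
      exact sqExcess_sub_sq_div_le K z w (by exact_mod_cast hn)
  have hρ0 : ∀ n z, 0 ≤ ρ n z := fun n z => integral_nonneg fun w => by
    have := hF w
    positivity
  have hρb : ∀ n : ℕ, 1 ≤ n → ∀ z, |ρ n z| ≤ 10 * (1 + C) := fun n hn z =>
    hC.abs_integral_le z (by norm_num) fun w => by
      have := hF w
      rw [abs_of_nonneg (by positivity)]
      exact sqExcess_sub_sq_div_le K z w (by exact_mod_cast hn)
  have hρt : ∀ z, Tendsto (fun n => ρ n z) atTop (𝓝 0) := by
    intro z
    refine squeeze_zero' (Eventually.of_forall fun n => hρ0 n z)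
      (g := fun n : ℕ => ((8 * sqExcess K z + 2) * (1 + C)) / n) ?_
      (tendsto_const_div_atTop_nhds_zero_nat _)
    filter_upwards [eventually_ge_atTop 1] with n hn
    have hn' : (1 : ℝ) ≤ n := by exact_mod_cast hn
    have hz := hF z
    have := hC.abs_integral_le z (A := (8 * sqExcess K z + 2) / n)
      (f := fun w => (sqExcess K w - sqExcess K z) ^ 2 / (n + sqExcess K w)) (by positivity)
      fun w => by
        have hw := hF w
        rw [abs_of_nonneg (by positivity), div_mul_eq_mul_div]
        exact div_le_div₀ (by positivity) (sqExcess_sub_sq_le K z w) (by linarith) (by linarith)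
    rw [← div_mul_eq_mul_div]
    exact (le_abs_self _).trans this
  have hstep : ∀ n : ℕ, 1 ≤ n → ∀ z, ((n : ℝ) / (n + sqExcess K z)) ^ 2 * D z
      ≤ ∫ w, T n w ∂(κ z) - T n z + ρ n z := by
    intro n hn z
    have hn' : (0 : ℝ) < n := by exact_mod_cast hn
    have i1 := (hC.integrable_sqExcess_sub K z).const_mul (((n : ℝ) / (n + sqExcess K z)) ^ 2)
    have i2 : Integrable (T n) (κ z) := integrable_of_abs_le _ (hTb n)
    have i3 : Integrable (fun w => T n w - T n z) (κ z) := i2.sub (integrable_const _)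
    have := integral_mono i1 (i3.add (hρi n hn z)) fun w => truncation_sub hn' (hF z) (hF w)
    rw [integral_const_mul, integral_add' i3 (hρi n hn z),
      integral_sub i2 (integrable_const _)] at this
    simpa using this
  have hlim : Tendsto (fun n => ∫ z, ρ n z ∂μ) atTop (𝓝 0) := by
    have h1 := tendsto_integral_filter_of_dominated_convergence (μ := μ) (l := atTop) (F := ρ)
      (f := fun _ => (0 : ℝ)) (fun _ => 10 * (1 + (C : ℝ)))
      (Eventually.of_forall fun n => Measurable.of_discrete.aestronglyMeasurable)
      (by
        filter_upwards [eventually_ge_atTop 1] with n hn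
        exact ae_of_all _ (hρb n hn)) (integrable_const _) (ae_of_all _ hρt)
    simpa using h1
  have hle : ∀ n : ℕ, 1 ≤ n →
      μ.real {z} * (((n : ℝ) / (n + sqExcess K z)) ^ 2 * D z) ≤ ∫ z, ρ n z ∂μ := by
    intro n hn
    have hn' : (0 : ℝ) < n := by exact_mod_cast hn
    have hb1 : ∀ z, |∫ w, T n w ∂(κ z)| ≤ n := fun z => abs_integral_le_of_abs_le _ (hTb n)
    have i1 : Integrable (fun z => ∫ w, T n w ∂(κ z)) μ := integrable_of_abs_le _ hb1
    have i2 : Integrable (T n) μ := integrable_of_abs_le _ (hTb n)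
    have i3 : Integrable (ρ n) μ := integrable_of_abs_le _ (hρb n hn)
    have e : ∫ z, ρ n z ∂μ = ∫ z, (∫ w, T n w ∂(κ z) - T n z + ρ n z) ∂μ := by
      have h12 : Integrable (fun z => ∫ w, T n w ∂(κ z) - T n z) μ := i1.sub i2
      rw [integral_add h12 i3, integral_sub i1 i2, integral_integral_of_invariant hμ (hTb n)]
      simp
    rw [e, ← smul_eq_mul, ← integral_indicator_const _ (measurableSet_singleton z)]
    refine integral_mono ((integrable_const _).indicator (measurableSet_singleton z))
      ((i1.sub i2).add i3) fun v => ?_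
    rw [Set.indicator_apply]
    have h0 := hstep n hn v
    split_ifs with hv
    · rw [Set.mem_singleton_iff.1 hv] at h0 ⊢
      exact h0
    · refine le_trans ?_ h0
      have := hF v
      exact mul_nonneg (by positivity) (hK v)
  have hlim2 : Tendsto (fun n : ℕ => μ.real {z} * (((n : ℝ) / (n + sqExcess K z)) ^ 2 * D z))
      atTop (𝓝 (μ.real {z} * (1 ^ 2 * D z))) := by
    refine (((tendsto_natCast_div_add_atTop (sqExcess K z)).pow 2).mul_const _).const_mul _
  have h0 : μ.real {z} * (1 ^ 2 * D z) ≤ 0 :=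
    le_of_tendsto_of_tendsto hlim2 hlim (by
      filter_upwards [eventually_ge_atTop 1] with n hn using hle n hn)
  have h1 : μ.real {z} = 0 := by
    have h2 : 0 ≤ μ.real {z} := measureReal_nonneg
    change 0 < D z at hz
    nlinarith
  rwa [measureReal_eq_zero_iff] at h1

end

end

section

open ProbabilityTheory

section Occupation

variable {E : Type*} [MeasurableSpace E] [Countable E] [MeasurableSingletonClass E]
  (κ : Kernel E E) [IsMarkovKernel κ]

/-- The average occupation of the state `w` up to time `n`. -/
noncomputable def occup (z : E) (n : ℕ) (w : E) : ℝ :=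
  (n : ℝ)⁻¹ * ∑ j ∈ Finset.range n, ((κ ^ j) z).real {w}

lemma occup_nonneg (z : E) (n : ℕ) (w : E) : 0 ≤ occup κ z n w :=
  mul_nonneg (by positivity) (Finset.sum_nonneg fun _ _ => measureReal_nonneg)

lemma sum_occup_le_one (z : E) (n : ℕ) (s : Finset E) : ∑ w ∈ s, occup κ z n w ≤ 1 := by
  unfold occup
  rw [← Finset.mul_sum, Finset.sum_comm]
  have h1 : ∀ j, ∑ w ∈ s, ((κ ^ j) z).real {w} ≤ 1 := fun j => by
    rw [sum_measureReal_singleton]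
    exact measureReal_le_one
  calc _ ≤ (n : ℝ)⁻¹ * ∑ j ∈ Finset.range n, 1 := by gcongr with j _; exact h1 j
    _ ≤ 1 := by simpa using inv_mul_le_one

lemma sum_pow_mul_le (z v : E) (j : ℕ) (s : Finset E) :
    ∑ w ∈ s, ((κ ^ j) z).real {w} * (κ w).real {v} ≤ ((κ ^ (j + 1)) z).real {v} := by
  have e : κ ^ (j + 1) = κ ∘ₖ (κ ^ j) := pow_succ' κ j
  have h1 : ∑ w ∈ s, ((κ ^ j) z) {w} * (κ w) {v} ≤ ((κ ^ (j + 1)) z) {v} := by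
    rw [e, Kernel.comp_apply' _ _ _ (measurableSet_singleton v), lintegral_countable']
    simp_rw [mul_comm]
    exact ENNReal.sum_le_tsum s
  have h2 := ENNReal.toReal_mono (measure_ne_top _ _) h1
  rw [ENNReal.toReal_sum (fun w _ => ENNReal.mul_ne_top (measure_ne_top _ _)
    (measure_ne_top _ _))] at h2
  simpa [measureReal_def] using h2

lemma sum_occup_mul_le (z v : E) (n : ℕ) (s : Finset E) :
    ∑ w ∈ s, occup κ z n w * (κ w).real {v} ≤ occup κ z n v + (n : ℝ)⁻¹ := by
  unfold occup
  simp_rw [mul_assoc, Finset.sum_mul]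
  rw [← Finset.mul_sum, Finset.sum_comm]
  calc _ ≤ (n : ℝ)⁻¹ * ∑ j ∈ Finset.range n, ((κ ^ (j + 1)) z).real {v} := by
        gcongr with j _
        exact sum_pow_mul_le κ z v j s
    _ ≤ (n : ℝ)⁻¹ * (∑ j ∈ Finset.range n, ((κ ^ j) z).real {v} + 1) := by
        gcongr
        have h1 := Finset.sum_range_succ' (fun j => ((κ ^ j) z).real {v}) n
        have h2 := Finset.sum_range_succ (fun j => ((κ ^ j) z).real {v}) n
        have h3 : ((κ ^ n) z).real {v} ≤ 1 := measureReal_le_one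
        have h4 : 0 ≤ ((κ ^ 0) z).real {v} := measureReal_nonneg
        linarith
    _ = _ := by ring

/-- Any limit of the occupation averages along an ultrafilter is given by an invariant measure. -/
lemma exists_invariant_of_ultrafilter (z : E) (g : Ultrafilter ℕ) (hg : (g : Filter ℕ) ≤ atTop) :
    ∃ μ : Measure E, IsFiniteMeasure μ ∧ Kernel.Invariant κ μ ∧
      ∀ w, Tendsto (fun n => occup κ z n w) g (𝓝 (μ.real {w})) := by
  have h1 : ∀ w, ∃ a, 0 ≤ a ∧ Tendsto (fun n => occup κ z n w) g (𝓝 a) := by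
    intro w
    obtain ⟨a, ha, hle⟩ := (isCompact_Icc (a := (0 : ℝ)) (b := 1)).ultrafilter_le_nhds
      (g.map fun n => occup κ z n w) (by
        rw [le_principal_iff]
        refine Ultrafilter.mem_coe.1 (Ultrafilter.mem_map.2 (Filter.univ_mem' fun n => ?_))
        refine ⟨occup_nonneg κ z n w, ?_⟩
        simpa using sum_occup_le_one κ z n {w})
    exact ⟨a, ha.1, hle⟩
  choose a ha0 ha using h1
  set μ : Measure E := Measure.sum fun w => ENNReal.ofReal (a w) • Measure.dirac w with hμ
  have hμs : ∀ w, μ {w} = ENNReal.ofReal (a w) := fun w => Measure.sum_smul_dirac_singleton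
  have hμr : ∀ w, μ.real {w} = a w := fun w => by
    rw [measureReal_def, hμs, ENNReal.toReal_ofReal (ha0 w)]
  have hsum : ∀ s : Finset E, ∑ w ∈ s, a w ≤ 1 := fun s =>
    le_of_tendsto' (tendsto_finsetSum s fun w _ => ha w) fun n => sum_occup_le_one κ z n s
  have hfin : IsFiniteMeasure μ := by
    refine ⟨lt_of_le_of_lt ?_ ENNReal.one_lt_top⟩
    rw [← Measure.tsum_indicator_apply_singleton μ Set.univ MeasurableSet.univ]
    simp only [Set.indicator_univ, hμs]
    rw [ENNReal.tsum_eq_iSup_sum]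
    refine iSup_le fun s => ?_
    rw [← ENNReal.ofReal_sum_of_nonneg fun w _ => ha0 w, ← ENNReal.ofReal_one]
    exact ENNReal.ofReal_le_ofReal (hsum s)
  have hsub : ∀ v, (μ.bind κ) {v} ≤ μ {v} := by
    intro v
    rw [Measure.bind_apply (measurableSet_singleton v) κ.measurable.aemeasurable,
      lintegral_countable', ENNReal.tsum_eq_iSup_sum]
    refine iSup_le fun s => ?_
    have h2 : ∑ w ∈ s, a w * (κ w).real {v} ≤ a v := by
      have h3 : Tendsto (fun n : ℕ => (n : ℝ)⁻¹) g (𝓝 0) :=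
        (tendsto_inv_atTop_zero.comp tendsto_natCast_atTop_atTop).mono_left hg
      have h4 := (ha v).add h3
      rw [add_zero] at h4
      exact le_of_tendsto_of_tendsto' (tendsto_finsetSum s fun w _ => (ha w).mul_const _) h4
        fun n => sum_occup_mul_le κ z v n s
    rw [hμs v]
    refine le_trans (le_of_eq ?_) (ENNReal.ofReal_le_ofReal h2)
    rw [ENNReal.ofReal_sum_of_nonneg fun w _ => mul_nonneg (ha0 w) measureReal_nonneg]
    refine Finset.sum_congr rfl fun w _ => ?_
    rw [hμs, ENNReal.ofReal_mul (ha0 w), ofReal_measureReal, mul_comm]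
  have hle : μ.bind κ ≤ μ := by
    refine Measure.le_iff.2 fun s hs => ?_
    rw [← Measure.tsum_indicator_apply_singleton μ s hs,
      ← Measure.tsum_indicator_apply_singleton (μ.bind κ) s hs]
    exact ENNReal.tsum_le_tsum fun w => Set.indicator_le_indicator (hsub w)
  have huniv : (μ.bind κ) Set.univ = μ Set.univ := by
    rw [Measure.bind_apply MeasurableSet.univ κ.measurable.aemeasurable]
    simp
  have : IsFiniteMeasure (μ.bind κ) := ⟨by rw [huniv]; exact measure_lt_top _ _⟩
  exact ⟨μ, hfin, Measure.eq_of_le_of_measure_univ_eq hle huniv, fun w => by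
    rw [hμr]; exact ha w⟩

variable {κ}

lemma invariant_pow {μ : Measure E} (h : Kernel.Invariant κ μ) (n : ℕ) :
    Kernel.Invariant (κ ^ n) μ := by
  induction n with
  | zero =>
    have e : κ ^ 0 = Kernel.id := pow_zero κ
    rw [e, Kernel.Invariant]
    exact Measure.id_comp
  | succ n ih =>
    have e : κ ^ (n + 1) = (κ ^ n) ∘ₖ κ := pow_succ κ n
    rw [e]
    exact ih.comp h

end Occupation

section

variable {κ : Kernel (ℕ × S) (ℕ × S)} [IsMarkovKernel κ]

/-- For an irreducible Lamperti kernel with positive averaged parameters, the occupation averages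
of all states vanish in the limit. -/
lemma HasLam.tendsto_occup {Q : S → S → ℝ} {pst : S → ℝ} (hQs : IsStochasticMatrix Q)
    (hQi : IsIrreducibleMatrix Q) (hp : IsStationaryDist Q pst) (hQ : QLim κ Q) {c s : S → ℝ}
    (h : HasLam κ c s) (hs : 0 < ∑ i, s i * pst i) (hcs : 0 < ∑ i, (2 * c i + s i) * pst i)
    (hirr : ∀ z w, ∃ n, (κ ^ n) z {w} ≠ 0) (z w : ℕ × S) :
    Tendsto (fun n => occup κ z n w) atTop (𝓝 0) := by
  have hlin : ∀ (L : ℕ) i, iterSum Q (fun i => 2 * c i + s i) L i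
      = 2 * iterSum Q c L i + iterSum Q s L i := by
    intro L
    induction L with
    | zero => intro i; simp [iterSum]
    | succ L ih =>
      intro i
      simp only [iterSum, ih, mul_add, Finset.sum_add_distrib, Finset.mul_sum]
      have : ∀ j, Q i j * (2 * iterSum Q c L j) = 2 * (Q i j * iterSum Q c L j) :=
        fun j => by ring
      simp_rw [this]
      ring
  obtain ⟨L, hL1, hL2⟩ := ((eventually_iterSum_pos hQs hQi hp hs).and
    (eventually_iterSum_pos hQs hQi hp hcs)).exists
  simp_rw [hlin] at hL2
  have hL := h.pow hQ L
  obtain ⟨K, hK⟩ := hL.exists_lyapunov hL1 hL2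
  obtain ⟨C, hC⟩ := hL.moment
  rw [tendsto_iff_ultrafilter]
  intro g hg
  obtain ⟨μ, hfin, hinv, hlim⟩ := exists_invariant_of_ultrafilter κ z g hg
  have h0 : ∀ v : ℕ × S, K < v.1 → μ {v} = 0 := fun v hv =>
    measure_singleton_eq_zero_of_invariant hC (invariant_pow hinv L) (fun z => (hK z).1)
      ((hK v).2 hv)
  have hw : μ {w} = 0 := by
    obtain ⟨n, hn⟩ := hirr w (K + 1, w.2)
    have h1 := h0 (K + 1, w.2) (Nat.lt_succ_self K)
    have h2 := (invariant_pow hinv n).def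
    rw [← h2, Measure.bind_apply (measurableSet_singleton _) (κ ^ n).measurable.aemeasurable,
      lintegral_countable', ENNReal.tsum_eq_zero] at h1
    exact (mul_eq_zero.1 (h1 w)).resolve_left hn
  have := hlim w
  rwa [measureReal_def, hw, ENNReal.toReal_zero] at this

/-- Time averages of functions vanishing at infinity tend to zero. -/
lemma tendsto_average_of_tendsto_occup {z : ℕ × S}
    (h : ∀ w, Tendsto (fun n => occup κ z n w) atTop (𝓝 0)) {e : ℕ × S → ℝ}
    (he : ∀ i, Tendsto (fun x : ℕ => e (x, i)) atTop (𝓝 0)) :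
    Tendsto (fun n : ℕ => (n : ℝ)⁻¹ * ∑ j ∈ Finset.range n, ∫ w, e w ∂((κ ^ j) z)) atTop (𝓝 0) := by
  obtain ⟨C, hC0, hC⟩ := exists_abs_le_of_tendsto he
  rw [Metric.tendsto_atTop']
  intro ε hε
  have h1 : ∀ᶠ x : ℕ in atTop, ∀ i, |e (x, i)| < ε / 2 := by
    rw [eventually_all]
    intro i
    have := (he i).abs
    rw [abs_zero] at this
    exact this.eventually_lt_const (half_pos hε)
  obtain ⟨N, hN⟩ := eventually_atTop.1 h1
  set A : Finset (ℕ × S) := Finset.range N ×ˢ Finset.univ with hA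
  have hpt : ∀ w, |e w| ≤ ε / 2 + C * ∑ v ∈ A, Set.indicator {v} (fun _ => (1 : ℝ)) w := by
    intro w
    have hnn : 0 ≤ ∑ v ∈ A, Set.indicator {v} (fun _ => (1 : ℝ)) w :=
      Finset.sum_nonneg fun v _ => Set.indicator_nonneg (fun _ _ => zero_le_one) _
    rcases lt_or_ge w.1 N with hw | hw
    · have hwA : w ∈ A := by simp [hA, hw]
      have h2 := Finset.single_le_sum (f := fun v => Set.indicator {v} (fun _ => (1 : ℝ)) w)
        (fun v _ => Set.indicator_nonneg (fun _ _ => zero_le_one) _) hwA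
      simp only [Set.indicator_of_mem (Set.mem_singleton w)] at h2
      have := hC w
      nlinarith
    · have := hN w.1 hw w.2
      have : 0 ≤ C * ∑ v ∈ A, Set.indicator {v} (fun _ => (1 : ℝ)) w := mul_nonneg hC0 hnn
      linarith
  have h_int : ∀ j, |∫ w, e w ∂((κ ^ j) z)| ≤ ε / 2 + C * ∑ v ∈ A, ((κ ^ j) z).real {v} := by
    intro j
    have i1 : ∀ v ∈ A, Integrable (Set.indicator {v} (fun _ => (1 : ℝ))) ((κ ^ j) z) :=
      fun v _ => (integrable_const _).indicator (measurableSet_singleton v)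
    have i2 : Integrable (fun w => ∑ v ∈ A, Set.indicator {v} (fun _ => (1 : ℝ)) w) ((κ ^ j) z) :=
      integrable_finsetSum _ i1
    calc _ ≤ ∫ w, |e w| ∂((κ ^ j) z) := abs_integral_le_integral_abs
      _ ≤ ∫ w, (ε / 2 + C * ∑ v ∈ A, Set.indicator {v} (fun _ => (1 : ℝ)) w) ∂((κ ^ j) z) :=
          integral_mono (integrable_of_abs_le _ hC).abs
            ((integrable_const _).add (i2.const_mul C)) hpt
      _ = _ := by
          rw [integral_add (integrable_const _) (i2.const_mul C), integral_const_mul,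
            integral_finsetSum _ i1]
          simp_rw [integral_indicator_const _ (measurableSet_singleton _)]
          simp
  have hA0 : Tendsto (fun n => C * ∑ v ∈ A, occup κ z n v) atTop (𝓝 0) := by
    have := (tendsto_finsetSum A fun v _ => h v).const_mul C
    simpa using this
  obtain ⟨M, hM⟩ := eventually_atTop.1 (hA0.eventually_lt_const (half_pos hε))
  refine ⟨max M 1, fun n hn => ?_⟩
  have hn1 : (0 : ℝ) < n := by
    have : 0 < n := lt_of_le_of_lt (Nat.zero_le _) hn
    exact_mod_cast this
  rw [Real.dist_eq, sub_zero, abs_mul, abs_of_nonneg (by positivity)]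
  have h3 := hM n ((le_max_left _ _).trans hn.le)
  calc _ ≤ (n : ℝ)⁻¹ * ∑ j ∈ Finset.range n, (ε / 2 + C * ∑ v ∈ A, ((κ ^ j) z).real {v}) := by
        gcongr
        exact (Finset.abs_sum_le_sum_abs _ _).trans (Finset.sum_le_sum fun j _ => h_int j)
    _ = ε / 2 + C * ∑ v ∈ A, occup κ z n v := by
        unfold occup
        rw [Finset.sum_add_distrib, ← Finset.mul_sum (Finset.range n), Finset.sum_comm,
          ← Finset.mul_sum A]
        simp
        field_simp
    _ < ε := by linarith

end

end

section

open ProbabilityTheory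

/-- The functions `t ^ j * q ^ (-a) * exp (-t ^ 2 / q)`, closed under differentiation up to linear
combinations; `gaussFun α 0` solves the backward equation of the limiting squared Bessel process. -/
noncomputable def gaussFun (a : ℝ) (j : ℕ) (q t : ℝ) : ℝ :=
  t ^ j * q ^ (-a) * Real.exp (-(t ^ 2) / q)

lemma exists_abs_gaussFun_le (j : ℕ) (B : ℝ) :
    ∃ C, 0 ≤ C ∧ ∀ a q t, 0 ≤ a → 1 ≤ q → q ≤ B → |gaussFun a j q t| ≤ C := by
  refine ⟨1 + |B| ^ j * j.factorial, by positivity, fun a q t ha hq hqB => ?_⟩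
  have hB : 0 < B := by linarith
  have h1 : q ^ (-a) ≤ 1 := Real.rpow_le_one_of_one_le_of_nonpos hq (by linarith)
  have h1' : 0 ≤ q ^ (-a) := Real.rpow_nonneg (by linarith) _
  have h2 : Real.exp (-(t ^ 2) / q) ≤ Real.exp (-(t ^ 2 / B)) := by
    apply Real.exp_le_exp.2
    rw [neg_div]
    exact neg_le_neg (div_le_div_of_nonneg_left (sq_nonneg t) (by linarith) hqB)
  have h3 : |t| ^ j ≤ 1 + (t ^ 2) ^ j := by
    have : (t ^ 2) ^ j = (|t| ^ j) ^ 2 := by rw [← sq_abs, ← pow_mul, mul_comm, pow_mul]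
    rw [this]
    nlinarith [sq_nonneg (|t| ^ j - 1), sq_nonneg (|t| ^ j)]
  have h4 : (t ^ 2) ^ j ≤ B ^ j * j.factorial * Real.exp (t ^ 2 / B) := by
    have := Real.pow_div_factorial_le_exp (t ^ 2 / B) (by positivity) j
    rw [div_pow, div_div, div_le_iff₀ (by positivity)] at this
    linarith
  have h5 : Real.exp (-(t ^ 2 / B)) ≤ 1 := Real.exp_le_one_iff.2 (by
    have : 0 ≤ t ^ 2 / B := by positivity
    linarith)
  have h6 : Real.exp (t ^ 2 / B) * Real.exp (-(t ^ 2 / B)) = 1 := by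
    rw [← Real.exp_add, add_neg_cancel, Real.exp_zero]
  rw [gaussFun, abs_mul, abs_mul, abs_of_nonneg h1', abs_of_nonneg (Real.exp_nonneg _), abs_pow,
    abs_of_pos hB]
  calc |t| ^ j * q ^ (-a) * Real.exp (-(t ^ 2) / q)
      ≤ |t| ^ j * 1 * Real.exp (-(t ^ 2 / B)) := by gcongr
    _ ≤ (1 + B ^ j * j.factorial * Real.exp (t ^ 2 / B)) * Real.exp (-(t ^ 2 / B)) := by
        rw [mul_one]
        gcongr
        linarith
    _ = Real.exp (-(t ^ 2 / B)) + B ^ j * j.factorial := by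
        rw [add_mul, one_mul, mul_assoc, h6, mul_one]
    _ ≤ _ := by linarith

lemma hasDerivAt_gaussFun_right (a : ℝ) (j : ℕ) (q t : ℝ) (hq : 0 < q) :
    HasDerivAt (gaussFun a j q)
      (j * gaussFun a (j - 1) q t - 2 * gaussFun (a + 1) (j + 1) q t) t := by
  have h1 : HasDerivAt (fun t : ℝ => t ^ j) (j * t ^ (j - 1)) t := hasDerivAt_pow j t
  have h2 : HasDerivAt (fun t : ℝ => Real.exp (-(t ^ 2) / q))
      (Real.exp (-(t ^ 2) / q) * (-(2 * t) / q)) t := by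
    have := ((hasDerivAt_pow 2 t).neg.div_const q).exp
    simpa using this
  refine (show HasDerivAt (gaussFun a j q) _ t from
    (h1.mul_const (q ^ (-a))).mul h2).congr_deriv ?_
  have : q ^ (-(a + 1)) = q ^ (-a) / q := by
    rw [neg_add, ← sub_eq_add_neg, Real.rpow_sub_one hq.ne']
  simp only [gaussFun, this, pow_succ]
  field_simp
  ring

lemma hasDerivAt_gaussFun_left (a : ℝ) (j : ℕ) (q t : ℝ) (hq : 0 < q) :
    HasDerivAt (fun q => gaussFun a j q t)
      (-a * gaussFun (a + 1) j q t + gaussFun (a + 2) (j + 2) q t) q := by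
  have h1 : HasDerivAt (fun q : ℝ => q ^ (-a)) (-a * q ^ (-a - 1)) q :=
    Real.hasDerivAt_rpow_const (Or.inl hq.ne')
  have h2 : HasDerivAt (fun q : ℝ => Real.exp (-(t ^ 2) / q))
      (Real.exp (-(t ^ 2) / q) * (t ^ 2 / q ^ 2)) q := by
    refine (((hasDerivAt_inv hq.ne').const_mul (-(t ^ 2))).exp).congr_deriv ?_
    simp only [div_eq_mul_inv]
    ring
  refine (show HasDerivAt (fun q => gaussFun a j q t) _ q from
    (h1.const_mul (t ^ j)).mul h2).congr_deriv ?_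
  have e1 : q ^ (-(a + 1)) = q ^ (-a) / q := by
    rw [neg_add, ← sub_eq_add_neg, Real.rpow_sub_one hq.ne']
  have e2 : q ^ (-(a + 2)) = q ^ (-a) / q ^ 2 := by
    rw [neg_add, ← sub_eq_add_neg, Real.rpow_sub hq, Real.rpow_two]
  simp only [gaussFun, e1, e2, Real.rpow_sub_one hq.ne']
  field_simp
  ring

lemma abs_sub_le_of_hasDerivAt {f f' : ℝ → ℝ} {K x y : ℝ}
    (hf : ∀ s ∈ Set.uIcc x y, HasDerivAt f (f' s) s) (hK : ∀ s ∈ Set.uIcc x y, |f' s| ≤ K) :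
    |f y - f x| ≤ K * |y - x| :=
  (convex_uIcc x y).norm_image_sub_le_of_norm_hasDerivWithin_le
    (fun s hs => (hf s hs).hasDerivWithinAt) hK Set.left_mem_uIcc Set.right_mem_uIcc

lemma abs_taylor_one_le {f f' f'' : ℝ → ℝ} {K x y : ℝ}
    (hf : ∀ s ∈ Set.uIcc x y, HasDerivAt f (f' s) s)
    (hf' : ∀ s ∈ Set.uIcc x y, HasDerivAt f' (f'' s) s) (hK : ∀ s ∈ Set.uIcc x y, |f'' s| ≤ K) :
    |f y - f x - f' x * (y - x)| ≤ K * |y - x| ^ 2 := by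
  have hK0 : 0 ≤ K := (abs_nonneg _).trans (hK x Set.left_mem_uIcc)
  have := abs_sub_le_of_hasDerivAt (f := fun s => f s - f' x * (s - x)) (f' := fun s => f' s - f' x)
    (K := K * |y - x|) (x := x) (y := y)
    (fun s hs => by
      exact ((hf s hs).sub (((hasDerivAt_id s).sub_const x).const_mul (f' x))).congr_deriv
        (by simp))
    (fun s hs => by
      have hsub := Set.uIcc_subset_uIcc_left hs
      refine (abs_sub_le_of_hasDerivAt (fun r hr => hf' r (hsub hr))
        (fun r hr => hK r (hsub hr))).trans ?_
      exact mul_le_mul_of_nonneg_left (Set.abs_sub_left_of_mem_uIcc hs) hK0)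
  simp only [sub_self, mul_zero, sub_zero] at this
  calc _ = |f y - f' x * (y - x) - f x| := by ring_nf
    _ ≤ _ := this
    _ = _ := by ring

lemma abs_taylor_two_le {f f' f'' f''' : ℝ → ℝ} {K x y : ℝ}
    (hf : ∀ s ∈ Set.uIcc x y, HasDerivAt f (f' s) s)
    (hf' : ∀ s ∈ Set.uIcc x y, HasDerivAt f' (f'' s) s)
    (hf'' : ∀ s ∈ Set.uIcc x y, HasDerivAt f'' (f''' s) s)
    (hK : ∀ s ∈ Set.uIcc x y, |f''' s| ≤ K) :
    |f y - f x - f' x * (y - x) - f'' x / 2 * (y - x) ^ 2| ≤ K * |y - x| ^ 3 := by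
  have hK0 : 0 ≤ K := (abs_nonneg _).trans (hK x Set.left_mem_uIcc)
  have := abs_sub_le_of_hasDerivAt
    (f := fun s => f s - f' x * (s - x) - f'' x / 2 * (s - x) ^ 2)
    (f' := fun s => f' s - f' x - f'' x * (s - x))
    (K := K * |y - x| ^ 2) (x := x) (y := y)
    (fun s hs => by
      have h1 := (hasDerivAt_id s).sub_const x
      refine (((hf s hs).sub (h1.const_mul (f' x))).sub
        ((h1.pow 2).const_mul (f'' x / 2))).congr_deriv ?_
      simp
      ring)
    (fun s hs => by
      have hsub := Set.uIcc_subset_uIcc_left hs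
      refine (abs_taylor_one_le (fun r hr => hf' r (hsub hr)) (fun r hr => hf'' r (hsub hr))
        (fun r hr => hK r (hsub hr))).trans ?_
      exact mul_le_mul_of_nonneg_left
        (pow_le_pow_left₀ (abs_nonneg _) (Set.abs_sub_left_of_mem_uIcc hs) 2) hK0)
  simp only [sub_self, mul_zero, sub_zero, ne_eq, OfNat.ofNat_ne_zero, not_false_eq_true,
    zero_pow] at this
  calc _ = |f y - f' x * (y - x) - f'' x / 2 * (y - x) ^ 2 - f x| := by ring_nf
    _ ≤ _ := this
    _ = _ := by ring

end

section

open ProbabilityTheory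

lemma exists_gaussFun_lipschitz {a : ℝ} (ha : 0 ≤ a) (j : ℕ) (B : ℝ) :
    ∃ C, 0 ≤ C ∧ ∀ q q' t t', 1 ≤ q → q ≤ B → 1 ≤ q' → q' ≤ B →
      |gaussFun a j q' t' - gaussFun a j q t| ≤ C * (|q' - q| + |t' - t|) := by
  obtain ⟨C1, h1, hC1⟩ := exists_abs_gaussFun_le (j - 1) B
  obtain ⟨C2, h2, hC2⟩ := exists_abs_gaussFun_le (j + 1) B
  obtain ⟨C3, h3, hC3⟩ := exists_abs_gaussFun_le j B
  obtain ⟨C4, h4, hC4⟩ := exists_abs_gaussFun_le (j + 2) B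
  refine ⟨j * C1 + 2 * C2 + (a * C3 + C4), by positivity, fun q q' t t' hq hqB hq' hqB' => ?_⟩
  have e1 : |gaussFun a j q' t' - gaussFun a j q' t| ≤ (j * C1 + 2 * C2) * |t' - t| := by
    refine abs_sub_le_of_hasDerivAt
      (fun s _ => hasDerivAt_gaussFun_right a j q' s (by linarith)) fun s _ => ?_
    have b1 := hC1 a q' s ha hq' hqB'
    have b2 := hC2 (a + 1) q' s (by linarith) hq' hqB'
    refine (abs_sub _ _).trans ?_
    rw [abs_mul, abs_mul, Nat.abs_cast, abs_two]
    gcongr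
  have e2 : |gaussFun a j q' t - gaussFun a j q t| ≤ (a * C3 + C4) * |q' - q| := by
    refine abs_sub_le_of_hasDerivAt (f := fun q => gaussFun a j q t)
      (fun s hs => hasDerivAt_gaussFun_left a j s t ?_) fun s hs => ?_
    · linarith [hs.1, le_min hq hq']
    · have b3 := hC3 (a + 1) s t (by linarith) (by linarith [hs.1, le_min hq hq'])
        (hs.2.trans (max_le hqB hqB'))
      have b4 := hC4 (a + 2) s t (by linarith) (by linarith [hs.1, le_min hq hq'])
        (hs.2.trans (max_le hqB hqB'))
      refine (abs_add_le _ _).trans ?_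
      rw [abs_mul, abs_neg, abs_of_nonneg ha]
      gcongr
  have e3 := abs_sub_le (gaussFun a j q' t') (gaussFun a j q' t) (gaussFun a j q t)
  have p1 : 0 ≤ (j * C1 + 2 * C2) * |q' - q| := by positivity
  have p2 : 0 ≤ (a * C3 + C4) * |t' - t| := by positivity
  nlinarith

lemma exists_gaussFun_taylor {a : ℝ} (ha : 0 ≤ a) (B : ℝ) :
    ∃ C, 0 ≤ C ∧ ∀ q q' t t', 1 ≤ q → q ≤ B → 1 ≤ q' → q' ≤ B →
      |gaussFun a 0 q' t' - gaussFun a 0 q t + 2 * t * gaussFun (a + 1) 0 q' t * (t' - t)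
        - (-gaussFun (a + 1) 0 q' t + 2 * gaussFun (a + 2) 2 q' t) * (t' - t) ^ 2
        - (-a * gaussFun (a + 1) 0 q' t + gaussFun (a + 2) 2 q' t) * (q' - q)|
        ≤ C * (|t' - t| ^ 3 + |q' - q| ^ 2) := by
  obtain ⟨C0, h0, hC0⟩ := exists_abs_gaussFun_le 0 B
  obtain ⟨C1, h1, hC1⟩ := exists_abs_gaussFun_le 1 B
  obtain ⟨C2, h2, hC2⟩ := exists_abs_gaussFun_le 2 B
  obtain ⟨C3, h3, hC3⟩ := exists_abs_gaussFun_le 3 B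
  obtain ⟨C4, h4, hC4⟩ := exists_abs_gaussFun_le 4 B
  set K := 12 * C1 + 8 * C3 + a * ((a + 1) * C0 + C2) + ((a + 2) * C2 + C4) with hK
  refine ⟨K, by positivity, fun q q' t t' hq hqB hq' hqB' => ?_⟩
  have hq0 : 0 < q' := by linarith
  have e1 := abs_taylor_two_le (f := gaussFun a 0 q')
    (f' := fun s => -2 * gaussFun (a + 1) 1 q' s)
    (f'' := fun s => -2 * gaussFun (a + 1) 0 q' s + 4 * gaussFun (a + 2) 2 q' s)
    (f''' := fun s => 12 * gaussFun (a + 2) 1 q' s - 8 * gaussFun (a + 3) 3 q' s)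
    (K := 12 * C1 + 8 * C3) (x := t) (y := t')
    (fun s _ => (hasDerivAt_gaussFun_right a 0 q' s hq0).congr_deriv (by simp))
    (fun s _ => ((hasDerivAt_gaussFun_right (a + 1) 1 q' s hq0).const_mul (-2)).congr_deriv (by
      rw [show a + 1 + 1 = a + 2 by ring]
      simp
      ring))
    (fun s _ => (((hasDerivAt_gaussFun_right (a + 1) 0 q' s hq0).const_mul (-2)).add
      ((hasDerivAt_gaussFun_right (a + 2) 2 q' s hq0).const_mul 4)).congr_deriv (by
      rw [show a + 1 + 1 = a + 2 by ring, show a + 2 + 1 = a + 3 by ring]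
      simp
      ring))
    (fun s _ => by
      have b1 := hC1 (a + 2) q' s (by linarith) hq' hqB'
      have b2 := hC3 (a + 3) q' s (by linarith) hq' hqB'
      rw [abs_le] at b1 b2 ⊢
      constructor <;> linarith [b1.1, b1.2, b2.1, b2.2])
  have e2 := abs_taylor_one_le (f := fun q => gaussFun a 0 q t)
    (f' := fun s => -a * gaussFun (a + 1) 0 s t + gaussFun (a + 2) 2 s t)
    (f'' := fun s => -a * (-(a + 1) * gaussFun (a + 2) 0 s t + gaussFun (a + 3) 2 s t)
      + (-(a + 2) * gaussFun (a + 3) 2 s t + gaussFun (a + 4) 4 s t))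
    (K := a * ((a + 1) * C0 + C2) + ((a + 2) * C2 + C4)) (x := q') (y := q)
    (fun s hs => hasDerivAt_gaussFun_left a 0 s t (by linarith [hs.1, le_min hq' hq]))
    (fun s hs => by
      have hs0 : 0 < s := by linarith [hs.1, le_min hq' hq]
      refine (((hasDerivAt_gaussFun_left (a + 1) 0 s t hs0).const_mul (-a)).add
        (hasDerivAt_gaussFun_left (a + 2) 2 s t hs0)).congr_deriv ?_
      rw [show a + 1 + 1 = a + 2 by ring, show a + 2 + 1 = a + 3 by ring,
        show a + 1 + 2 = a + 3 by ring, show a + 2 + 2 = a + 4 by ring])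
    (fun s hs => by
      have hs1 : 1 ≤ s := by linarith [hs.1, le_min hq' hq]
      have hs2 : s ≤ B := hs.2.trans (max_le hqB' hqB)
      have b0 := hC0 (a + 2) s t (by linarith) hs1 hs2
      have b2 := hC2 (a + 3) s t (by linarith) hs1 hs2
      have b4 := hC4 (a + 4) s t (by linarith) hs1 hs2
      refine (abs_add_le _ _).trans (add_le_add ?_ ?_)
      · rw [abs_mul, abs_neg, abs_of_nonneg ha]
        refine mul_le_mul_of_nonneg_left ((abs_add_le _ _).trans (add_le_add ?_ b2)) ha
        rw [abs_mul, abs_neg, abs_of_nonneg (by linarith)]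
        exact mul_le_mul_of_nonneg_left b0 (by linarith)
      · refine (abs_add_le _ _).trans (add_le_add ?_ b4)
        rw [abs_mul, abs_neg, abs_of_nonneg (by linarith)]
        exact mul_le_mul_of_nonneg_left b2 (by linarith))
  have hg : gaussFun (a + 1) 1 q' t = t * gaussFun (a + 1) 0 q' t := by
    simp [gaussFun, mul_assoc]
  have p1 : 0 ≤ (a * ((a + 1) * C0 + C2) + ((a + 2) * C2 + C4)) * |t' - t| ^ 3 := by positivity
  have p2 : 0 ≤ (12 * C1 + 8 * C3) * |q' - q| ^ 2 := by positivity
  rw [abs_sub_comm q q'] at e2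
  rw [hg] at e1
  set D1 := (12 * C1 + 8 * C3)
  set D2 := a * ((a + 1) * C0 + C2) + ((a + 2) * C2 + C4)
  have : K = D1 + D2 := by rw [hK]; ring
  rw [this]
  rw [abs_le] at e1 e2 ⊢
  constructor <;> nlinarith [e1.1, e1.2, e2.1, e2.2]

end

section

open ProbabilityTheory

/-- The scaled time-to-go of the approximating diffusion. -/
def gaussTime (T r : ℝ) (k : ℕ) : ℝ := 1 + T * r ^ 2 * k

/-- The solution of the backward equation at scale `r`, corrected by solutions `h1`, `h2` of
Poisson's equation. -/
noncomputable def gaussCorr (a T : ℝ) (h1 h2 : S → ℝ) (r : ℝ) (k : ℕ) (z : ℕ × S) : ℝ :=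
  gaussFun a 0 (gaussTime T r k) (r * z.1) +
    r ^ 2 * (gaussFun (a + 1) 0 (gaussTime T r k) (r * z.1) * h1 z.2 +
      gaussFun (a + 2) 2 (gaussTime T r k) (r * z.1) * h2 z.2)

lemma gaussTime_nextCount (T r : ℝ) (s0 : S) {k : ℕ} {z : ℕ × S} (h : ¬(k = 0 ∧ z.2 = s0)) :
    gaussTime T r (nextCount s0 k z) - gaussTime T r k =
      -(T * r ^ 2 * if z.2 = s0 then 1 else 0) := by
  unfold gaussTime nextCount
  split_ifs with hz
  · have : 1 ≤ k := by
      rcases Nat.eq_zero_or_pos k with h0 | h0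
      · exact absurd ⟨h0, hz⟩ h
      · exact h0
    rw [Nat.cast_sub this]
    push_cast
    ring
  · ring

lemma one_le_gaussTime {T : ℝ} (hT : 0 ≤ T) (r : ℝ) (k : ℕ) : 1 ≤ gaussTime T r k := by
  unfold gaussTime
  have : 0 ≤ T * r ^ 2 * k := by positivity
  linarith

lemma gaussTime_mono {T : ℝ} (hT : 0 ≤ T) (r : ℝ) {k l : ℕ} (h : k ≤ l) :
    gaussTime T r k ≤ gaussTime T r l := by
  unfold gaussTime
  gcongr

lemma exists_abs_gaussCorr_sub_le {a T : ℝ} (ha : 0 ≤ a) (hT : 0 ≤ T) (h1 h2 : S → ℝ)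
    (R B : ℝ) (s0 : S) :
    ∃ K, 0 ≤ K ∧ ∀ r, 0 ≤ r → r ≤ R → ∀ k z w, gaussTime T r k ≤ B → ¬(k = 0 ∧ z.2 = s0) →
      |gaussCorr a T h1 h2 r (nextCount s0 k z) w - gaussCorr a T h1 h2 r k z
        - r ^ 2 * (gaussFun (a + 1) 0 (gaussTime T r (nextCount s0 k z)) (r * z.1) *
            (-2 * z.1 * jump z w - jump z w ^ 2 + (T * a * if z.2 = s0 then 1 else 0)
              + (h1 w.2 - h1 z.2))
          + gaussFun (a + 2) 2 (gaussTime T r (nextCount s0 k z)) (r * z.1) *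
            (2 * jump z w ^ 2 - (T * if z.2 = s0 then 1 else 0) + (h2 w.2 - h2 z.2)))|
        ≤ r ^ 3 * K * (1 + jump z w ^ 4) := by
  obtain ⟨C, hC, hCt⟩ := exists_gaussFun_taylor ha B
  obtain ⟨C1, hC1, hL1⟩ := exists_gaussFun_lipschitz (show 0 ≤ a + 1 by linarith) 0 B
  obtain ⟨C2, hC2, hL2⟩ := exists_gaussFun_lipschitz (show 0 ≤ a + 2 by linarith) 2 B
  set H1 := ∑ i, |h1 i|
  set H2 := ∑ i, |h2 i|
  have hH1 : ∀ i, |h1 i| ≤ H1 := fun i =>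
    Finset.single_le_sum (f := fun i => |h1 i|) (fun _ _ => abs_nonneg _) (Finset.mem_univ i)
  have hH2 : ∀ i, |h2 i| ≤ H2 := fun i =>
    Finset.single_le_sum (f := fun i => |h2 i|) (fun _ _ => abs_nonneg _) (Finset.mem_univ i)
  have hH1' : 0 ≤ H1 := Finset.sum_nonneg fun _ _ => abs_nonneg _
  have hH2' : 0 ≤ H2 := Finset.sum_nonneg fun _ _ => abs_nonneg _
  refine ⟨C * (1 + T ^ 2 * |R|) + (C1 * H1 + C2 * H2) * (1 + T * |R|), by positivity,
    fun r hr hrR k z w hk hal => ?_⟩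
  have hR : r ≤ |R| := hrR.trans (le_abs_self R)
  set δ : ℝ := if z.2 = s0 then 1 else 0 with hδ
  have hδ0 : 0 ≤ δ := by rw [hδ]; split_ifs <;> norm_num
  have hδ1 : δ ≤ 1 := by rw [hδ]; split_ifs <;> norm_num
  have hq := gaussTime_nextCount T r s0 hal
  rw [← hδ] at hq
  have hq1 := one_le_gaussTime hT r k
  have hq1' := one_le_gaussTime hT r (nextCount s0 k z)
  have hqB' := (gaussTime_mono hT r (nextCount_le s0 k z)).trans hk
  unfold gaussCorr
  set q := gaussTime T r k
  set q' := gaussTime T r (nextCount s0 k z)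
  set d := jump z w with hd
  have ht : r * (w.1 : ℝ) - r * z.1 = r * d := by rw [hd]; unfold jump; ring
  set t := r * (z.1 : ℝ) with htdef
  set t' := r * (w.1 : ℝ)
  have E := hCt q q' t t' hq1 hk hq1' hqB'
  have L1 := hL1 q' q' t t' hq1' hqB' hq1' hqB'
  have L1' := hL1 q q' t t hq1 hk hq1' hqB'
  have L2 := hL2 q' q' t t' hq1' hqB' hq1' hqB'
  have L2' := hL2 q q' t t hq1 hk hq1' hqB'
  have hqa : |q' - q| ≤ T * r ^ 2 := by
    rw [hq, abs_neg, abs_of_nonneg (by positivity)]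
    exact mul_le_of_le_one_right (by positivity) hδ1
  have hta : |t' - t| = r * |d| := by rw [ht, abs_mul, abs_of_nonneg hr]
  have hr3 : r ^ 4 ≤ r ^ 3 * |R| := by rw [pow_succ]; gcongr
  have hrT : T * r ^ 2 ≤ r * (T * |R|) := by
    calc T * r ^ 2 = r * (T * r) := by ring
      _ ≤ _ := by gcongr
  rw [sub_self, abs_zero, zero_add, hta] at L1 L2
  rw [sub_self, abs_zero, add_zero] at L1' L2'
  have X1 : |(gaussFun (a + 1) 0 q' t' - gaussFun (a + 1) 0 q' t) * h1 w.2| ≤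
      C1 * (r * |d|) * H1 := by
    rw [abs_mul]
    exact mul_le_mul L1 (hH1 _) (abs_nonneg _) (by positivity)
  have X2 : |(gaussFun (a + 2) 2 q' t' - gaussFun (a + 2) 2 q' t) * h2 w.2| ≤
      C2 * (r * |d|) * H2 := by
    rw [abs_mul]
    exact mul_le_mul L2 (hH2 _) (abs_nonneg _) (by positivity)
  have X3 : |(gaussFun (a + 1) 0 q' t - gaussFun (a + 1) 0 q t) * h1 z.2|
      ≤ C1 * (r * (T * |R|)) * H1 := by
    rw [abs_mul]
    refine mul_le_mul (L1'.trans ?_) (hH1 _) (abs_nonneg _) (by positivity)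
    exact mul_le_mul_of_nonneg_left (hqa.trans hrT) hC1
  have X4 : |(gaussFun (a + 2) 2 q' t - gaussFun (a + 2) 2 q t) * h2 z.2|
      ≤ C2 * (r * (T * |R|)) * H2 := by
    rw [abs_mul]
    refine mul_le_mul (L2'.trans ?_) (hH2 _) (abs_nonneg _) (by positivity)
    exact mul_le_mul_of_nonneg_left (hqa.trans hrT) hC2
  rw [ht, hq] at E
  have E' : C * (|r * d| ^ 3 + |-(T * r ^ 2 * δ)| ^ 2) ≤
      C * (r ^ 3 * |d| ^ 3 + r ^ 3 * (T ^ 2 * |R|)) := by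
    refine mul_le_mul_of_nonneg_left (add_le_add ?_ ?_) hC
    · rw [abs_mul, abs_of_nonneg hr, mul_pow]
    · rw [← hq]
      calc |q' - q| ^ 2 ≤ (T * r ^ 2) ^ 2 := pow_le_pow_left₀ (abs_nonneg _) hqa 2
        _ = T ^ 2 * r ^ 4 := by ring
        _ ≤ T ^ 2 * (r ^ 3 * |R|) := by gcongr
        _ = _ := by ring
  have E2 := E.trans E'
  have Y := (abs_add_le _ _).trans (add_le_add X1 X2)
  have Y' := (abs_add_le _ _).trans (add_le_add X3 X4)
  have Z := (abs_add_le _ _).trans (add_le_add Y Y')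
  have hr2 : 0 ≤ r ^ 2 := sq_nonneg r
  have Z' := mul_le_mul_of_nonneg_left Z hr2
  rw [← abs_of_nonneg hr2, ← abs_mul, abs_of_nonneg hr2] at Z'
  have W := (abs_add_le _ _).trans (add_le_add E2 Z')
  have d3 := abs_pow_three_le d
  have d1 := abs_le_one_add_pow_four d
  have d4 : 0 ≤ d ^ 4 := by positivity
  calc _ = _ := by
        congr 1
        rw [htdef]
        ring
    _ ≤ _ := W
    _ = r ^ 3 * (C * (|d| ^ 3 + 1 * (T ^ 2 * |R|))
        + (C1 * H1 + C2 * H2) * (|d| + 1 * (T * |R|))) := by ring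
    _ ≤ r ^ 3 * (C * ((1 + d ^ 4) + (1 + d ^ 4) * (T ^ 2 * |R|))
        + (C1 * H1 + C2 * H2) * ((1 + d ^ 4) + (1 + d ^ 4) * (T * |R|))) := by
        gcongr <;> linarith
    _ = _ := by ring

end

section

open ProbabilityTheory

section

variable {κ : Kernel (ℕ × S) (ℕ × S)} [IsMarkovKernel κ] {c s : S → ℝ} {Q : S → S → ℝ}

lemma HasLam.tendsto_drift (h : HasLam κ c s) (i : S) :
    Tendsto (fun x : ℕ => (x : ℝ) * ∫ w, jump (x, i) w ∂(κ (x, i))) atTop (𝓝 (c i)) := by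
  have h1 : Tendsto (fun x : ℕ => (1 : ℝ) / (1 + (x : ℝ))) atTop (𝓝 0) :=
    tendsto_const_div_one_add 1
  have h2 := (h.drift i).sub ((h.drift i).mul h1)
  rw [mul_zero, sub_zero] at h2
  refine h2.congr fun x => ?_
  have : (1 + (x : ℝ)) ≠ 0 := by positivity
  field_simp
  ring

lemma HasLam.exists_gaussCorr_step (h : HasLam κ c s) (hQ : QLim κ Q) {a T : ℝ} (ha : 0 ≤ a)
    (hT : 0 ≤ T) (s0 : S) {h1 h2 : S → ℝ}
    (hh1 : ∀ i, h1 i - ∑ j, Q i j * h1 j = -2 * c i - s i + T * a * if i = s0 then 1 else 0)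
    (hh2 : ∀ i, h2 i - ∑ j, Q i j * h2 j = 2 * s i - T * if i = s0 then 1 else 0)
    (R B : ℝ) :
    ∃ e : ℕ × S → ℝ, (∀ z, 0 ≤ e z) ∧ (∀ i, Tendsto (fun x : ℕ => e (x, i)) atTop (𝓝 0)) ∧
      ∃ K, 0 ≤ K ∧ ∀ r, 0 ≤ r → r ≤ R → ∀ k z, gaussTime T r k ≤ B → ¬(k = 0 ∧ z.2 = s0) →
        |∫ w, gaussCorr a T h1 h2 r (nextCount s0 k z) w ∂(κ z) - gaussCorr a T h1 h2 r k z|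
          ≤ r ^ 2 * (e z + K * r) := by
  obtain ⟨C, hC⟩ := h.moment
  obtain ⟨K, hK, hKb⟩ := exists_abs_gaussCorr_sub_le ha hT h1 h2 R B s0
  obtain ⟨C1, hC1, hb1⟩ := exists_abs_gaussFun_le 0 B
  obtain ⟨C2, hC2, hb2⟩ := exists_abs_gaussFun_le 2 B
  set A1 : ℕ × S → ℝ := fun z => -2 * (z.1 * ∫ w, jump z w ∂(κ z)) - ∫ w, jump z w ^ 2 ∂(κ z)
    + (T * a * if z.2 = s0 then 1 else 0) + (∫ w, h1 w.2 ∂(κ z) - h1 z.2) with hA1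
  set A2 : ℕ × S → ℝ := fun z => 2 * ∫ w, jump z w ^ 2 ∂(κ z)
    - (T * if z.2 = s0 then 1 else 0) + (∫ w, h2 w.2 ∂(κ z) - h2 z.2) with hA2
  have t1 : ∀ i, Tendsto (fun x : ℕ => A1 (x, i)) atTop (𝓝 0) := fun i => by
    have := ((((h.tendsto_drift i).const_mul (-2)).sub (h.second i)).add_const
      (T * a * if i = s0 then 1 else 0)).add ((hQ.tendsto_integral_snd h1 i).sub_const (h1 i))
    convert this using 2
    linarith [hh1 i]
  have t2 : ∀ i, Tendsto (fun x : ℕ => A2 (x, i)) atTop (𝓝 0) := fun i => by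
    have := (((h.second i).const_mul 2).sub_const
      (T * if i = s0 then 1 else 0)).add ((hQ.tendsto_integral_snd h2 i).sub_const (h2 i))
    convert this using 2
    linarith [hh2 i]
  refine ⟨fun z => C1 * |A1 z| + C2 * |A2 z|, fun z => by positivity, fun i => ?_,
    K * (1 + C), by positivity, fun r hr hrR k z hk hal => ?_⟩
  · have := ((t1 i).abs.const_mul C1).add ((t2 i).abs.const_mul C2)
    simpa using this
  have hb := hKb r hr hrR k z
  have hq1 := one_le_gaussTime hT r k
  have hq1' := one_le_gaussTime hT r (nextCount s0 k z)
  have hqB' := (gaussTime_mono hT r (nextCount_le s0 k z)).trans hk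
  set F1 := gaussFun (a + 1) 0 (gaussTime T r (nextCount s0 k z)) (r * z.1)
  set F2 := gaussFun (a + 2) 2 (gaussTime T r (nextCount s0 k z)) (r * z.1)
  have f1 : |F1| ≤ C1 := hb1 _ _ _ (by linarith) hq1' hqB'
  have f2 : |F2| ≤ C2 := hb2 _ _ _ (by linarith) hq1' hqB'
  set M : ℕ × S → ℝ := fun w => r ^ 2 * (F1 *
            (-2 * z.1 * jump z w - jump z w ^ 2 + (T * a * if z.2 = s0 then 1 else 0)
              + (h1 w.2 - h1 z.2))
          + F2 * (2 * jump z w ^ 2 - (T * if z.2 = s0 then 1 else 0) + (h2 w.2 - h2 z.2))) with hM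
  have ij := hC.integrable_jump z
  have ij2 := hC.integrable_sq z
  have ih : ∀ f : S → ℝ, Integrable (fun w : ℕ × S => f w.2) (κ z) := fun f =>
    integrable_of_abs_le (κ z) (C := ∑ i, |f i|) fun w =>
      Finset.single_le_sum (f := fun i => |f i|) (fun _ _ => abs_nonneg _) (Finset.mem_univ w.2)
  have i1 : Integrable (fun w => -2 * z.1 * jump z w - jump z w ^ 2) (κ z) :=
    (ij.const_mul _).sub ij2
  have i2 : Integrable (fun w => -2 * z.1 * jump z w - jump z w ^ 2
      + (T * a * if z.2 = s0 then 1 else 0)) (κ z) := i1.add (integrable_const _)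
  have i3 : Integrable (fun w => 2 * jump z w ^ 2 - (T * if z.2 = s0 then 1 else 0)) (κ z) :=
    (ij2.const_mul _).sub (integrable_const _)
  have ih' : ∀ f : S → ℝ, Integrable (fun w : ℕ × S => f w.2 - f z.2) (κ z) := fun f =>
    (ih f).sub (integrable_const _)
  have iF1 : Integrable (fun w => -2 * z.1 * jump z w - jump z w ^ 2
      + (T * a * if z.2 = s0 then 1 else 0) + (h1 w.2 - h1 z.2)) (κ z) :=
    i2.add (ih' h1)
  have iF2 : Integrable (fun w => 2 * jump z w ^ 2 - (T * if z.2 = s0 then 1 else 0)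
      + (h2 w.2 - h2 z.2)) (κ z) :=
    i3.add (ih' h2)
  have iM : Integrable M (κ z) := ((iF1.const_mul _).add (iF2.const_mul _)).const_mul _
  have eF1 : ∫ w, (-2 * z.1 * jump z w - jump z w ^ 2
      + (T * a * if z.2 = s0 then 1 else 0) + (h1 w.2 - h1 z.2)) ∂(κ z) = A1 z := by
    rw [integral_add i2 (ih' h1), integral_add i1 (integrable_const _),
      integral_sub (ij.const_mul _) ij2,
      integral_sub (ih h1) (integrable_const _), integral_const_mul]
    simp [hA1, mul_assoc]
  have eF2 : ∫ w, (2 * jump z w ^ 2 - (T * if z.2 = s0 then 1 else 0)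
      + (h2 w.2 - h2 z.2)) ∂(κ z) = A2 z := by
    rw [integral_add i3 (ih' h2), integral_sub (ij2.const_mul _) (integrable_const _),
      integral_sub (ih h2) (integrable_const _), integral_const_mul]
    simp [hA2]
  have eM : ∫ w, M w ∂(κ z) = r ^ 2 * (F1 * A1 z + F2 * A2 z) := by
    rw [hM, integral_const_mul, integral_add (iF1.const_mul _) (iF2.const_mul _),
      integral_const_mul, integral_const_mul, eF1, eF2]
  have iD : Integrable (fun w => gaussCorr a T h1 h2 r (nextCount s0 k z) w
      - gaussCorr a T h1 h2 r k z - M w) (κ z) :=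
    hC.integrable z (A := r ^ 3 * K) fun w => hb w hk hal
  have iG : Integrable (fun w => gaussCorr a T h1 h2 r (nextCount s0 k z) w) (κ z) := by
    refine ((iD.add iM).add (integrable_const (gaussCorr a T h1 h2 r k z))).congr
      (ae_of_all _ fun w => ?_)
    simp
  have eD := hC.abs_integral_le z (f := fun w => gaussCorr a T h1 h2 r (nextCount s0 k z) w
      - gaussCorr a T h1 h2 r k z - M w) (A := r ^ 3 * K) (by positivity) fun w => hb w hk hal
  have iG' : Integrable (fun w => gaussCorr a T h1 h2 r (nextCount s0 k z) w
      - gaussCorr a T h1 h2 r k z) (κ z) := iG.sub (integrable_const _)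
  rw [integral_sub iG' iM, integral_sub iG (integrable_const _), integral_const, eM] at eD
  simp only [probReal_univ, one_smul] at eD
  have hFA : |r ^ 2 * (F1 * A1 z + F2 * A2 z)| ≤ r ^ 2 * (C1 * |A1 z| + C2 * |A2 z|) := by
    rw [abs_mul, abs_of_nonneg (sq_nonneg r)]
    refine mul_le_mul_of_nonneg_left ((abs_add_le _ _).trans ?_) (sq_nonneg r)
    rw [abs_mul, abs_mul]
    gcongr
  have := (abs_add_le _ _).trans (add_le_add eD hFA)
  rw [sub_add_cancel] at this
  refine this.trans_eq ?_
  ring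

end

end

section

open ProbabilityTheory

section

variable {κ : Kernel (ℕ × S) (ℕ × S)} [IsMarkovKernel κ] {c s : S → ℝ} {Q : S → S → ℝ}
  {pst : S → ℝ} {z : ℕ × S}

lemma eventually_stopVal_aliveInd_le (hQs : IsStochasticMatrix Q)
    (hQi : IsIrreducibleMatrix Q) (hp : IsStationaryDist Q pst) (hQ : QLim κ Q)
    (hocc : ∀ w, Tendsto (fun n => occup κ z n w) atTop (𝓝 0)) (s0 : S) {M : ℕ} (hM : 0 < M) :
    ∀ᶠ n : ℕ in atTop, stopVal κ s0 (aliveInd s0) (M * n) n z ≤ 2 / (pst s0 * M) := by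
  obtain ⟨h, hh⟩ := exists_poisson_center hQs hQi hp (fun i => if i = s0 then (-1 : ℝ) else 0)
  have hsum : ∑ i, (if i = s0 then (-1 : ℝ) else 0) * pst i = -pst s0 := by
    simp [ite_mul]
  rw [hsum] at hh
  set H := ∑ i, |h i|
  have hH : ∀ i, |h i| ≤ H := fun i =>
    Finset.single_le_sum (f := fun i => |h i|) (fun _ _ => abs_nonneg _) (Finset.mem_univ i)
  set e : ℕ × S → ℝ := fun v => |∫ w, h w.2 ∂(κ v) - ∑ j, Q v.2 j * h j| with he
  have het : ∀ i, Tendsto (fun x : ℕ => e (x, i)) atTop (𝓝 0) := fun i => by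
    have := ((hQ.tendsto_integral_snd h i).sub_const (∑ j, Q i j * h j)).abs
    rwa [sub_self, abs_zero] at this
  obtain ⟨Ce, -, hCe⟩ := exists_abs_le_of_tendsto het
  have hπ := hp.1 s0
  have key := fun n : ℕ => mul_stopVal_aliveInd_le κ s0
    (g := fun k z => (k : ℝ) + (h z.2 + H))
    (fun k => ⟨k + (H + H), fun z => by
      rw [abs_le]
      have := abs_le.1 (hH z.2)
      have hk : (0 : ℝ) ≤ k := by positivity
      constructor <;> linarith [this.1, this.2]⟩)
    (fun k z => by
      have := abs_le.1 (hH z.2)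
      have hk : (0 : ℝ) ≤ k := by positivity
      linarith [this.1]) hπ.le
    (e := e) (fun _ => abs_nonneg _) hCe n (fun k _ v hal => by
      have ih : Integrable (fun w : ℕ × S => h w.2) (κ v) :=
        integrable_of_abs_le (κ v) (C := H) fun w => hH w.2
      have ih' : Integrable (fun w : ℕ × S => h w.2 + H) (κ v) := ih.add (integrable_const _)
      rw [integral_add (integrable_const _) ih', integral_add ih (integrable_const _)]
      simp only [integral_const, probReal_univ, one_smul]
      have h1 := le_abs_self (∫ w, h w.2 ∂(κ v) - ∑ j, Q v.2 j * h j)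
      have h2 := hh v.2
      have h3 := gaussTime_nextCount 1 1 s0 hal
      unfold gaussTime at h3
      simp only [he]
      split_ifs at h2 h3 <;> linarith) (M * n) n le_rfl z
  have havg := (tendsto_average_of_tendsto_occup hocc het).comp
    (tendsto_id.const_mul_atTop' hM : Tendsto (fun n : ℕ => M * n) atTop atTop)
  have havg2 : Tendsto (fun n : ℕ => (M : ℝ) * ((((M * n : ℕ) : ℝ)⁻¹ *
      ∑ j ∈ Finset.range (M * n), ∫ w, e w ∂((κ ^ j) z))) + 2 * H * (n : ℝ)⁻¹) atTop (𝓝 0) := by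
    have := (havg.const_mul (M : ℝ)).add
      ((tendsto_inv_atTop_nhds_zero_nat (𝕜 := ℝ)).const_mul (2 * H))
    simpa using this
  filter_upwards [havg2.eventually_le_const zero_lt_one, eventually_gt_atTop 0] with n hn hn0
  have hn0' : (0 : ℝ) < n := by exact_mod_cast hn0
  have hM' : (0 : ℝ) < M := by exact_mod_cast hM
  have k1 := key n
  have hb := (abs_le.1 (hH z.2)).2
  rw [le_div_iff₀ (by positivity)]
  push_cast at k1 hn
  set Sm := ∑ j ∈ Finset.range (M * n), ∫ w, e w ∂((κ ^ j) z)
  set A := stopVal κ s0 (aliveInd s0) (M * n) n z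
  have e1 : (M : ℝ) * ((M * n : ℝ)⁻¹ * Sm) + 2 * H * (n : ℝ)⁻¹ = (Sm + 2 * H) / n := by
    field_simp
  rw [e1, div_le_one hn0'] at hn
  have : A * (pst s0 * M) * n ≤ 2 * n := by linarith
  exact le_of_mul_le_mul_right this hn0'

end

end

section

open ProbabilityTheory

lemma exists_abs_gaussCorr_le {a T : ℝ} (ha : 0 ≤ a) (hT : 0 ≤ T) (h1 h2 : S → ℝ) (B : ℝ) :
    ∃ K, 0 ≤ K ∧ ∀ r k (z : ℕ × S), gaussTime T r k ≤ B →
      |gaussFun (a + 1) 0 (gaussTime T r k) (r * z.1) * h1 z.2 +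
        gaussFun (a + 2) 2 (gaussTime T r k) (r * z.1) * h2 z.2| ≤ K := by
  obtain ⟨C1, hC1, hb1⟩ := exists_abs_gaussFun_le 0 B
  obtain ⟨C2, hC2, hb2⟩ := exists_abs_gaussFun_le 2 B
  set H1 := ∑ i, |h1 i|
  set H2 := ∑ i, |h2 i|
  have hH1 : ∀ i, |h1 i| ≤ H1 := fun i =>
    Finset.single_le_sum (f := fun i => |h1 i|) (fun _ _ => abs_nonneg _) (Finset.mem_univ i)
  have hH2 : ∀ i, |h2 i| ≤ H2 := fun i =>
    Finset.single_le_sum (f := fun i => |h2 i|) (fun _ _ => abs_nonneg _) (Finset.mem_univ i)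
  have hH1' : 0 ≤ H1 := Finset.sum_nonneg fun _ _ => abs_nonneg _
  have hH2' : 0 ≤ H2 := Finset.sum_nonneg fun _ _ => abs_nonneg _
  refine ⟨C1 * H1 + C2 * H2, by positivity, fun r k z hk => ?_⟩
  have hq := one_le_gaussTime hT r k
  refine (abs_add_le _ _).trans (add_le_add ?_ ?_) <;> rw [abs_mul]
  · exact mul_le_mul (hb1 _ _ _ (by linarith) hq hk) (hH1 _) (abs_nonneg _) hC1
  · exact mul_le_mul (hb2 _ _ _ (by linarith) hq hk) (hH2 _) (abs_nonneg _) hC2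

section

variable {κ : Kernel (ℕ × S) (ℕ × S)} [IsMarkovKernel κ] {c s : S → ℝ} {Q : S → S → ℝ}
  {pst : S → ℝ} {z : ℕ × S}

lemma exists_gaussCorr_bdd {a T : ℝ} (ha : 0 ≤ a) (hT : 0 ≤ T) (h1 h2 : S → ℝ) (r : ℝ) (k : ℕ) :
    ∃ C, ∀ z, |gaussCorr a T h1 h2 r k z| ≤ C := by
  obtain ⟨K, -, hK⟩ := exists_abs_gaussCorr_le ha hT h1 h2 (gaussTime T r k)
  obtain ⟨C, -, hC⟩ := exists_abs_gaussFun_le 0 (gaussTime T r k)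
  refine ⟨C + r ^ 2 * K, fun z => (abs_add_le _ _).trans (add_le_add
    (hC _ _ _ ha (one_le_gaussTime hT r k) le_rfl) ?_)⟩
  rw [abs_mul, abs_of_nonneg (sq_nonneg r)]
  exact mul_le_mul_of_nonneg_left (hK r k z le_rfl) (sq_nonneg r)

lemma HasLam.tendsto_stopVal_gaussCorr (h : HasLam κ c s) (hQ : QLim κ Q)
    (hocc : ∀ w, Tendsto (fun n => occup κ z n w) atTop (𝓝 0)) (s0 : S) {a T : ℝ} (ha : 0 ≤ a)
    (hT : 0 ≤ T) {h1 h2 : S → ℝ}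
    (hh1 : ∀ i, h1 i - ∑ j, Q i j * h1 j = -2 * c i - s i + T * a * if i = s0 then 1 else 0)
    (hh2 : ∀ i, h2 i - ∑ j, Q i j * h2 j = 2 * s i - T * if i = s0 then 1 else 0)
    {l : ℝ} (hl : 0 ≤ l) {M : ℕ} (hM : 0 < M) :
    Tendsto (fun n : ℕ => stopVal κ s0 (gaussCorr a T h1 h2 (Real.sqrt (l / n))) (M * n) n z)
      atTop (𝓝 ((1 + T * l) ^ (-a))) := by
  obtain ⟨e, he0, het, K, hK, hstep⟩ :=
    h.exists_gaussCorr_step hQ ha hT s0 hh1 hh2 (Real.sqrt l) (1 + T * l)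
  obtain ⟨K', hK', hbK⟩ := exists_abs_gaussCorr_le ha hT h1 h2 (1 + T * l)
  obtain ⟨Ce, hCe0, hCe⟩ := exists_abs_le_of_tendsto het
  have hr2 : ∀ n : ℕ, Real.sqrt (l / n) ^ 2 = l / n := fun n => Real.sq_sqrt (by positivity)
  have htime : ∀ n : ℕ, 0 < n → gaussTime T (Real.sqrt (l / n)) n = 1 + T * l := fun n hn => by
    have : (n : ℝ) ≠ 0 := by positivity
    rw [gaussTime, hr2, mul_assoc, div_mul_cancel₀ _ this]
  have hln : Tendsto (fun n : ℕ => l / (n : ℝ)) atTop (𝓝 0) :=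
    tendsto_const_div_atTop_nhds_zero_nat l
  have hr0 : Tendsto (fun n : ℕ => Real.sqrt (l / n)) atTop (𝓝 0) := by
    have := (Real.continuous_sqrt.tendsto 0).comp hln
    rwa [Real.sqrt_zero] at this
  have hq0 : (0 : ℝ) < 1 + T * l := by positivity
  have lim1 : Tendsto (fun n : ℕ => gaussFun a 0 (1 + T * l) (Real.sqrt (l / n) * z.1)) atTop
      (𝓝 ((1 + T * l) ^ (-a))) := by
    have h0 : gaussFun a 0 (1 + T * l) (0 * z.1) = (1 + T * l) ^ (-a) := by simp [gaussFun]
    rw [← h0]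
    exact (hasDerivAt_gaussFun_right a 0 _ _ hq0).continuousAt.tendsto.comp
      (hr0.mul_const (z.1 : ℝ))
  have havg := (tendsto_average_of_tendsto_occup hocc het).comp
    (tendsto_id.const_mul_atTop' hM : Tendsto (fun n : ℕ => M * n) atTop atTop)
  have lim2 : Tendsto (fun n : ℕ => l / (n : ℝ) * K' + (l * M * ((((M * n : ℕ) : ℝ)⁻¹ *
      ∑ j ∈ Finset.range (M * n), ∫ w, e w ∂((κ ^ j) z))) + l * M * K * Real.sqrt (l / n)))
      atTop (𝓝 0) := by
    have := (hln.mul_const K').add ((havg.const_mul (l * M)).add (hr0.const_mul (l * M * K)))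
    simpa using this
  have lim3 : Tendsto (fun n : ℕ => stopVal κ s0 (gaussCorr a T h1 h2 (Real.sqrt (l / n)))
      (M * n) n z - gaussFun a 0 (1 + T * l) (Real.sqrt (l / n) * z.1)) atTop (𝓝 0) := by
    refine squeeze_zero_norm' ?_ lim2
    filter_upwards [eventually_gt_atTop 0] with n hn
    have hn0 : (0 : ℝ) < n := by exact_mod_cast hn
    have hn1 : (1 : ℝ) ≤ n := by exact_mod_cast hn
    have hM' : (0 : ℝ) < M := by exact_mod_cast hM
    set r := Real.sqrt (l / n) with hr
    have hrl : r ≤ Real.sqrt l := Real.sqrt_le_sqrt (div_le_self hl hn1)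
    have hr' : 0 ≤ r := Real.sqrt_nonneg _
    have A := abs_stopVal_sub_le κ s0 (g := gaussCorr a T h1 h2 r)
      (fun k => exists_gaussCorr_bdd ha hT h1 h2 r k)
      (e := fun z => r ^ 2 * (e z + K * r))
      (fun z => mul_nonneg (sq_nonneg r) (add_nonneg (he0 z) (by positivity)))
      (Ce := r ^ 2 * (Ce + K * r)) (fun z => by
        rw [abs_of_nonneg (mul_nonneg (sq_nonneg r) (add_nonneg (he0 z) (by positivity)))]
        refine mul_le_mul_of_nonneg_left ?_ (sq_nonneg r)
        linarith [(abs_le.1 (hCe z)).2]) n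
      (fun k hk v hal => hstep r hr' hrl k v
        ((gaussTime_mono hT r hk).trans_eq (htime n hn)) hal) (M * n) n le_rfl z
    have h_int : ∀ j, ∫ w, r ^ 2 * (e w + K * r) ∂((κ ^ j) z)
        = r ^ 2 * (∫ w, e w ∂((κ ^ j) z)) + r ^ 2 * (K * r) := fun j => by
      rw [integral_const_mul, integral_add (integrable_of_abs_le _ hCe) (integrable_const _)]
      simp [mul_add]
    simp_rw [h_int] at A
    rw [Finset.sum_add_distrib, ← Finset.mul_sum, Finset.sum_const, Finset.card_range,
      nsmul_eq_mul, hr2] at A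
    have B := hbK r n z (htime n hn).le
    have D : |gaussCorr a T h1 h2 r n z - gaussFun a 0 (1 + T * l) (r * z.1)| ≤ l / n * K' := by
      rw [gaussCorr, htime n hn, add_sub_cancel_left, abs_mul, hr2, abs_of_nonneg (by positivity)]
      rw [htime n hn] at B
      exact mul_le_mul_of_nonneg_left B (by positivity)
    rw [Real.norm_eq_abs]
    refine (abs_sub_le _ (gaussCorr a T h1 h2 r n z) _).trans ((add_le_add A D).trans_eq ?_)
    push_cast
    field_simp
    ring
  have := lim3.add lim1
  rw [zero_add] at this
  exact this.congr fun n => sub_add_cancel _ _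

end

/-- Convergence of the Laplace transform of the rescaled square of the embedded chain. -/
lemma tendsto_integral_exp (X : MChain (ℕ × S)) {c s : S → ℝ} {Q : S → S → ℝ} {pst : S → ℝ}
    {z : ℕ × S} (hQs : IsStochasticMatrix Q) (hQi : IsIrreducibleMatrix Q)
    (hp : IsStationaryDist Q pst) (hQ : QLim X.stepKernel Q) (h : HasLam X.stepKernel c s)
    (hocc : ∀ w, Tendsto (fun n => occup X.stepKernel z n w) atTop (𝓝 0)) (s0 : S) {a T : ℝ}
    (ha : 0 ≤ a) (hT : 0 ≤ T) (hTa : T * a * pst s0 = ∑ i, (2 * c i + s i) * pst i)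
    (hTs : T * pst s0 = 2 * ∑ i, s i * pst i) {l : ℝ} (hl : 0 ≤ l) :
    Tendsto (fun n : ℕ => ∫ ω, Real.exp (-(l / n * ((ω (tauSeq s0 ω n)).1 : ℝ) ^ 2)) ∂(X.P z))
      atTop (𝓝 ((1 + T * l) ^ (-a))) := by
  obtain ⟨h1, hh1⟩ := exists_poisson hQs hQi hp
    (f := fun i => -2 * c i - s i + T * a * if i = s0 then 1 else 0) (by
      have : ∑ i, pst i * (T * a * if i = s0 then 1 else 0) = T * a * pst s0 := by
        simp [mul_ite, mul_comm]
      simp_rw [mul_add, Finset.sum_add_distrib, this, hTa, ← Finset.sum_add_distrib]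
      exact Finset.sum_eq_zero fun i _ => by ring)
  obtain ⟨h2, hh2⟩ := exists_poisson hQs hQi hp
    (f := fun i => 2 * s i - T * if i = s0 then 1 else 0) (by
      have : ∑ i, pst i * (T * if i = s0 then 1 else 0) = T * pst s0 := by
        simp [mul_ite, mul_comm]
      simp_rw [mul_sub, Finset.sum_sub_distrib, this, hTs, Finset.mul_sum,
        ← Finset.sum_sub_distrib]
      exact Finset.sum_eq_zero fun i _ => by ring)
  obtain ⟨K', hK', hbK⟩ := exists_abs_gaussCorr_le ha hT h1 h2 (1 + T * l)
  obtain ⟨C0, hC0, hb0⟩ := exists_abs_gaussFun_le 0 (1 + T * l)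
  have hπ := hp.1 s0
  rw [Metric.tendsto_atTop']
  intro ε hε
  obtain ⟨M, hM⟩ := exists_nat_gt (2 * (1 + C0) / pst s0 / (ε / 3))
  have hM0 : (0 : ℝ) < M := lt_of_le_of_lt (by positivity) hM
  have hMn : 0 < M := by exact_mod_cast hM0
  have lim1 := h.tendsto_stopVal_gaussCorr hQ hocc s0 ha hT hh1 hh2 hl hMn
  have lim2 : Tendsto (fun n : ℕ => l / (n : ℝ) * K') atTop (𝓝 0) := by
    simpa using (tendsto_const_div_atTop_nhds_zero_nat l).mul_const K'
  have ev := (((Metric.tendsto_nhds.1 lim1 (ε / 3) (by positivity)).and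
    (lim2.eventually_lt_const (show 0 < ε / 3 by positivity))).and
    (eventually_stopVal_aliveInd_le hQs hQi hp hQ hocc s0 hMn)).and (eventually_gt_atTop 0)
  obtain ⟨N, hN⟩ := eventually_atTop.1 ev
  refine ⟨N, fun n hn => ?_⟩
  obtain ⟨⟨⟨e1, e2⟩, e3⟩, hn0⟩ := hN n hn.le
  have hn0' : (0 : ℝ) < n := by exact_mod_cast hn0
  set r := Real.sqrt (l / n) with hr
  have hr2 : r ^ 2 = l / n := Real.sq_sqrt (by positivity)
  have htime : gaussTime T r n = 1 + T * l := by
    rw [gaussTime, hr2, mul_assoc, div_mul_cancel₀ _ hn0'.ne']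
  set f : ℕ → ℝ := fun x => Real.exp (-(l / n * (x : ℝ) ^ 2)) with hf
  have hf1 : ∀ x, |f x| ≤ 1 := fun x => by
    rw [abs_of_nonneg (Real.exp_nonneg _)]
    exact Real.exp_le_one_iff.2 (neg_nonpos.2 (by positivity))
  have A := abs_integral_tauSeq_sub_le X s0 f hf1
    (fun n => (Measurable.of_discrete (f := f)).comp (measurable_fst_tauSeq s0 n)) (M * n) n z
  have B := abs_stopVal_sub_stopVal_le X.stepKernel s0
    (g := fun k z => (1 - aliveInd s0 k z) * f z.1) (g' := gaussCorr a T h1 h2 r)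
    (fun k => ⟨1, fun z => by
      unfold aliveInd
      split_ifs
      · simpa using hf1 z.1
      · simp⟩)
    (fun k => exists_gaussCorr_bdd ha hT h1 h2 r k) n C0 (l / n * K') (fun k hk v => by
      have hkB : gaussTime T r k ≤ 1 + T * l := (gaussTime_mono hT r hk).trans_eq htime
      have b1 : |r ^ 2 * (gaussFun (a + 1) 0 (gaussTime T r k) (r * v.1) * h1 v.2 +
          gaussFun (a + 2) 2 (gaussTime T r k) (r * v.1) * h2 v.2)| ≤ l / n * K' := by
        rw [abs_mul, abs_of_nonneg (sq_nonneg r), hr2]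
        exact mul_le_mul_of_nonneg_left (hbK r k v hkB) (by positivity)
      unfold gaussCorr aliveInd
      split_ifs with h0
      · have : gaussFun a 0 (gaussTime T r k) (r * v.1) = f v.1 := by
          simp only [hf, gaussFun, gaussTime, h0.1, ← hr2]
          simp [mul_pow]
        rw [this, sub_zero, one_mul, sub_add_cancel_left, abs_neg, mul_zero, zero_add]
        exact b1
      · rw [sub_self, zero_mul, zero_sub, abs_neg, mul_one]
        exact (abs_add_le _ _).trans
          (add_le_add (hb0 _ _ _ ha (one_le_gaussTime hT r k) hkB) b1)) (M * n) n le_rfl z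
  have e4 : (1 + C0) * (2 / (pst s0 * M)) < ε / 3 := by
    rw [div_lt_iff₀ (by positivity)] at hM
    calc (1 + C0) * (2 / (pst s0 * M)) = 2 * (1 + C0) / pst s0 / M := by field_simp
      _ < ε / 3 := by rw [div_lt_iff₀ hM0]; linarith
  have e5 := mul_le_mul_of_nonneg_left e3 (show 0 ≤ 1 + C0 by positivity)
  rw [Real.dist_eq] at e1 ⊢
  rw [abs_le] at A B
  rw [abs_lt] at e1 ⊢
  constructor <;> linarith [A.1, A.2, B.1, B.2, e1.1, e1.2]

end

section

open ProbabilityTheory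

lemma integrable_of_ae_mem_Icc {μ : Measure ℝ} [IsProbabilityMeasure μ]
    (h : ∀ᵐ x ∂μ, x ∈ Set.Icc (0 : ℝ) 1) {f : ℝ → ℝ} (hf : Continuous f) : Integrable f μ := by
  obtain ⟨C, hC⟩ := isCompact_Icc.exists_bound_of_continuousOn (hf.continuousOn (s := Set.Icc 0 1))
  exact Integrable.of_bound hf.aestronglyMeasurable C (h.mono fun x hx => hC x hx)

/-- Method of moments on the unit interval. -/
lemma tendsto_of_tendsto_moments {μ : ℕ → ProbabilityMeasure ℝ} {ν : ProbabilityMeasure ℝ}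
    (hμ : ∀ n, ∀ᵐ x ∂(μ n : Measure ℝ), x ∈ Set.Icc (0 : ℝ) 1)
    (hν : ∀ᵐ x ∂(ν : Measure ℝ), x ∈ Set.Icc (0 : ℝ) 1)
    (hm : ∀ k : ℕ, Tendsto (fun n => ∫ x, x ^ k ∂(μ n : Measure ℝ)) atTop
      (𝓝 (∫ x, x ^ k ∂(ν : Measure ℝ)))) :
    Tendsto μ atTop (𝓝 ν) := by
  rw [ProbabilityMeasure.tendsto_iff_forall_integral_tendsto]
  intro f
  have hpoly : ∀ (p : Polynomial ℝ) (ρ : ProbabilityMeasure ℝ),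
      (∀ᵐ x ∂(ρ : Measure ℝ), x ∈ Set.Icc (0 : ℝ) 1) → ∫ x, p.eval x ∂(ρ : Measure ℝ)
        = ∑ k ∈ Finset.range (p.natDegree + 1), p.coeff k * ∫ x, x ^ k ∂(ρ : Measure ℝ) := by
    intro p ρ hρ
    simp_rw [Polynomial.eval_eq_sum_range]
    rw [integral_finsetSum _ fun k _ =>
      (integrable_of_ae_mem_Icc hρ (continuous_pow k)).const_mul (p.coeff k)]
    simp_rw [integral_const_mul]
  have happrox : ∀ (p : Polynomial ℝ) (ε : ℝ), (∀ x ∈ Set.Icc (0 : ℝ) 1, |p.eval x - f x| < ε) →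
      ∀ ρ : ProbabilityMeasure ℝ, (∀ᵐ x ∂(ρ : Measure ℝ), x ∈ Set.Icc (0 : ℝ) 1) →
      |∫ x, p.eval x ∂(ρ : Measure ℝ) - ∫ x, f x ∂(ρ : Measure ℝ)| ≤ ε := by
    intro p ε hp ρ hρ
    rw [← integral_sub (integrable_of_ae_mem_Icc hρ p.continuous)
      (integrable_of_ae_mem_Icc hρ f.continuous)]
    have := norm_integral_le_of_norm_le_const (μ := (ρ : Measure ℝ))
      (f := fun x => p.eval x - f x) (hρ.mono fun x hx => (hp x hx).le)
    simpa using this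
  rw [Metric.tendsto_atTop']
  intro ε hε
  obtain ⟨p, hp⟩ := exists_polynomial_near_of_continuousOn 0 1 f f.continuous.continuousOn (ε / 3)
    (by positivity)
  have hlim : Tendsto (fun n => ∫ x, p.eval x ∂(μ n : Measure ℝ)) atTop
      (𝓝 (∫ x, p.eval x ∂(ν : Measure ℝ))) := by
    rw [hpoly p ν hν]
    refine Tendsto.congr (fun n => (hpoly p (μ n) (hμ n)).symm) ?_
    exact tendsto_finsetSum _ fun k _ => (hm k).const_mul _
  obtain ⟨N, hN⟩ := (Metric.tendsto_atTop'.1 hlim) (ε / 3) (by positivity)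
  refine ⟨N, fun n hn => ?_⟩
  have e1 := hN n hn
  have e2 := happrox p _ hp (μ n) (hμ n)
  have e3 := happrox p _ hp ν hν
  rw [Real.dist_eq, abs_lt] at *
  rw [abs_le] at e2 e3
  constructor <;> linarith [e1.1, e1.2, e2.1, e2.2, e3.1, e3.2]

/-- The density of the square root of a Gamma random variable. -/
noncomputable def sqrtGammaDensity (a t u : ℝ) : ℝ :=
  2 * u ^ (2 * a - 1) * Real.exp (-(u ^ 2) / t) / (t ^ a * Real.Gamma a)

section

variable {a t : ℝ}

lemma measurable_sqrtGammaDensity : Measurable (sqrtGammaDensity a t) := by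
  unfold sqrtGammaDensity
  fun_prop

lemma sqrtGammaDensity_nonneg (ha : 0 < a) (ht : 0 < t) {u : ℝ} (hu : 0 < u) :
    0 ≤ sqrtGammaDensity a t u := by
  have := Real.Gamma_pos_of_pos ha
  unfold sqrtGammaDensity
  positivity

lemma integral_exp_mul_sqrtGammaDensity (ha : 0 < a) (ht : 0 < t) {l : ℝ} (hl : 0 ≤ l) :
    ∫ u in Set.Ioi (0 : ℝ), sqrtGammaDensity a t u * Real.exp (-(l * u ^ 2))
      = (1 + t * l) ^ (-a) := by
  have hG := Real.Gamma_pos_of_pos ha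
  have hb : 0 < l + 1 / t := by positivity
  have key := integral_rpow_mul_exp_neg_mul_rpow (p := 2) (q := 2 * a - 1) (b := l + 1 / t)
    two_pos (by linarith) hb
  have e1 : ∀ u : ℝ, sqrtGammaDensity a t u * Real.exp (-(l * u ^ 2))
      = 2 / (t ^ a * Real.Gamma a) * (u ^ (2 * a - 1) * Real.exp (-(l + 1 / t) * u ^ (2 : ℝ))) := by
    intro u
    rw [Real.rpow_two, show -(l + 1 / t) * u ^ 2 = -(u ^ 2) / t + -(l * u ^ 2) by ring,
      Real.exp_add,
      sqrtGammaDensity]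
    ring
  simp_rw [e1]
  rw [integral_const_mul, key, show -(2 * a - 1 + 1) / 2 = -a by ring,
    show (2 * a - 1 + 1) / 2 = a by ring, show 1 + t * l = t * (l + 1 / t) by field_simp; ring,
    Real.mul_rpow ht.le hb.le, Real.rpow_neg ht.le]
  field_simp

/-- The law of the square root of a Gamma random variable. -/
noncomputable def sqrtGammaMeasure (a t : ℝ) : Measure ℝ :=
  (volume.restrict (Set.Ioi 0)).withDensity fun u => ENNReal.ofReal (sqrtGammaDensity a t u)

lemma integrable_sqrtGammaDensity (ha : 0 < a) (ht : 0 < t) :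
    IntegrableOn (sqrtGammaDensity a t) (Set.Ioi 0) := by
  have := integral_exp_mul_sqrtGammaDensity ha ht le_rfl
  simp only [zero_mul, neg_zero, Real.exp_zero, mul_one, mul_zero, add_zero, Real.one_rpow] at this
  exact integrable_of_integral_eq_one this

lemma isProbabilityMeasure_sqrtGammaMeasure (ha : 0 < a) (ht : 0 < t) :
    IsProbabilityMeasure (sqrtGammaMeasure a t) := by
  have := integral_exp_mul_sqrtGammaDensity ha ht le_rfl
  simp only [zero_mul, neg_zero, Real.exp_zero, mul_one, mul_zero, add_zero, Real.one_rpow] at this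
  refine ⟨?_⟩
  rw [sqrtGammaMeasure, withDensity_apply _ MeasurableSet.univ, Measure.restrict_univ,
    ← ofReal_integral_eq_lintegral_ofReal (integrable_sqrtGammaDensity ha ht), this,
    ENNReal.ofReal_one]
  exact (ae_restrict_mem measurableSet_Ioi).mono fun u hu => sqrtGammaDensity_nonneg ha ht hu

lemma integral_exp_sqrtGammaMeasure (ha : 0 < a) (ht : 0 < t) {l : ℝ} (hl : 0 ≤ l) :
    ∫ u, Real.exp (-(l * u ^ 2)) ∂(sqrtGammaMeasure a t) = (1 + t * l) ^ (-a) := by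
  rw [sqrtGammaMeasure, integral_withDensity_eq_integral_toReal_smul
    measurable_sqrtGammaDensity.ennreal_ofReal (ae_of_all _ fun _ => ENNReal.ofReal_lt_top),
    ← integral_exp_mul_sqrtGammaDensity ha ht hl]
  refine setIntegral_congr_fun measurableSet_Ioi fun u hu => ?_
  simp only [smul_eq_mul]
  rw [ENNReal.toReal_ofReal (sqrtGammaDensity_nonneg ha ht hu)]

lemma sqrtGammaMeasure_real_Iic (ha : 0 < a) (ht : 0 < t) {y : ℝ} (hy : 0 ≤ y) :
    (sqrtGammaMeasure a t).real (Set.Iic y) = Fdist a t y := by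
  have h1 : Set.Iic y ∩ Set.Ioi (0 : ℝ) = Set.Ioc 0 y := by
    rw [Set.inter_comm, Set.Ioi_inter_Iic]
  have hnn : 0 ≤ᵐ[volume.restrict (Set.Ioc 0 y)] sqrtGammaDensity a t :=
    (ae_restrict_mem measurableSet_Ioc).mono fun u hu => sqrtGammaDensity_nonneg ha ht hu.1
  rw [measureReal_def, sqrtGammaMeasure, withDensity_apply _ measurableSet_Iic,
    Measure.restrict_restrict measurableSet_Iic, h1,
    ← ofReal_integral_eq_lintegral_ofReal
      ((integrable_sqrtGammaDensity ha ht).mono_set Set.Ioc_subset_Ioi_self) hnn,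
    ENNReal.toReal_ofReal (integral_nonneg_of_ae hnn), Fdist, intervalIntegral.integral_of_le hy]
  rfl

lemma sqrtGammaMeasure_singleton (y : ℝ) : sqrtGammaMeasure a t {y} = 0 :=
  (withDensity_absolutelyContinuous _ _) (by simp)

lemma sqrtGammaMeasure_Iic_zero : sqrtGammaMeasure a t (Set.Iic 0) = 0 := by
  refine (withDensity_absolutelyContinuous _ _) ?_
  rw [Measure.restrict_apply measurableSet_Iic, Set.Iic_inter_Ioi, Set.Ioc_self, measure_empty]

end

/-- Convergence of the Laplace transforms of `W ^ 2` to that of a Gamma law implies convergence of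
the distribution functions of `W`. -/
lemma tendsto_measure_le_of_laplace {Ω : Type*} [MeasurableSpace Ω] {μ : Measure Ω}
    [IsProbabilityMeasure μ] {W : ℕ → Ω → ℝ} (hW : ∀ n, Measurable (W n)) (hW0 : ∀ n ω, 0 ≤ W n ω)
    {a t : ℝ} (ha : 0 < a) (ht : 0 < t)
    (hlap : ∀ k : ℕ, Tendsto (fun n => ∫ ω, Real.exp (-(k * W n ω ^ 2)) ∂μ) atTop
      (𝓝 ((1 + t * k) ^ (-a)))) {y : ℝ} (hy : 0 ≤ y) :
    Tendsto (fun n => (μ {ω | W n ω ≤ y}).toReal) atTop (𝓝 (Fdist a t y)) := by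
  have hprob := isProbabilityMeasure_sqrtGammaMeasure ha ht
  set φ : ℝ → ℝ := fun u => Real.exp (-u ^ 2) with hφ
  have hφm : Measurable φ := by fun_prop
  have hφ01 : ∀ u, φ u ∈ Set.Icc (0 : ℝ) 1 := fun u =>
    ⟨Real.exp_nonneg _, Real.exp_le_one_iff.2 (by simpa using sq_nonneg u)⟩
  have hφW : ∀ n, Measurable fun ω => φ (W n ω) := fun n => hφm.comp (hW n)
  have hφle : ∀ {u v : ℝ}, 0 ≤ u → 0 ≤ v → (φ v ≤ φ u ↔ u ≤ v) := fun {u v} hu hv => by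
    rw [hφ, Real.exp_le_exp, neg_le_neg_iff, sq_le_sq₀ hu hv]
  have hae : ∀ᵐ u ∂(sqrtGammaMeasure a t), 0 < u := by
    rw [ae_iff]
    simp only [not_lt]
    exact sqrtGammaMeasure_Iic_zero
  let ρ : ℕ → ProbabilityMeasure ℝ := fun n =>
    ⟨μ.map fun ω => φ (W n ω), Measure.isProbabilityMeasure_map (hφW n).aemeasurable⟩
  let ν : ProbabilityMeasure ℝ :=
    ⟨(sqrtGammaMeasure a t).map φ, Measure.isProbabilityMeasure_map hφm.aemeasurable⟩
  have hpow : ∀ (k : ℕ) u, φ u ^ k = Real.exp (-(k * u ^ 2)) := fun k u => by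
    rw [hφ, ← Real.exp_nat_mul]
    congr 1
    ring
  have hlim : Tendsto ρ atTop (𝓝 ν) := by
    refine tendsto_of_tendsto_moments
      (fun n => (ae_map_iff (hφW n).aemeasurable measurableSet_Icc).2 (ae_of_all _ fun _ => hφ01 _))
      ((ae_map_iff hφm.aemeasurable measurableSet_Icc).2 (ae_of_all _ fun _ => hφ01 _))
      fun k => ?_
    have e1 : ∫ x, x ^ k ∂(ν : Measure ℝ) = (1 + t * k) ^ (-a) := by
      rw [← integral_exp_sqrtGammaMeasure ha ht k.cast_nonneg]
      simp_rw [← hpow]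
      exact integral_map hφm.aemeasurable (continuous_pow k).aestronglyMeasurable
    have e2 : ∀ n, ∫ x, x ^ k ∂(ρ n : Measure ℝ) = ∫ ω, Real.exp (-(k * W n ω ^ 2)) ∂μ := by
      intro n
      simp_rw [← hpow]
      exact integral_map (hφW n).aemeasurable (continuous_pow k).aestronglyMeasurable
    rw [e1]
    exact (hlap k).congr fun n => (e2 n).symm
  have hfr : (ν : Measure ℝ) (frontier (Set.Ici (φ y))) = 0 := by
    rw [frontier_Ici]
    change (sqrtGammaMeasure a t).map φ {φ y} = 0
    rw [Measure.map_apply hφm (measurableSet_singleton _)]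
    have : φ ⁻¹' {φ y} ⊆ {y} ∪ Set.Iic 0 := by
      intro u hu
      rcases le_or_gt u 0 with h | h
      · exact Or.inr h
      · refine Or.inl ?_
        have hu' : φ u = φ y := hu
        exact le_antisymm ((hφle h.le hy).1 hu'.ge) ((hφle hy h.le).1 hu'.le)
    exact measure_mono_null this
      (measure_union_null (sqrtGammaMeasure_singleton y) sqrtGammaMeasure_Iic_zero)
  have := (ENNReal.tendsto_toReal (measure_ne_top _ _)).comp
    (ProbabilityMeasure.tendsto_measure_of_null_frontier_of_tendsto' hlim hfr)
  have e1 : ((ν : Measure ℝ) (Set.Ici (φ y))).toReal = Fdist a t y := by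
    rw [← sqrtGammaMeasure_real_Iic ha ht hy, measureReal_def]
    congr 1
    change (sqrtGammaMeasure a t).map φ (Set.Ici (φ y)) = _
    rw [Measure.map_apply hφm measurableSet_Ici]
    refine measure_congr (hae.mono fun u hu => ?_)
    exact propext (hφle hu.le hy)
  rw [e1] at this
  refine this.congr fun n => ?_
  change (μ.map (fun ω => φ (W n ω)) (Set.Ici (φ y))).toReal = _
  rw [Measure.map_apply (hφW n) measurableSet_Ici]
  congr 2
  ext ω
  exact hφle (hW0 n ω) hy

end

/-- Lemma (weak limit for the embedded chain): under (B_p) for some `p > 4`, (Q_∞) with `q`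
aperiodic and (M_L), if `Σ_i (2c_i + s_i²) π(i) > 0` then
`P[n^{-1/2} Y_n ≤ x] → F_{α,θ}(x √π(s0))`. -/
theorem stmt17 (X : MChain (ℕ × S)) (hirr : X.Irreducible) (s0 : S)
    (p : ℝ) (hp : 4 < p) (hB : CondB X p)
    (Q : S → S → ℝ) (pst : S → ℝ) (hQ : CondQ X Q) (hpst : IsStationaryDist Q pst)
    (hap : IsAperiodicMatrix Q)
    (c s2 : S → ℝ) (hML : CondML X c s2)
    (hpos : 0 < ∑ i, (2 * c i + s2 i) * pst i) :
    ∀ (z : ℕ × S) (x : ℝ), 0 ≤ x →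
      Tendsto (fun n : ℕ =>
          (X.P z {ω | ((ω (tauSeq s0 ω n)).1 : ℝ) ≤ Real.sqrt n * x}).toReal)
        atTop
        (nhds (Fdist (1 / 2 + (∑ i, c i * pst i) / (∑ i, s2 i * pst i))
          (2 * ∑ i, s2 i * pst i) (x * Real.sqrt (pst s0)))) := by
  intro z x hx
  set A := ∑ i, c i * pst i with hA
  set B := ∑ i, s2 i * pst i with hBdef
  have hsum : ∑ i, (2 * c i + s2 i) * pst i = 2 * A + B := by
    simp_rw [hA, hBdef, add_mul, Finset.sum_add_distrib, Finset.mul_sum, mul_assoc]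
  have hs0 := hpst.1 s0
  have hBpos : 0 < B := by
    obtain ⟨i, hi⟩ := hML.2.1
    exact Finset.sum_pos' (fun j _ => mul_nonneg (hML.1 j) (hpst.1 j).le)
      ⟨i, Finset.mem_univ i, mul_pos ((hML.1 i).lt_of_ne' hi) (hpst.1 i)⟩
  have haB : (1 / 2 + A / B) * (2 * B) = 2 * A + B := by field_simp; ring
  have ha : 0 < 1 / 2 + A / B := by
    rw [hsum, ← haB] at hpos
    exact pos_of_mul_pos_left hpos (by positivity)
  have hlam := hasLam_stepKernel X hp hB hML
  have hlim := qLim_stepKernel X hQ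
  have hocc := hlam.tendsto_occup hQ.2.1 hQ.2.2 hpst hlim hBpos hpos
    (X.pow_ne_zero_of_irreducible hirr) z
  have hn : ∀ n : ℕ, (0 : ℝ) ≤ pst s0 / n := fun n => div_nonneg hs0.le n.cast_nonneg
  have key := tendsto_measure_le_of_laplace (μ := X.P z)
    (W := fun n ω => Real.sqrt (pst s0 / n) * ((ω (tauSeq s0 ω n)).1 : ℝ))
    (fun n => ((Measurable.of_discrete (f := fun m : ℕ => (m : ℝ))).comp
      (measurable_fst_tauSeq s0 n)).const_mul _)
    (fun n ω => mul_nonneg (Real.sqrt_nonneg _) (Nat.cast_nonneg _)) ha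
    (show 0 < 2 * B by positivity) (fun k => by
      have := tendsto_integral_exp X hQ.2.1 hQ.2.2 hpst hlim hlam hocc s0 ha.le
        (T := 2 * B / pst s0) (by positivity)
        (by rw [hsum, ← haB]; field_simp) (by field_simp; rfl)
        (l := k * pst s0) (by positivity)
      rw [show 2 * B / pst s0 * (k * pst s0) = 2 * B * k by field_simp] at this
      refine this.congr fun n => ?_
      simp_rw [mul_pow, Real.sq_sqrt (hn n), ← mul_assoc, mul_div_assoc])
    (mul_nonneg hx (Real.sqrt_nonneg (pst s0)))
  refine key.congr' ((eventually_gt_atTop 0).mono fun n hn0 => ?_)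
  have hsn : 0 < Real.sqrt n := Real.sqrt_pos.2 (Nat.cast_pos.2 hn0)
  have hsp : 0 < Real.sqrt (pst s0) := Real.sqrt_pos.2 hs0
  congr 2
  ext ω
  simp only [Set.mem_ofPred_eq]
  rw [Real.sqrt_div hs0.le, div_mul_eq_mul_div, div_le_iff₀ hsn, mul_comm, mul_right_comm,
    mul_le_mul_iff_left₀ hsp, mul_comm x]
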